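/- Let (I_n) be the internal DLA process on Z^d started from I_0 = {0}, built from independent simple random walks started at the origin. Let ω_d be the volume of the d-dimensional Euclidean unit ball and B_n = {x ∈ Z^d : |x| ≤ n}. Then for any ε > 0, with probability 1, B_{n(1−ε)} ⊂ I_{⌊ω_d n^d⌋} ⊂ B_{n(1+ε)} for all sufficiently large n. -/

import Mathlib

open MeasureTheory Filter Topology

/-- The lattice neighbors of a point of `ℤ^d` (the `2d` points at `ℓ¹`-distance one). -/
noncomputable def latNbrs {d : ℕ} (x : Fin d → ℤ) : Finset (Fin d → ℤ) :=
  (Finset.univ ×ˢ ({1, -1} : Finset ℤ)).image (fun p => Function.update x p.1 (x p.1 + p.2))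

open Classical in
/-- Probability that the random walk which at each step moves uniformly to one of the
points in `nbr ·`, started at `x`, hits the set `A` within `n` steps, with first
hitting position `y`. -/
noncomputable def hitP {V : Type*} (nbr : V → Finset V) (A : Set V) : ℕ → V → V → ℝ
  | 0, x, y => if x ∈ A ∧ x = y then 1 else 0
  | n+1, x, y =>
      if x ∈ A then (if x = y then 1 else 0)
      else ((nbr x).card : ℝ)⁻¹ * ∑ z ∈ nbr x, hitP nbr A n z y

/-- The hitting distribution `H_A(x,y)`: probability that the random walk started at `x`
ever hits `A`, with first hitting position `y` (monotone limit of `hitP`). -/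
noncomputable def hitMeas {V : Type*} (nbr : V → Finset V) (A : Set V) (x y : V) : ℝ :=
  ⨆ n, hitP nbr A n x y

/-- Outer boundary of a finite set. -/
noncomputable def bdryF {V : Type*} [DecidableEq V] (nbr : V → Finset V) (A : Finset V) :
    Finset V :=
  A.biUnion nbr \ A

/-- Euclidean norm of a lattice point. -/
noncomputable def eunorm {d : ℕ} (x : Fin d → ℤ) : ℝ := Real.sqrt (∑ i, ((x i : ℝ)) ^ 2)
/-- The lattice ball of (real) radius `r` in `ℤ^d`. -/
def latBall {d : ℕ} (r : ℝ) : Set (Fin d → ℤ) := {x | eunorm x ≤ r}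

/-- The volume `ω_d` of the `d`-dimensional Euclidean unit ball. -/
noncomputable def unitBallVol (d : ℕ) : ℝ :=
  (MeasureTheory.volume (Metric.ball (0 : EuclideanSpace ℝ (Fin d)) 1)).toReal

namespace InternalDLA

/-! ### The lattice Laplacian and the maximum principle -/

/-- The (unnormalised) graph Laplacian on `ℤ^d`. -/
noncomputable def lap {d : ℕ} (f : (Fin d → ℤ) → ℝ) (x : Fin d → ℤ) : ℝ :=
  ∑ i, (f (x + Pi.single i 1) + f (x - Pi.single i 1) - 2 * f x)

section Laplacian

variable {d : ℕ}

lemma update_add_eq (x : Fin d → ℤ) (i : Fin d) (c : ℤ) :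
    Function.update x i (x i + c) = x + Pi.single i c := by
  ext j
  by_cases h : j = i
  · subst h; simp
  · simp [h]

lemma mem_latNbrs {x y : Fin d → ℤ} :
    y ∈ latNbrs x ↔ ∃ i, y = x + Pi.single i 1 ∨ y = x - Pi.single i 1 := by
  have key : ∀ i : Fin d, x + Pi.single i (-1) = x - Pi.single i 1 := fun i => by
    rw [Pi.single_neg, sub_eq_add_neg]
  simp only [latNbrs, Finset.mem_image, Finset.mem_product, Finset.mem_univ, true_and,
    Finset.mem_insert, Finset.mem_singleton, Prod.exists, update_add_eq]
  constructor
  · rintro ⟨i, c, rfl | rfl, rfl⟩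
    · exact ⟨i, Or.inl rfl⟩
    · exact ⟨i, Or.inr (key i)⟩
  · rintro ⟨i, rfl | rfl⟩
    · exact ⟨i, 1, Or.inl rfl, rfl⟩
    · exact ⟨i, -1, Or.inr rfl, key i⟩

lemma latNbrs_injOn (x : Fin d → ℤ) :
    Set.InjOn (fun p : Fin d × ℤ => Function.update x p.1 (x p.1 + p.2))
      ↑((Finset.univ : Finset (Fin d)) ×ˢ ({1, -1} : Finset ℤ)) := by
  rintro ⟨i, a⟩ ha ⟨j, b⟩ hb h
  simp only [update_add_eq] at h
  have h' : (Pi.single i a : Fin d → ℤ) = Pi.single j b := add_left_cancel h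
  have ha' : a ≠ 0 := by
    simp at ha; rcases ha with rfl | rfl <;> norm_num
  have hij : i = j := by
    by_contra hne
    have := congrFun h' i
    rw [Pi.single_eq_same, Pi.single_eq_of_ne hne] at this
    exact ha' this
  subst hij
  have := congrFun h' i
  simp at this
  rw [this]

lemma card_latNbrs (x : Fin d → ℤ) : (latNbrs x).card = 2 * d := by
  rw [latNbrs, Finset.card_image_of_injOn (latNbrs_injOn x), Finset.card_product]
  simp [mul_comm]

lemma sum_latNbrs (f : (Fin d → ℤ) → ℝ) (x : Fin d → ℤ) :
    ∑ y ∈ latNbrs x, f y = ∑ i, (f (x + Pi.single i 1) + f (x - Pi.single i 1)) := by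
  rw [latNbrs, Finset.sum_image (latNbrs_injOn x), Finset.sum_product]
  refine Finset.sum_congr rfl fun i _ => ?_
  rw [Finset.sum_pair (by norm_num)]
  simp only [update_add_eq, Pi.single_neg, sub_eq_add_neg]

lemma lap_eq_sum_latNbrs (f : (Fin d → ℤ) → ℝ) (x : Fin d → ℤ) :
    lap f x = ∑ y ∈ latNbrs x, f y - 2 * d * f x := by
  rw [sum_latNbrs, lap, Finset.sum_sub_distrib]
  simp; ring

lemma lap_sub (f g : (Fin d → ℤ) → ℝ) (x : Fin d → ℤ) :
    lap (fun y => f y - g y) x = lap f x - lap g x := by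
  rw [lap, lap, lap, ← Finset.sum_sub_distrib]
  exact Finset.sum_congr rfl fun i _ => by ring

lemma lap_add (f g : (Fin d → ℤ) → ℝ) (x : Fin d → ℤ) :
    lap (fun y => f y + g y) x = lap f x + lap g x := by
  rw [lap, lap, lap, ← Finset.sum_add_distrib]
  exact Finset.sum_congr rfl fun i _ => by ring

lemma lap_const_mul (c : ℝ) (f : (Fin d → ℤ) → ℝ) (x : Fin d → ℤ) :
    lap (fun y => c * f y) x = c * lap f x := by
  rw [lap, lap, Finset.mul_sum]
  exact Finset.sum_congr rfl fun i _ => by ring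

lemma lap_const (c : ℝ) (x : Fin d → ℤ) : lap (fun _ => c) x = 0 := by
  rw [lap]; exact Finset.sum_eq_zero fun i _ => by ring

lemma lap_sum {ι : Type*} (s : Finset ι) (f : ι → (Fin d → ℤ) → ℝ) (x : Fin d → ℤ) :
    lap (fun y => ∑ j ∈ s, f j y) x = ∑ j ∈ s, lap (f j) x := by
  simp only [lap, Finset.mul_sum]
  rw [Finset.sum_comm]
  exact Finset.sum_congr rfl fun i _ => by
    rw [Finset.sum_sub_distrib, Finset.sum_add_distrib]

lemma mem_latNbrs_comm {x y : Fin d → ℤ} : y ∈ latNbrs x ↔ x ∈ latNbrs y := by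
  simp only [mem_latNbrs]
  constructor <;> rintro ⟨i, rfl | rfl⟩ <;> refine ⟨i, ?_⟩ <;> simp

lemma add_single_mem_latNbrs (x : Fin d → ℤ) (i : Fin d) : x + Pi.single i 1 ∈ latNbrs x :=
  mem_latNbrs.2 ⟨i, Or.inl rfl⟩

lemma sub_single_mem_latNbrs (x : Fin d → ℤ) (i : Fin d) : x - Pi.single i 1 ∈ latNbrs x :=
  mem_latNbrs.2 ⟨i, Or.inr rfl⟩

lemma mem_bdryF {A : Finset (Fin d → ℤ)} {y : Fin d → ℤ} :
    y ∈ bdryF latNbrs A ↔ (∃ x ∈ A, y ∈ latNbrs x) ∧ y ∉ A := by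
  simp [bdryF]

lemma mem_or_mem_bdryF {A : Finset (Fin d → ℤ)} {x y : Fin d → ℤ} (hx : x ∈ A)
    (hy : y ∈ latNbrs x) : y ∈ A ∨ y ∈ bdryF latNbrs A := by
  by_cases h : y ∈ A
  · exact Or.inl h
  · exact Or.inr (mem_bdryF.2 ⟨⟨x, hx, hy⟩, h⟩)

lemma notMem_of_mem_bdryF {A : Finset (Fin d → ℤ)} {y : Fin d → ℤ}
    (hy : y ∈ bdryF latNbrs A) : y ∉ A := (mem_bdryF.1 hy).2

/-- Maximum principle for subharmonic functions on a finite set. -/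
lemma max_principle (hd : 0 < d) (A : Finset (Fin d → ℤ)) (f : (Fin d → ℤ) → ℝ) (c : ℝ)
    (hf : ∀ x ∈ A, 0 ≤ lap f x) (hb : ∀ y ∈ bdryF latNbrs A, f y ≤ c) :
    ∀ x ∈ A, f x ≤ c := by
  by_contra! hcon
  obtain ⟨x₁, hx₁, hc₁⟩ := hcon
  obtain ⟨x₂, hx₂, hmax⟩ := A.exists_max_image f ⟨x₁, hx₁⟩
  have hc₂ : c < f x₂ := hc₁.trans_le (hmax x₁ hx₁)
  let i₀ : Fin d := ⟨0, hd⟩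
  obtain ⟨x, hx, hxmax⟩ := (A.filter fun x => f x = f x₂).exists_max_image (fun x => x i₀)
    ⟨x₂, by simp [hx₂]⟩
  rw [Finset.mem_filter] at hx
  have hle : ∀ y ∈ latNbrs x, f y ≤ f x := by
    intro y hy
    rcases mem_or_mem_bdryF hx.1 hy with h | h
    · rw [hx.2]; exact hmax y h
    · rw [hx.2]; exact (hb y h).trans hc₂.le
  have hlap := hf x hx.1
  have hlt : f (x + Pi.single i₀ 1) < f x := by
    rcases mem_or_mem_bdryF hx.1 (add_single_mem_latNbrs x i₀) with h | h
    · refine lt_of_le_of_ne (hle _ (add_single_mem_latNbrs x i₀)) fun heq => ?_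
      have := hxmax (x + Pi.single i₀ 1) (by rw [Finset.mem_filter]; exact ⟨h, heq.trans hx.2⟩)
      simp at this
    · rw [hx.2]; exact (hb _ h).trans_lt hc₂
  have : lap f x < 0 := by
    rw [lap]
    refine Finset.sum_neg' (fun i _ => ?_) ⟨i₀, Finset.mem_univ _, ?_⟩
    · linarith [hle _ (add_single_mem_latNbrs x i), hle _ (sub_single_mem_latNbrs x i)]
    · linarith [hle _ (sub_single_mem_latNbrs x i₀)]
  linarith

/-- Comparison principle on a finite set. -/
lemma comparison (hd : 0 < d) (A : Finset (Fin d → ℤ)) (f g : (Fin d → ℤ) → ℝ)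
    (hf : ∀ x ∈ A, 0 ≤ lap f x) (hg : ∀ x ∈ A, lap g x ≤ 0)
    (hb : ∀ y ∈ bdryF latNbrs A, f y ≤ g y) : ∀ x ∈ A, f x ≤ g x := by
  have := max_principle hd A (fun y => f y - g y) 0
    (fun x hx => by rw [lap_sub]; linarith [hf x hx, hg x hx])
    (fun y hy => by linarith [hb y hy])
  intro x hx
  linarith [this x hx]

/-! ### Hitting distributions -/

lemma hitP_nonneg (B : Set (Fin d → ℤ)) (n : ℕ) (x y : Fin d → ℤ) :
    0 ≤ hitP latNbrs B n x y := by
  induction n generalizing x with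
  | zero => rw [hitP]; split_ifs <;> norm_num
  | succ n ih =>
    rw [hitP]
    split_ifs
    · norm_num
    · norm_num
    · exact mul_nonneg (by positivity) (Finset.sum_nonneg fun z _ => ih z)

lemma hitP_le_one (B : Set (Fin d → ℤ)) (n : ℕ) (x y : Fin d → ℤ) :
    hitP latNbrs B n x y ≤ 1 := by
  induction n generalizing x with
  | zero => rw [hitP]; split_ifs <;> norm_num
  | succ n ih =>
    rw [hitP]
    split_ifs
    · norm_num
    · norm_num
    · rcases Nat.eq_zero_or_pos (latNbrs x).card with h | h
      · simp [h]
      · rw [inv_mul_le_iff₀ (by exact_mod_cast h), mul_one]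
        calc ∑ z ∈ latNbrs x, hitP latNbrs B n z y ≤ ∑ z ∈ latNbrs x, 1 :=
              Finset.sum_le_sum fun z _ => ih z
          _ = _ := by simp

lemma hitP_of_mem {B : Set (Fin d → ℤ)} (n : ℕ) {x : Fin d → ℤ} (y : Fin d → ℤ) (hx : x ∈ B) :
    hitP latNbrs B n x y = if x = y then 1 else 0 := by
  cases n with
  | zero => rw [hitP]; simp [hx]
  | succ n => rw [hitP]; simp [hx]

lemma hitP_succ_of_notMem {B : Set (Fin d → ℤ)} (n : ℕ) {x : Fin d → ℤ} (y : Fin d → ℤ)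
    (hx : x ∉ B) :
    hitP latNbrs B (n + 1) x y = ((latNbrs x).card : ℝ)⁻¹ * ∑ z ∈ latNbrs x, hitP latNbrs B n z y := by
  rw [hitP]; simp [hx]

lemma hitP_mono (B : Set (Fin d → ℤ)) (x y : Fin d → ℤ) :
    Monotone fun n => hitP latNbrs B n x y := by
  refine monotone_nat_of_le_succ fun n => ?_
  induction n generalizing x with
  | zero =>
    by_cases hx : x ∈ B
    · rw [hitP_of_mem _ _ hx, hitP_of_mem _ _ hx]
    · have : hitP latNbrs B 0 x y = 0 := by rw [hitP]; simp [hx]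
      rw [this]; exact hitP_nonneg _ _ _ _
  | succ n ih =>
    by_cases hx : x ∈ B
    · rw [hitP_of_mem _ _ hx, hitP_of_mem _ _ hx]
    · rw [hitP_succ_of_notMem _ _ hx, hitP_succ_of_notMem _ _ hx]
      exact mul_le_mul_of_nonneg_left (Finset.sum_le_sum fun z _ => ih z) (by positivity)

lemma tendsto_hitP (B : Set (Fin d → ℤ)) (x y : Fin d → ℤ) :
    Tendsto (fun n => hitP latNbrs B n x y) atTop (𝓝 (hitMeas latNbrs B x y)) :=
  tendsto_atTop_ciSup (hitP_mono B x y) ⟨1, by rintro _ ⟨n, rfl⟩; exact hitP_le_one B n x y⟩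

lemma hitMeas_nonneg (B : Set (Fin d → ℤ)) (x y : Fin d → ℤ) : 0 ≤ hitMeas latNbrs B x y :=
  ge_of_tendsto' (tendsto_hitP B x y) fun n => hitP_nonneg B n x y

lemma hitMeas_of_mem {B : Set (Fin d → ℤ)} {x : Fin d → ℤ} (y : Fin d → ℤ) (hx : x ∈ B) :
    hitMeas latNbrs B x y = if x = y then 1 else 0 := by
  simp only [hitMeas, hitP_of_mem _ _ hx, ciSup_const]

lemma hitMeas_of_notMem {B : Set (Fin d → ℤ)} {x : Fin d → ℤ} (y : Fin d → ℤ) (hx : x ∉ B) :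
    hitMeas latNbrs B x y
      = ((latNbrs x).card : ℝ)⁻¹ * ∑ z ∈ latNbrs x, hitMeas latNbrs B z y := by
  have h1 := (tendsto_hitP B x y).comp (tendsto_add_atTop_nat 1)
  refine tendsto_nhds_unique h1 ?_
  simp only [Function.comp_def, hitP_succ_of_notMem _ _ hx]
  exact (tendsto_finsetSum _ fun z _ => tendsto_hitP B z y).const_mul _

/-- The expected value of `F` at the first exit point from `A` of a simple random walk started
at `x`. -/
noncomputable def exitMean (A : Finset (Fin d → ℤ)) (F : (Fin d → ℤ) → ℝ) (x : Fin d → ℤ) : ℝ :=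
  ∑ y ∈ bdryF latNbrs A, hitMeas latNbrs (↑(bdryF latNbrs A)) x y * F y

lemma exitMean_of_mem_bdryF {A : Finset (Fin d → ℤ)} (F : (Fin d → ℤ) → ℝ) {x : Fin d → ℤ}
    (hx : x ∈ bdryF latNbrs A) : exitMean A F x = F x := by
  rw [exitMean, Finset.sum_eq_single x]
  · rw [hitMeas_of_mem _ (by exact_mod_cast hx)]; simp
  · intro y _ hy
    rw [hitMeas_of_mem _ (by exact_mod_cast hx)]; simp [hy.symm]
  · intro h; exact absurd hx h

lemma lap_hitMeas (hd : 0 < d) {B : Set (Fin d → ℤ)} {x : Fin d → ℤ} (y : Fin d → ℤ)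
    (hx : x ∉ B) : lap (fun z => hitMeas latNbrs B z y) x = 0 := by
  rw [lap_eq_sum_latNbrs, hitMeas_of_notMem y hx, card_latNbrs]
  have : (d : ℝ) ≠ 0 := by exact_mod_cast hd.ne'
  push_cast
  field_simp
  ring

lemma lap_exitMean (hd : 0 < d) {A : Finset (Fin d → ℤ)} (F : (Fin d → ℤ) → ℝ) {x : Fin d → ℤ}
    (hx : x ∈ A) : lap (exitMean A F) x = 0 := by
  have hx' : x ∉ (↑(bdryF latNbrs A) : Set (Fin d → ℤ)) := fun h =>
    notMem_of_mem_bdryF (by exact_mod_cast h) hx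
  have : exitMean A F = fun z => ∑ y ∈ bdryF latNbrs A,
      F y * hitMeas latNbrs (↑(bdryF latNbrs A)) z y := by
    ext z; exact Finset.sum_congr rfl fun y _ => mul_comm _ _
  rw [this, lap_sum]
  exact Finset.sum_eq_zero fun y _ => by rw [lap_const_mul, lap_hitMeas hd y hx', mul_zero]

lemma exitMean_mono {A : Finset (Fin d → ℤ)} {F G : (Fin d → ℤ) → ℝ} (x : Fin d → ℤ)
    (h : ∀ y ∈ bdryF latNbrs A, F y ≤ G y) : exitMean A F x ≤ exitMean A G x :=
  Finset.sum_le_sum fun y hy => mul_le_mul_of_nonneg_left (h y hy) (hitMeas_nonneg _ _ _)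

lemma exitMean_nonneg {A : Finset (Fin d → ℤ)} {F : (Fin d → ℤ) → ℝ} (x : Fin d → ℤ)
    (h : ∀ y ∈ bdryF latNbrs A, 0 ≤ F y) : 0 ≤ exitMean A F x :=
  Finset.sum_nonneg fun y hy => mul_nonneg (hitMeas_nonneg _ _ _) (h y hy)

lemma exitMean_add (A : Finset (Fin d → ℤ)) (F G : (Fin d → ℤ) → ℝ) (x : Fin d → ℤ) :
    exitMean A (fun y => F y + G y) x = exitMean A F x + exitMean A G x := by
  simp only [exitMean, mul_add, Finset.sum_add_distrib]

lemma exitMean_const_mul (A : Finset (Fin d → ℤ)) (c : ℝ) (F : (Fin d → ℤ) → ℝ)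
    (x : Fin d → ℤ) : exitMean A (fun y => c * F y) x = c * exitMean A F x := by
  simp only [exitMean, Finset.mul_sum]
  exact Finset.sum_congr rfl fun y _ => by ring

lemma exitMean_sum {ι : Type*} (A : Finset (Fin d → ℤ)) (s : Finset ι)
    (F : ι → (Fin d → ℤ) → ℝ) (x : Fin d → ℤ) :
    exitMean A (fun y => ∑ j ∈ s, F j y) x = ∑ j ∈ s, exitMean A (F j) x := by
  simp only [exitMean, Finset.mul_sum]
  rw [Finset.sum_comm]

lemma le_exitMean (hd : 0 < d) {A : Finset (Fin d → ℤ)} {F : (Fin d → ℤ) → ℝ}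
    (hF : ∀ x ∈ A, 0 ≤ lap F x) {x : Fin d → ℤ} (hx : x ∈ A) : F x ≤ exitMean A F x :=
  comparison hd A F (exitMean A F) hF (fun _ hz => (lap_exitMean hd F hz).le)
    (fun _ hy => (exitMean_of_mem_bdryF F hy).ge) x hx

lemma exitMean_le (hd : 0 < d) {A : Finset (Fin d → ℤ)} {F : (Fin d → ℤ) → ℝ}
    (hF : ∀ x ∈ A, lap F x ≤ 0) {x : Fin d → ℤ} (hx : x ∈ A) : exitMean A F x ≤ F x :=
  comparison hd A (exitMean A F) F (fun _ hz => (lap_exitMean hd F hz).ge) hF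
    (fun _ hy => (exitMean_of_mem_bdryF F hy).le) x hx

lemma exitMean_const (hd : 0 < d) {A : Finset (Fin d → ℤ)} (c : ℝ) {x : Fin d → ℤ}
    (hx : x ∈ A) : exitMean A (fun _ => c) x = c :=
  le_antisymm (exitMean_le hd (fun z _ => (lap_const c z).le) hx)
    (le_exitMean hd (fun z _ => (lap_const c z).ge) hx)

end Laplacian

/-! ### The growth process -/

section Growth

variable {d : ℕ}

/-- The defining properties of the internal DLA growth process. -/
structure IsGrowth {Ω : Type*} [MeasurableSpace Ω] (P : Measure Ω)
    (I : ℕ → Ω → Finset (Fin d → ℤ)) (Y : ℕ → Ω → (Fin d → ℤ)) : Prop where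
  init : ∀ ω, I 0 ω = {0}
  step : ∀ n ω, I (n+1) ω = insert (Y (n+1) ω) (I n ω)
  bdry : ∀ n ω, Y (n+1) ω ∈ bdryF latNbrs (I n ω)
  law : ∀ (n : ℕ) (A : Finset (Fin d → ℤ)), ∀ y ∈ bdryF latNbrs A,
      P {ω | I n ω = A ∧ Y (n+1) ω = y}
        = ENNReal.ofReal (hitMeas latNbrs (↑(bdryF latNbrs A)) 0 y) * P {ω | I n ω = A}

variable {Ω : Type*} [MeasurableSpace Ω] {P : Measure Ω}
  {I : ℕ → Ω → Finset (Fin d → ℤ)} {Y : ℕ → Ω → (Fin d → ℤ)}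

lemma IsGrowth.zero_mem (h : IsGrowth P I Y) (n : ℕ) (ω : Ω) : 0 ∈ I n ω := by
  induction n with
  | zero => simp [h.init]
  | succ n ih => rw [h.step]; exact Finset.mem_insert_of_mem ih

lemma IsGrowth.card (h : IsGrowth P I Y) (n : ℕ) (ω : Ω) : (I n ω).card = n + 1 := by
  induction n with
  | zero => simp [h.init]
  | succ n ih =>
    rw [h.step, Finset.card_insert_of_notMem (notMem_of_mem_bdryF (h.bdry n ω)), ih]

lemma IsGrowth.measure_succ_le (h : IsGrowth P I Y) (n : ℕ) (A' : Finset (Fin d → ℤ)) :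
    P {ω | I (n+1) ω = A'} ≤ ∑' A, ∑ y ∈ bdryF latNbrs A,
      if insert y A = A' then P {ω | I n ω = A ∧ Y (n+1) ω = y} else 0 := by
  have hsub : {ω | I (n+1) ω = A'} ⊆ ⋃ A, ⋃ y ∈ bdryF latNbrs A,
      {ω | insert y A = A' ∧ I n ω = A ∧ Y (n+1) ω = y} := by
    intro ω hω
    simp only [Set.mem_iUnion, Set.mem_ofPred_eq]
    refine ⟨I n ω, Y (n+1) ω, h.bdry n ω, ?_, rfl, rfl⟩
    rw [← h.step]; exact hω
  refine (measure_mono hsub).trans ((measure_iUnion_le _).trans (ENNReal.tsum_le_tsum fun A => ?_))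
  refine (measure_biUnion_finset_le _ _).trans (Finset.sum_le_sum fun y _ => ?_)
  split_ifs with hy
  · simp [hy]
  · simp [hy]

lemma IsGrowth.tsum_succ_le (h : IsGrowth P I Y) (n : ℕ) {Φ : Finset (Fin d → ℤ) → ℝ}
    (hΦ : ∀ A, 0 ≤ Φ A) {r : ℝ} (hr : 0 ≤ r)
    (hstep : ∀ A, 0 ∈ A → exitMean A (fun y => Φ (insert y A)) 0 ≤ r * Φ A) :
    ∑' A, P {ω | I (n+1) ω = A} * ENNReal.ofReal (Φ A)
      ≤ ENNReal.ofReal r * ∑' A, P {ω | I n ω = A} * ENNReal.ofReal (Φ A) := by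
  calc ∑' A', P {ω | I (n+1) ω = A'} * ENNReal.ofReal (Φ A')
      ≤ ∑' A', (∑' A, ∑ y ∈ bdryF latNbrs A,
        if insert y A = A' then P {ω | I n ω = A ∧ Y (n+1) ω = y} else 0)
          * ENNReal.ofReal (Φ A') := by
        gcongr with A'
        exact h.measure_succ_le n A'
    _ = ∑' A, ∑' A', ∑ y ∈ bdryF latNbrs A,
        (if insert y A = A' then P {ω | I n ω = A ∧ Y (n+1) ω = y} * ENNReal.ofReal (Φ A')
          else 0) := by
        rw [ENNReal.tsum_comm]
        congr 1; ext A'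
        rw [← ENNReal.tsum_mul_right]
        congr 1; ext A
        rw [Finset.sum_mul]
        refine Finset.sum_congr rfl fun y _ => ?_
        split_ifs <;> simp
    _ = ∑' A, ∑ y ∈ bdryF latNbrs A,
        P {ω | I n ω = A ∧ Y (n+1) ω = y} * ENNReal.ofReal (Φ (insert y A)) := by
        congr 1; ext A
        rw [Summable.tsum_finsetSum (fun _ _ => ENNReal.summable)]
        refine Finset.sum_congr rfl fun y _ => ?_
        rw [tsum_eq_single (insert y A)]
        · simp
        · intro A' hA'; simp [hA'.symm]
    _ ≤ ∑' A, ENNReal.ofReal r * (P {ω | I n ω = A} * ENNReal.ofReal (Φ A)) := by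
        refine ENNReal.tsum_le_tsum fun A => ?_
        by_cases h0 : (0 : Fin d → ℤ) ∈ A
        · have : ∑ y ∈ bdryF latNbrs A,
              P {ω | I n ω = A ∧ Y (n+1) ω = y} * ENNReal.ofReal (Φ (insert y A))
              = P {ω | I n ω = A} *
                ENNReal.ofReal (exitMean A (fun y => Φ (insert y A)) 0) := by
            rw [exitMean, ENNReal.ofReal_sum_of_nonneg
              (fun y _ => mul_nonneg (hitMeas_nonneg _ _ _) (hΦ _)), Finset.mul_sum]
            refine Finset.sum_congr rfl fun y hy => ?_
            rw [h.law n A y hy, ENNReal.ofReal_mul (hitMeas_nonneg _ _ _)]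
            ring
          rw [this]
          calc _ ≤ P {ω | I n ω = A} * ENNReal.ofReal (r * Φ A) := by
                gcongr; exact hstep A h0
            _ = _ := by rw [ENNReal.ofReal_mul hr]; ring
        · have hz : P {ω | I n ω = A} = 0 := by
            rw [← nonpos_iff_eq_zero, ← measure_empty (μ := P)]
            refine measure_mono fun ω hω => h0 ?_
            rw [← (show I n ω = A from hω)]; exact h.zero_mem n ω
          rw [hz]
          simp only [zero_mul, mul_zero, nonpos_iff_eq_zero, Finset.sum_eq_zero_iff]
          intro y _
          rw [measure_mono_null _ hz, zero_mul]
          exact fun ω hω => hω.1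
    _ = _ := ENNReal.tsum_mul_left

/-- Markov's inequality for a supermartingale of the growth process. -/
lemma IsGrowth.measure_le [IsProbabilityMeasure P] (h : IsGrowth P I Y) (n : ℕ)
    {Φ : Finset (Fin d → ℤ) → ℝ} (hΦ : ∀ A, 0 ≤ Φ A) {r : ℝ} (hr : 0 ≤ r)
    (hstep : ∀ A, 0 ∈ A → exitMean A (fun y => Φ (insert y A)) 0 ≤ r * Φ A)
    {E : Set Ω} (hE : ∀ ω ∈ E, 1 ≤ Φ (I n ω)) :
    P E ≤ ENNReal.ofReal (r ^ n * Φ {0}) := by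
  have hmain : ∀ n, ∑' A, P {ω | I n ω = A} * ENNReal.ofReal (Φ A)
      ≤ ENNReal.ofReal (r ^ n * Φ {0}) := by
    intro n
    induction n with
    | zero =>
      rw [tsum_eq_single {0}]
      · simp [h.init]
      · intro A hA
        have : {ω | I 0 ω = A} = ∅ := by
          ext ω; simp [h.init, hA.symm]
        simp [this]
    | succ n ih =>
      refine (h.tsum_succ_le n hΦ hr hstep).trans ?_
      rw [pow_succ', mul_assoc, ENNReal.ofReal_mul hr]
      gcongr
  refine le_trans ?_ (hmain n)
  have hsub : E ⊆ ⋃ A, {ω | I n ω = A ∧ 1 ≤ Φ A} := by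
    intro ω hω
    simp only [Set.mem_iUnion, Set.mem_ofPred_eq]
    exact ⟨I n ω, rfl, hE ω hω⟩
  refine (measure_mono hsub).trans ((measure_iUnion_le _).trans (ENNReal.tsum_le_tsum fun A => ?_))
  by_cases hA : 1 ≤ Φ A
  · calc P {ω | I n ω = A ∧ 1 ≤ Φ A} ≤ P {ω | I n ω = A} * 1 := by
          rw [mul_one]; exact measure_mono fun ω hω => hω.1
      _ ≤ _ := by
          gcongr
          rw [← ENNReal.ofReal_one]
          exact ENNReal.ofReal_le_ofReal hA
  · simp [hA]

end Growth

section Chernoff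

variable {d : ℕ} {Ω : Type*} [MeasurableSpace Ω] {P : Measure Ω}
  {I : ℕ → Ω → Finset (Fin d → ℤ)} {Y : ℕ → Ω → (Fin d → ℤ)}

open Classical in
/-- A Chernoff bound for the probability that a site is still vacant, in terms of a
nonnegative function which is subharmonic off that site. -/
lemma IsGrowth.measure_notMem_le [IsProbabilityMeasure P] (h : IsGrowth P I Y) (hd : 0 < d)
    (N : ℕ) {z : Fin d → ℤ} {g : (Fin d → ℤ) → ℝ} {M S c : ℝ} (hc : 0 ≤ c) (hcM : c * M ≤ 1)
    (hg0 : ∀ x, 0 ≤ g x) (hgM : ∀ x, g x ≤ M) (hg : ∀ x, x ≠ z → 0 ≤ lap g x)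
    (hS : ∀ A : Finset (Fin d → ℤ), z ∉ A → ∑ x ∈ A, g x ≤ S) :
    P {ω | z ∉ I N ω} ≤ ENNReal.ofReal (Real.exp (c * S - c * (1 - c * M) * g 0 * N)) := by
  set Φ : Finset (Fin d → ℤ) → ℝ := fun A =>
    if z ∈ A then 0 else Real.exp (c * S) * Real.exp (-(c * ∑ x ∈ A, g x)) with hΦdef
  have hΦ : ∀ A, 0 ≤ Φ A := by
    intro A; simp only [hΦdef]; split_ifs <;> positivity
  have hstep : ∀ A, 0 ∈ A → exitMean A (fun y => Φ (insert y A)) 0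
      ≤ Real.exp (-(c * (1 - c * M) * g 0)) * Φ A := by
    intro A hA
    by_cases hz : z ∈ A
    · have : exitMean A (fun y => Φ (insert y A)) 0 = exitMean A (fun _ => 0) 0 := by
        simp [hΦdef, hz]
      rw [this, exitMean_const hd 0 hA]
      exact mul_nonneg (Real.exp_nonneg _) (hΦ A)
    · have h1 : exitMean A (fun y => Φ (insert y A)) 0
          ≤ exitMean A (fun y => Φ A * (1 + (-(c * (1 - c * M))) * g y)) 0 := by
        refine exitMean_mono 0 fun y hy => ?_
        have hyA := notMem_of_mem_bdryF hy
        have h2 : Φ (insert y A) ≤ Φ A * Real.exp (-(c * g y)) := by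
          simp only [hΦdef, if_neg hz]
          split_ifs
          · positivity
          · rw [Finset.sum_insert hyA]
            simp only [← Real.exp_add]
            apply le_of_eq; congr 1; ring
        refine h2.trans (mul_le_mul_of_nonneg_left ?_ (hΦ A))
        have h3 : 0 ≤ c * g y := mul_nonneg hc (hg0 y)
        have h4 : c * g y ≤ c * M := mul_le_mul_of_nonneg_left (hgM y) hc
        have h5 := (abs_le.1 (Real.abs_exp_sub_one_sub_id_le (x := -(c * g y))
          (by rw [abs_neg, abs_of_nonneg h3]; linarith))).2
        nlinarith [mul_le_mul_of_nonneg_left h4 h3]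
      refine h1.trans ?_
      rw [exitMean_const_mul, exitMean_add, exitMean_const_mul, exitMean_const hd _ hA, mul_comm]
      refine mul_le_mul_of_nonneg_right ?_ (hΦ A)
      have h6 := le_exitMean hd (F := g) (A := A) (fun x hx => hg x (fun h => hz (h ▸ hx))) hA
      have h7 : 0 ≤ c * (1 - c * M) := mul_nonneg hc (by linarith)
      have h8 := Real.add_one_le_exp (-(c * (1 - c * M) * g 0))
      nlinarith [mul_le_mul_of_nonneg_left h6 h7]
  refine (h.measure_le N hΦ (Real.exp_nonneg _) hstep (E := {ω | z ∉ I N ω}) ?_).trans ?_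
  · intro ω hω
    have hω' : z ∉ I N ω := hω
    simp only [hΦdef, if_neg hω']
    rw [← Real.exp_add]
    refine Real.one_le_exp ?_
    nlinarith [mul_le_mul_of_nonneg_left (hS _ hω') hc]
  · refine ENNReal.ofReal_le_ofReal ?_
    have : Φ {0} ≤ Real.exp (c * S) := by
      simp only [hΦdef]
      split_ifs
      · positivity
      · rw [← Real.exp_add]
        refine Real.exp_le_exp.2 ?_
        simp only [Finset.sum_singleton]
        nlinarith [mul_nonneg hc (hg0 0)]
    calc _ ≤ Real.exp (-(c * (1 - c * M) * g 0)) ^ N * Real.exp (c * S) := by gcongr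
      _ = _ := by
        rw [← Real.exp_nat_mul, ← Real.exp_add]; congr 1; ring

end Chernoff

/-! ### Euclidean geometry of the lattice -/

section Geometry

variable {d : ℕ}

/-- The squared Euclidean norm of a lattice point. -/
noncomputable def sqn (x : Fin d → ℤ) : ℝ := ∑ i, (x i : ℝ) ^ 2

/-- The Euclidean inner product of a vector with a lattice point. -/
noncomputable def dot (v : Fin d → ℝ) (x : Fin d → ℤ) : ℝ := ∑ i, v i * (x i : ℝ)

lemma sqn_nonneg (x : Fin d → ℤ) : 0 ≤ sqn x := Finset.sum_nonneg fun _ _ => sq_nonneg _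

lemma eunorm_nonneg (x : Fin d → ℤ) : 0 ≤ eunorm x := Real.sqrt_nonneg _

lemma eunorm_sq (x : Fin d → ℤ) : eunorm x ^ 2 = sqn x := Real.sq_sqrt (sqn_nonneg x)

lemma eunorm_eq_norm (x : Fin d → ℤ) :
    eunorm x = ‖(WithLp.toLp 2 (fun i => (x i : ℝ)) : EuclideanSpace ℝ (Fin d))‖ := by
  rw [EuclideanSpace.norm_eq, eunorm]
  simp

lemma eunorm_add_le (x y : Fin d → ℤ) : eunorm (x + y) ≤ eunorm x + eunorm y := by
  simp only [eunorm_eq_norm]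
  refine le_trans (le_of_eq ?_) (norm_add_le _ _)
  congr 1
  ext i; simp

lemma eunorm_neg (x : Fin d → ℤ) : eunorm (-x) = eunorm x := by
  simp [eunorm]

lemma eunorm_zero : eunorm (0 : Fin d → ℤ) = 0 := by simp [eunorm]

lemma eunorm_single (i : Fin d) : eunorm (Pi.single i 1 : Fin d → ℤ) = 1 := by
  rw [eunorm, Finset.sum_eq_single i]
  · simp
  · intro j _ hj; simp [hj]
  · simp

lemma eunorm_le_of_mem_latNbrs {x y : Fin d → ℤ} (h : y ∈ latNbrs x) :
    eunorm y ≤ eunorm x + 1 := by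
  obtain ⟨i, rfl | rfl⟩ := mem_latNbrs.1 h
  · simpa [eunorm_single] using eunorm_add_le x (Pi.single i 1)
  · simpa [eunorm_single, eunorm_neg, sub_eq_add_neg] using eunorm_add_le x (-Pi.single i 1)

lemma abs_coord_le (x : Fin d → ℤ) (i : Fin d) : |(x i : ℝ)| ≤ eunorm x := by
  rw [← Real.sqrt_sq_eq_abs]
  exact Real.sqrt_le_sqrt (Finset.single_le_sum (f := fun i => (x i : ℝ) ^ 2)
    (fun j _ => sq_nonneg _) (Finset.mem_univ i))

lemma dot_add (v : Fin d → ℝ) (x y : Fin d → ℤ) : dot v (x + y) = dot v x + dot v y := by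
  simp [dot, mul_add, Finset.sum_add_distrib]

lemma dot_sub (v : Fin d → ℝ) (x y : Fin d → ℤ) : dot v (x - y) = dot v x - dot v y := by
  simp [dot, mul_sub, Finset.sum_sub_distrib]

lemma dot_single (v : Fin d → ℝ) (i : Fin d) : dot v (Pi.single i 1) = v i := by
  rw [dot, Finset.sum_eq_single i]
  · simp
  · intro j _ hj; simp [hj]
  · simp

lemma dot_zero (v : Fin d → ℝ) : dot v 0 = 0 := by simp [dot]

lemma dot_le_eunorm {v : Fin d → ℝ} (hv : ∑ i, v i ^ 2 = 1) (x : Fin d → ℤ) :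
    dot v x ≤ eunorm x := by
  have := Real.sum_mul_le_sqrt_mul_sqrt Finset.univ v (fun i => (x i : ℝ))
  rw [hv, Real.sqrt_one, one_mul] at this
  exact this

lemma abs_le_one_of_unit {v : Fin d → ℝ} (hv : ∑ i, v i ^ 2 = 1) (i : Fin d) : |v i| ≤ 1 := by
  rw [← sq_le_one_iff_abs_le_one, ← hv]
  exact Finset.single_le_sum (f := fun i => (v i) ^ 2) (fun j _ => sq_nonneg _) (Finset.mem_univ i)

lemma dot_le_of_mem_latNbrs {v : Fin d → ℝ} (hv : ∑ i, v i ^ 2 = 1) {x y : Fin d → ℤ}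
    (h : y ∈ latNbrs x) : dot v y ≤ dot v x + 1 := by
  obtain ⟨i, rfl | rfl⟩ := mem_latNbrs.1 h
  · rw [dot_add, dot_single]
    linarith [(abs_le.1 (abs_le_one_of_unit hv i)).2]
  · rw [dot_sub, dot_single]
    linarith [(abs_le.1 (abs_le_one_of_unit hv i)).1]

lemma latBall_finite (r : ℝ) : (latBall r : Set (Fin d → ℤ)).Finite := by
  refine (Set.finite_Icc (fun _ : Fin d => -⌈|r|⌉) (fun _ => ⌈|r|⌉)).subset fun x hx => ?_
  have h : ∀ i, |x i| ≤ ⌈|r|⌉ := by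
    intro i
    have h1 := (abs_coord_le x i).trans ((show eunorm x ≤ r from hx).trans
      ((le_abs_self r).trans (Int.le_ceil _)))
    exact_mod_cast h1
  exact ⟨fun i => (abs_le.1 (h i)).1, fun i => (abs_le.1 (h i)).2⟩

/-- The lattice ball as a finite set. -/
noncomputable def ballF (d : ℕ) (r : ℝ) : Finset (Fin d → ℤ) := (latBall_finite r).toFinset

lemma mem_ballF {r : ℝ} {x : Fin d → ℤ} : x ∈ ballF d r ↔ eunorm x ≤ r := by
  simp [ballF, latBall]

lemma exists_unit_dot {z : Fin d → ℤ} (hz : z ≠ 0) :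
    ∃ v : Fin d → ℝ, ∑ i, v i ^ 2 = 1 ∧ dot v z = eunorm z := by
  have h0 : eunorm z ≠ 0 := by
    rw [eunorm_eq_norm, norm_ne_zero_iff]
    intro h
    apply hz
    ext i
    have := congrArg (fun w : EuclideanSpace ℝ (Fin d) => w i) h
    simpa using this
  refine ⟨fun i => (z i : ℝ) / eunorm z, ?_, ?_⟩
  · simp only [div_pow]
    rw [← Finset.sum_div, eunorm_sq, sqn, div_self]
    rw [← sqn, ← eunorm_sq]; positivity
  · simp only [dot, div_mul_eq_mul_div, ← pow_two]
    rw [← Finset.sum_div, ← sqn, ← eunorm_sq]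
    field_simp

end Geometry

/-! ### The tentacle estimate -/

section Tentacle

variable {d : ℕ}

/-- The number of points of `A` in a half space. -/
noncomputable def halfCount (v : Fin d → ℝ) (k : ℝ) (A : Finset (Fin d → ℤ)) : ℝ :=
  ∑ x ∈ A, if k ≤ dot v x then 1 else 0

lemma halfCount_nonneg (v : Fin d → ℝ) (k : ℝ) (A : Finset (Fin d → ℤ)) :
    0 ≤ halfCount v k A := Finset.sum_nonneg fun _ _ => by split_ifs <;> norm_num

/-- If barriers are available at all the points of the slab at height `k`, then the exit
probability beyond the slab is controlled by the number of occupied sites beyond `k`. -/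
lemma exitMean_half_le (hd : 0 < d) {v : Fin d → ℝ} (hv : ∑ i, v i ^ 2 = 1)
    {u : (Fin d → ℤ) → (Fin d → ℤ) → ℝ} {κ n k : ℝ} (hn : 0 ≤ n) (hnk : n + 1 < k) (hκ : 0 ≤ κ)
    (hu_lap : ∀ y x, dot v x < dot v y → lap (u y) x ≤ 0)
    (hu_self : ∀ y, 1 ≤ u y y)
    (hu_nonneg : ∀ y x, dot v x ≤ dot v y + 1 → 0 ≤ u y x)
    (hu_le : ∀ y x, k ≤ dot v y → eunorm x ≤ n + 1 → u y x ≤ κ)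
    {φ : (Fin d → ℤ) → ℝ} (hφ0 : ∀ x, 0 ≤ φ x) (hφ : ∀ x, 0 ≤ lap φ x)
    (hφ1 : ∀ x, n < eunorm x → 1 ≤ φ x) {A : Finset (Fin d → ℤ)} (hA : 0 ∈ A) :
    exitMean A (fun y => if k + 1 ≤ dot v y then 1 else 0) 0
      ≤ κ * halfCount v k A * exitMean A φ 0 := by
  classical
  set F : (Fin d → ℤ) → ℝ := fun y => if k + 1 ≤ dot v y then 1 else 0 with hF
  have hF0 : ∀ y, 0 ≤ F y := fun y => by simp only [hF]; split_ifs <;> norm_num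
  have hF1 : ∀ y, F y ≤ 1 := fun y => by simp only [hF]; split_ifs <;> norm_num
  set W := A.filter fun y => k ≤ dot v y ∧ dot v y < k + 1 with hW
  have hWcard : (W.card : ℝ) ≤ halfCount v k A := by
    rw [halfCount, Finset.sum_ite, Finset.sum_const, Finset.sum_const_zero, add_zero, nsmul_eq_mul,
      mul_one]
    refine Nat.cast_le.2 (Finset.card_le_card fun y hy => ?_)
    rw [hW, Finset.mem_filter] at hy
    exact Finset.mem_filter.2 ⟨hy.1, hy.2.1⟩
  have hEle1 : ∀ x ∈ A, exitMean A F x ≤ 1 := fun x hx =>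
    (exitMean_mono x fun y _ => hF1 y).trans (exitMean_const hd 1 hx).le
  have step1 : ∀ x ∈ A.filter (fun x => dot v x < k), exitMean A F x ≤ ∑ y ∈ W, u y x := by
    refine comparison hd _ _ _ (fun x hx => ?_) (fun x hx => ?_) (fun y hy => ?_)
    · rw [lap_exitMean hd F (Finset.mem_filter.1 hx).1]
    · rw [lap_sum]
      refine Finset.sum_nonpos fun y hy => hu_lap y x ?_
      rw [hW, Finset.mem_filter] at hy
      exact (Finset.mem_filter.1 hx).2.trans_le hy.2.1
    · obtain ⟨⟨x, hx, hxy⟩, hyn⟩ := mem_bdryF.1 hy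
      rw [Finset.mem_filter] at hx
      have hyk : dot v y < k + 1 := by linarith [dot_le_of_mem_latNbrs hv hxy, hx.2]
      have hpos : ∀ w ∈ W, 0 ≤ u w y := fun w hw => by
        rw [hW, Finset.mem_filter] at hw
        exact hu_nonneg w y (by linarith [hw.2.1])
      rcases mem_or_mem_bdryF hx.1 hxy with hyA | hyA
      · have hyk' : k ≤ dot v y := by
          by_contra hlt
          exact hyn (Finset.mem_filter.2 ⟨hyA, not_le.1 hlt⟩)
        have hyW : y ∈ W := Finset.mem_filter.2 ⟨hyA, hyk', hyk⟩
        calc exitMean A F y ≤ 1 := hEle1 y hyA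
          _ ≤ u y y := hu_self y
          _ ≤ _ := Finset.single_le_sum (f := fun w => u w y) hpos hyW
      · rw [exitMean_of_mem_bdryF F hyA]
        simp only [hF, if_neg (not_le.2 hyk)]
        exact Finset.sum_nonneg hpos
  have step2 : ∀ x ∈ A, eunorm x ≤ n + 1 → exitMean A F x ≤ κ * halfCount v k A := by
    intro x hx hxn
    refine (step1 x (Finset.mem_filter.2 ⟨hx, (dot_le_eunorm hv x).trans_lt
      (by linarith)⟩)).trans ?_
    calc ∑ y ∈ W, u y x ≤ ∑ y ∈ W, κ := Finset.sum_le_sum fun y hy => by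
          rw [hW, Finset.mem_filter] at hy
          exact hu_le y x hy.2.1 hxn
      _ = κ * W.card := by rw [Finset.sum_const, nsmul_eq_mul, mul_comm]
      _ ≤ _ := by gcongr
  have hζ := halfCount_nonneg v k A
  have step3 : ∀ x ∈ A.filter (fun x => eunorm x ≤ n),
      exitMean A F x ≤ κ * halfCount v k A * exitMean A φ x := by
    refine comparison hd _ _ (fun x => κ * halfCount v k A * exitMean A φ x)
      (fun x hx => ?_) (fun x hx => ?_) (fun y hy => ?_)
    · rw [lap_exitMean hd F (Finset.mem_filter.1 hx).1]
    · rw [lap_const_mul, lap_exitMean hd φ (Finset.mem_filter.1 hx).1, mul_zero]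
    · obtain ⟨⟨x, hx, hxy⟩, hyn⟩ := mem_bdryF.1 hy
      rw [Finset.mem_filter] at hx
      have hyk : eunorm y ≤ n + 1 := by linarith [eunorm_le_of_mem_latNbrs hxy, hx.2]
      rcases mem_or_mem_bdryF hx.1 hxy with hyA | hyA
      · have hyk' : n < eunorm y := by
          by_contra hlt
          exact hyn (Finset.mem_filter.2 ⟨hyA, not_lt.1 hlt⟩)
        have h1 : 1 ≤ exitMean A φ y :=
          (hφ1 y hyk').trans (le_exitMean hd (fun x _ => hφ x) hyA)
        refine (step2 y hyA hyk).trans ?_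
        exact le_mul_of_one_le_right (by positivity) h1
      · rw [exitMean_of_mem_bdryF F hyA]
        have : F y = 0 := by
          simp only [hF]
          rw [if_neg]
          linarith [dot_le_eunorm hv y]
        rw [this]
        exact mul_nonneg (by positivity) (exitMean_nonneg y fun _ _ => hφ0 _)
  exact step3 0 (Finset.mem_filter.2 ⟨hA, by rw [eunorm_zero]; exact hn⟩)

variable {Ω : Type*} [MeasurableSpace Ω] {P : Measure Ω}
  {I : ℕ → Ω → Finset (Fin d → ℤ)} {Y : ℕ → Ω → (Fin d → ℤ)}

open Classical in
/-- Thin tentacles are exponentially unlikely. -/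
lemma IsGrowth.measure_tentacle_le [IsProbabilityMeasure P] (h : IsGrowth P I Y) (hd : 0 < d)
    {v : Fin d → ℝ} {κ k₀ : ℝ} (hκ : 0 < κ) (hk₀ : 0 < k₀)
    {φ : (Fin d → ℤ) → ℝ} (hφ0 : ∀ x, 0 ≤ φ x) (hφ1 : ∀ x, k₀ ≤ dot v x → 1 ≤ φ x)
    (G : Set (Fin d → ℤ)) (hφG : ∀ x ∈ G, ∀ y ∈ latNbrs x, 4 * κ * φ y ≤ 1 / 2)
    (hesc : ∀ k, k₀ ≤ k → ∀ A : Finset (Fin d → ℤ), 0 ∈ A →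
      exitMean A (fun y => if k + 1 ≤ dot v y then 1 else 0) 0
        ≤ κ * halfCount v k A * exitMean A φ 0)
    (N J : ℕ) {z : Fin d → ℤ} (hz : k₀ + J ≤ dot v z) (S : ℝ) :
    P {ω | z ∈ I N ω ∧ ↑(I N ω) ⊆ G ∧ ∑ x ∈ I N ω, φ x ≤ S}
      ≤ ENNReal.ofReal ((2 * κ)⁻¹ * Real.exp (4 * κ * S - J * Real.log 2)) := by
  set b : ℝ := Real.exp (4 * κ * S - J * Real.log 2) with hb
  set Ψ : Finset (Fin d → ℤ) → ℝ := fun A =>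
    ∑ j ∈ Finset.range (J + 1), 2 ^ j * halfCount v (k₀ + j) A with hΨ
  have hΨ0 : ∀ A, 0 ≤ Ψ A := fun A => Finset.sum_nonneg fun j _ =>
    mul_nonneg (by positivity) (halfCount_nonneg _ _ _)
  set Φ : Finset (Fin d → ℤ) → ℝ := fun A =>
    if (A : Set (Fin d → ℤ)) ⊆ G then
      b * (((2 * κ)⁻¹ + Ψ A) * Real.exp (-(4 * κ * ∑ x ∈ A, φ x))) else 0 with hΦdef
  have hΦ : ∀ A, 0 ≤ Φ A := by
    intro A; simp only [hΦdef]
    have := hΨ0 A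
    split_ifs <;> positivity
  have hstep : ∀ A, 0 ∈ A → exitMean A (fun y => Φ (insert y A)) 0 ≤ 1 * Φ A := by
    intro A hA
    rw [one_mul]
    by_cases hG : (A : Set (Fin d → ℤ)) ⊆ G
    swap
    · have : ∀ y, Φ (insert y A) = 0 := fun y => by
        simp only [hΦdef]; rw [if_neg]
        intro hsub
        exact hG fun x hx => hsub (by
          rw [Finset.coe_insert]; exact Set.mem_insert_of_mem _ hx)
      simp only [this]
      rw [exitMean_const hd 0 hA]; exact hΦ A
    set e := Real.exp (-(4 * κ * ∑ x ∈ A, φ x)) with he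
    have he0 : 0 < e := Real.exp_pos _
    have hb0 : 0 < b := Real.exp_pos _
    set c := (2 * κ)⁻¹ + Ψ A with hc
    have hc0 : 0 ≤ c := by have := hΨ0 A; positivity
    set L : ℕ → (Fin d → ℤ) → ℝ := fun j y => if k₀ + j ≤ dot v y then 1 else 0 with hL
    have hL0 : ∀ j y, 0 ≤ L j y := fun j y => by simp only [hL]; split_ifs <;> norm_num
    have h1 : exitMean A (fun y => Φ (insert y A)) 0 ≤
        exitMean A (fun y => (b * e) * (c + ((-(2 * κ * c)) * φ y +
          ∑ j ∈ Finset.range (J + 1), 2 ^ j * L j y))) 0 := by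
      refine exitMean_mono 0 fun y hy => ?_
      have hyA := notMem_of_mem_bdryF hy
      obtain ⟨⟨x, hx, hxy⟩, _⟩ := mem_bdryF.1 hy
      have hφy := hφG x (hG hx) y hxy
      have hφy0 := hφ0 y
      set T := ∑ j ∈ Finset.range (J + 1), 2 ^ j * L j y with hT
      have hT0 : 0 ≤ T := Finset.sum_nonneg fun j _ => mul_nonneg (by positivity) (hL0 j y)
      have h3 : 0 ≤ 4 * κ * φ y := by positivity
      have hexp : Real.exp (-(4 * κ * φ y)) ≤ 1 - 2 * κ * φ y := by
        have h5 := (abs_le.1 (Real.abs_exp_sub_one_sub_id_le (x := -(4 * κ * φ y))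
          (by rw [abs_neg, abs_of_nonneg h3]; linarith))).2
        nlinarith
      have hexp1 : Real.exp (-(4 * κ * φ y)) ≤ 1 := Real.exp_le_one_iff.2 (by linarith)
      simp only [hΦdef]
      split_ifs with hins
      · have hΨi : Ψ (insert y A) = Ψ A + T := by
          simp only [hΨ, hT, hL, halfCount, ← Finset.sum_add_distrib]
          refine Finset.sum_congr rfl fun j _ => ?_
          rw [Finset.sum_insert hyA]; ring
        rw [hΨi, Finset.sum_insert hyA, mul_add, neg_add, Real.exp_add, ← he, mul_assoc b e]
        refine mul_le_mul_of_nonneg_left ?_ hb0.le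
        rw [← add_assoc, ← hc, mul_comm _ e, ← mul_assoc, mul_comm _ e, mul_assoc]
        refine mul_le_mul_of_nonneg_left ?_ he0.le
        nlinarith [mul_le_mul_of_nonneg_left hexp hc0, mul_le_mul_of_nonneg_left hexp1 hT0]
      · have : 0 ≤ c + (-(2 * κ * c) * φ y + T) := by nlinarith
        positivity
    refine h1.trans ?_
    rw [exitMean_const_mul, exitMean_add A (fun _ => c),
      exitMean_add A (fun y => -(2 * κ * c) * φ y), exitMean_const hd _ hA,
      exitMean_const_mul, exitMean_sum]
    simp only [exitMean_const_mul]
    have hE0 : 0 ≤ exitMean A φ 0 := exitMean_nonneg 0 fun _ _ => hφ0 _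
    have hsum : ∑ j ∈ Finset.range (J + 1), 2 ^ j * exitMean A (L j) 0
        ≤ 2 * κ * c * exitMean A φ 0 := by
      rw [Finset.sum_range_succ']
      have hj0 : exitMean A (L 0) 0 ≤ exitMean A φ 0 := exitMean_mono 0 fun y _ => by
        simp only [hL]
        split_ifs with hy
        · exact hφ1 y (by simpa using hy)
        · exact hφ0 y
      have hj : ∑ j ∈ Finset.range J, 2 ^ (j + 1) * exitMean A (L (j + 1)) 0
          ≤ 2 * κ * exitMean A φ 0 * Ψ A := by
        simp only [hΨ, Finset.mul_sum]
        calc _ ≤ ∑ j ∈ Finset.range J,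
              2 * κ * exitMean A φ 0 * (2 ^ j * halfCount v (k₀ + j) A) := by
              refine Finset.sum_le_sum fun j _ => ?_
              have := hesc (k₀ + j) (by simp) A hA
              have h2 : exitMean A (L (j + 1)) 0 ≤ κ * halfCount v (k₀ + j) A * exitMean A φ 0 := by
                simpa [hL, add_assoc] using this
              calc (2:ℝ) ^ (j + 1) * exitMean A (L (j + 1)) 0
                  ≤ 2 ^ (j + 1) * (κ * halfCount v (k₀ + j) A * exitMean A φ 0) := by gcongr
                _ = _ := by ring
          _ ≤ _ := Finset.sum_le_sum_of_subset_of_nonneg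
              (Finset.range_subset_range.2 (Nat.le_succ J)) fun j _ _ => by
                have := halfCount_nonneg v (k₀ + j) A
                positivity
      have : 2 * κ * c = 1 + 2 * κ * Ψ A := by rw [hc]; field_simp
      rw [this]
      simp only [pow_zero, one_mul]
      nlinarith
    have hΦA : Φ A = b * (c * e) := by simp only [hΦdef, if_pos hG]; rfl
    rw [hΦA]
    calc b * e * (c + (-(2 * κ * c) * exitMean A φ 0 +
        ∑ j ∈ Finset.range (J + 1), 2 ^ j * exitMean A (L j) 0)) ≤ b * e * c := by
          refine mul_le_mul_of_nonneg_left ?_ (by positivity)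
          linarith
      _ = _ := by ring
  refine (h.measure_le N hΦ zero_le_one hstep (E := {ω | z ∈ I N ω ∧ ↑(I N ω) ⊆ G ∧
    ∑ x ∈ I N ω, φ x ≤ S}) ?_).trans ?_
  · rintro ω ⟨h1, h2, h3⟩
    simp only [hΦdef, if_pos h2]
    have h4 : (2:ℝ) ^ J ≤ Ψ (I N ω) := by
      have h5 : (1:ℝ) ≤ halfCount v (k₀ + J) (I N ω) := by
        have := Finset.single_le_sum (f := fun x => if k₀ + J ≤ dot v x then (1:ℝ) else 0)
          (fun x _ => by split_ifs <;> norm_num) h1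
        exact (le_of_eq (if_pos hz).symm).trans this
      calc (2:ℝ) ^ J ≤ 2 ^ J * halfCount v (k₀ + J) (I N ω) :=
            le_mul_of_one_le_right (by positivity) h5
        _ ≤ _ := Finset.single_le_sum (f := fun j : ℕ => 2 ^ j * halfCount v (k₀ + j) (I N ω))
            (fun j _ => mul_nonneg (by positivity) (halfCount_nonneg _ _ _))
            (Finset.mem_range.2 (Nat.lt_succ_self J))
    have h6 : Real.exp (-(4 * κ * S)) ≤ Real.exp (-(4 * κ * ∑ x ∈ I N ω, φ x)) := by
      refine Real.exp_le_exp.2 ?_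
      nlinarith
    have h7 : (2:ℝ) ^ J = Real.exp (J * Real.log 2) := by
      rw [Real.exp_nat_mul, Real.exp_log (by norm_num)]
    calc (1:ℝ) = b * (2 ^ J * Real.exp (-(4 * κ * S))) := by
          rw [hb, h7, ← Real.exp_add, ← Real.exp_add]
          rw [eq_comm, Real.exp_eq_one_iff]; ring
      _ ≤ _ := by
          have : 0 ≤ (2 * κ)⁻¹ := by positivity
          have : 2 ^ J ≤ (2 * κ)⁻¹ + Ψ (I N ω) := by linarith
          have := hΨ0 (I N ω)
          gcongr
  · refine ENNReal.ofReal_le_ofReal ?_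
    have hΨz : Ψ {0} = 0 := by
      simp only [hΨ, halfCount]
      refine Finset.sum_eq_zero fun j _ => ?_
      rw [Finset.sum_singleton, dot_zero, if_neg, mul_zero]
      have : (0:ℝ) ≤ j := Nat.cast_nonneg j
      linarith
    rw [one_pow, one_mul]
    simp only [hΦdef]
    split_ifs
    · rw [hΨz, add_zero, mul_comm]
      gcongr
      refine mul_le_of_le_one_right (by positivity) (Real.exp_le_one_iff.2 ?_)
      simp only [Finset.sum_singleton]
      have := hφ0 0
      have : 0 ≤ 4 * κ * φ 0 := by positivity
      linarith
    · positivity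

end Tentacle

/-! ### Harnack inequality and Liouville theorem -/

section Liouville

variable {d : ℕ}

/-- The `ℓ¹` norm of a lattice point. -/
def l1 (x : Fin d → ℤ) : ℕ := ∑ i, (x i).natAbs

lemma l1_zero : l1 (0 : Fin d → ℤ) = 0 := by simp [l1]

lemma l1_eq_zero {x : Fin d → ℤ} (h : l1 x = 0) : x = 0 := by
  ext i
  simpa [l1] using Finset.sum_eq_zero_iff.1 h i (Finset.mem_univ i)

lemma exists_closer {x : Fin d → ℤ} (hx : x ≠ 0) :
    ∃ y, x ∈ latNbrs y ∧ l1 x = l1 y + 1 := by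
  obtain ⟨i, hi⟩ : ∃ i, x i ≠ 0 := by
    by_contra! h
    exact hx (funext h)
  have key : ∀ c : ℤ, (x i).natAbs = (x i + c).natAbs + 1 →
      l1 x = l1 (x + Pi.single i c) + 1 := by
    intro c hc
    rw [l1, l1, ← Finset.add_sum_erase _ _ (Finset.mem_univ i),
      ← Finset.add_sum_erase _ _ (Finset.mem_univ i), hc]
    have : ∑ j ∈ Finset.univ.erase i, ((x + Pi.single i c : Fin d → ℤ) j).natAbs
        = ∑ j ∈ Finset.univ.erase i, (x j).natAbs := by
      refine Finset.sum_congr rfl fun j hj => ?_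
      simp [Finset.ne_of_mem_erase hj]
    rw [this]
    simp only [Pi.add_apply, Pi.single_eq_same]
    omega
  rcases lt_or_gt_of_ne hi with h | h
  · exact ⟨x + Pi.single i 1, mem_latNbrs_comm.1 (add_single_mem_latNbrs x i), key 1 (by omega)⟩
  · refine ⟨x - Pi.single i 1, mem_latNbrs_comm.1 (sub_single_mem_latNbrs x i), ?_⟩
    have := key (-1) (by omega)
    rwa [Pi.single_neg, ← sub_eq_add_neg] at this

lemma eunorm_le_l1 (x : Fin d → ℤ) : eunorm x ≤ l1 x := by
  induction hn : l1 x generalizing x with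
  | zero => rw [l1_eq_zero hn, eunorm_zero]; simp
  | succ n ih =>
    obtain ⟨y, hy, hl⟩ := exists_closer (x := x) (by rintro rfl; simp [l1_zero] at hn)
    have := ih y (by omega)
    push_cast
    linarith [eunorm_le_of_mem_latNbrs hy]

/-- Induction along nearest neighbour paths. -/
lemma lattice_induction {p : (Fin d → ℤ) → Prop} (h0 : p 0)
    (h : ∀ x, p x → ∀ y ∈ latNbrs x, p y) (x : Fin d → ℤ) : p x := by
  induction hn : l1 x generalizing x with
  | zero => rw [l1_eq_zero hn]; exact h0
  | succ n ih =>
    obtain ⟨y, hy, hl⟩ := exists_closer (x := x) (by rintro rfl; simp [l1_zero] at hn)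
    exact h y (ih y (by omega)) x hy

lemma nbr_le_of_harmonic {g : (Fin d → ℤ) → ℝ} (hg : ∀ x, 0 ≤ g x) {x y : Fin d → ℤ}
    (hx : lap g x ≤ 0) (hy : y ∈ latNbrs x) : g y ≤ 2 * d * g x := by
  rw [lap_eq_sum_latNbrs] at hx
  have := Finset.single_le_sum (f := g) (fun z _ => hg z) hy
  linarith

lemma le_pow_mul_of_harmonic {g : (Fin d → ℤ) → ℝ} (hg : ∀ x, 0 ≤ g x) {ρ : ℝ}
    (hl : ∀ x, eunorm x < ρ → lap g x = 0) (x : Fin d → ℤ) (hx : l1 x < ρ) :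
    g x ≤ (2 * d) ^ l1 x * g 0 := by
  induction hn : l1 x generalizing x with
  | zero => rw [l1_eq_zero hn]; simp
  | succ n ih =>
    obtain ⟨y, hy, hly⟩ := exists_closer (x := x) (by rintro rfl; simp [l1_zero] at hn)
    have hyn : l1 y = n := by omega
    have hyρ : (l1 y : ℝ) < ρ := by
      refine lt_trans ?_ hx
      exact_mod_cast (by omega : l1 y < l1 x)
    have h1 := ih y hyρ hyn
    have h2 := nbr_le_of_harmonic hg (hl y ((eunorm_le_l1 y).trans_lt hyρ)).le hy
    calc g x ≤ 2 * d * g y := h2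
      _ ≤ 2 * d * ((2 * d) ^ n * g 0) := by gcongr
      _ = _ := by ring

lemma lap_shift (g : (Fin d → ℤ) → ℝ) (y x : Fin d → ℤ) :
    lap (fun x => g (y + x)) x = lap g (y + x) := by
  simp only [lap, add_assoc, add_sub_assoc]

lemma lap_neg (g : (Fin d → ℤ) → ℝ) (x : Fin d → ℤ) :
    lap (fun x => g (-x)) x = lap g (-x) := by
  simp only [lap]
  refine Finset.sum_congr rfl fun i _ => ?_
  rw [show -(x + Pi.single i (1:ℤ)) = -x - Pi.single i 1 by abel,
    show -(x - Pi.single i (1:ℤ)) = -x + Pi.single i 1 by abel]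
  ring

lemma eq_zero_of_harmonic {g : (Fin d → ℤ) → ℝ} (hg : ∀ x, 0 ≤ g x) (hl : ∀ x, lap g x = 0)
    (h0 : g 0 = 0) (x : Fin d → ℤ) : g x = 0 := by
  refine lattice_induction (p := fun x => g x = 0) h0 (fun x hx y hy => ?_) x
  have := nbr_le_of_harmonic hg (hl x).le hy
  rw [hx, mul_zero] at this
  exact le_antisymm this (hg y)

/-- Normalised nonnegative harmonic functions. -/
def posHarm (d : ℕ) : Set ((Fin d → ℤ) → ℝ) := {h | (∀ x, 0 ≤ h x) ∧ (∀ x, lap h x = 0) ∧ h 0 = 1}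

lemma posHarm_pos {h : (Fin d → ℤ) → ℝ} (hh : h ∈ posHarm d) (x : Fin d → ℤ) : 0 < h x := by
  refine lattice_induction (p := fun x => 0 < h x) (by rw [hh.2.2]; norm_num)
    (fun x hx y hy => ?_) x
  have := nbr_le_of_harmonic hh.1 (hh.2.1 y).le (mem_latNbrs_comm.1 hy)
  refine lt_of_le_of_ne (hh.1 y) fun h0 => ?_
  rw [← h0, mul_zero] at this
  linarith

lemma continuous_lap_apply (x : Fin d → ℤ) :
    Continuous fun h : (Fin d → ℤ) → ℝ => lap h x := by
  unfold lap
  fun_prop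

lemma isCompact_posHarm : IsCompact (posHarm d) := by
  have hc : IsCompact (Set.univ.pi fun x : Fin d → ℤ =>
      Set.Icc (0:ℝ) ((2 * d) ^ l1 x)) := isCompact_univ_pi fun x => isCompact_Icc
  refine hc.of_isClosed_subset ?_ ?_
  · have : posHarm d = (⋂ x, {h | 0 ≤ h x}) ∩ ((⋂ x, {h | lap h x = 0}) ∩ {h | h 0 = 1}) := by
      ext h; simp [posHarm]
    rw [this]
    refine (isClosed_iInter fun x => isClosed_le continuous_const (continuous_apply x)).inter
      ((isClosed_iInter fun x => isClosed_eq (continuous_lap_apply x) continuous_const).inter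
      (isClosed_eq (continuous_apply 0) continuous_const))
  · intro h hh x _
    refine ⟨hh.1 x, ?_⟩
    have := le_pow_mul_of_harmonic hh.1 (ρ := l1 x + 1) (fun x _ => hh.2.1 x) x (by linarith)
    rwa [hh.2.2, mul_one] at this

/-- A nonempty compact family of normalised positive harmonic functions which is stable under
translation followed by normalisation. -/
structure IsStable (T : Set ((Fin d → ℤ) → ℝ)) : Prop where
  sub : T ⊆ posHarm d
  compact : IsCompact T
  nonempty : T.Nonempty
  shift : ∀ h ∈ T, ∀ y, (fun x => h (y + x) / h y) ∈ T

lemma isStable_posHarm : IsStable (posHarm d) where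
  sub := le_rfl
  compact := isCompact_posHarm
  nonempty := ⟨fun _ => 1, fun _ => zero_le_one, fun x => lap_const 1 x, rfl⟩
  shift := by
    intro h hh y
    have hy := posHarm_pos hh y
    refine ⟨fun x => div_nonneg (hh.1 _) hy.le, fun x => ?_, ?_⟩
    · have : (fun x => h (y + x) / h y) = fun x => (h y)⁻¹ * h (y + x) := by
        ext x; rw [div_eq_inv_mul]
      rw [this, lap_const_mul, lap_shift, hh.2.1, mul_zero]
    · simp [hy.ne']

lemma IsStable.exists_sub {T : Set ((Fin d → ℤ) → ℝ)} (hT : IsStable T) (j : Fin d) :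
    ∃ T' ⊆ T, IsStable T' ∧ ∃ m, (∀ h ∈ T, h (Pi.single j 1) ≤ m) ∧
      ∀ h ∈ T', ∀ x, h (x + Pi.single j 1) = m * h x := by
  obtain ⟨h₀, hh₀, hmax⟩ := hT.compact.exists_isMaxOn hT.nonempty
    (continuous_apply (Pi.single j 1 : Fin d → ℤ)).continuousOn
  set m := h₀ (Pi.single j 1) with hm
  have hle : ∀ h ∈ T, h (Pi.single j 1) ≤ m := fun h hh => hmax hh
  have hle' : ∀ h ∈ T, ∀ x, h (x + Pi.single j 1) ≤ m * h x := by
    intro h hh x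
    have := hle _ (hT.shift h hh x)
    rwa [div_le_iff₀ (posHarm_pos (hT.sub hh) x)] at this
  refine ⟨T ∩ {h | ∀ x, h (x + Pi.single j 1) = m * h x}, Set.inter_subset_left, ⟨?_, ?_, ?_, ?_⟩,
    m, hle, fun h hh => hh.2⟩
  · exact Set.inter_subset_left.trans hT.sub
  · refine hT.compact.inter_right ?_
    have : {h : (Fin d → ℤ) → ℝ | ∀ x, h (x + Pi.single j 1) = m * h x}
        = ⋂ x, {h | h (x + Pi.single j 1) = m * h x} := by ext h; simp
    rw [this]
    exact isClosed_iInter fun x => isClosed_eq (continuous_apply _)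
      (continuous_const.mul (continuous_apply _))
  · refine ⟨h₀, hh₀, fun x => ?_⟩
    have hp := hT.sub hh₀
    have := eq_zero_of_harmonic (g := fun x => m * h₀ x - h₀ (Pi.single j 1 + x))
      (fun x => by rw [add_comm (Pi.single j 1) x]; linarith [hle' h₀ hh₀ x])
      (fun x => by rw [lap_sub, lap_const_mul, lap_shift, hp.2.1, hp.2.1]; ring)
      (by simp [hp.2.2, hm]) x
    rw [add_comm]; linarith
  · rintro h ⟨hh, hhx⟩ y
    refine ⟨hT.shift h hh y, fun x => ?_⟩
    show h (y + (x + _)) / h y = m * (h (y + x) / h y)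
    rw [← add_assoc, hhx]; ring

lemma IsStable.exists_multiplicative {T : Set ((Fin d → ℤ) → ℝ)} (hT : IsStable T)
    (s : Finset (Fin d)) : ∃ T' ⊆ T, IsStable T' ∧
      ∀ i ∈ s, ∃ m, ∀ h ∈ T', ∀ x, h (x + Pi.single i 1) = m * h x := by
  classical
  induction s using Finset.induction_on with
  | empty => exact ⟨T, le_rfl, hT, by simp⟩
  | insert j s _ ih =>
    obtain ⟨T₁, h₁, hT₁, hm₁⟩ := ih
    obtain ⟨T₂, h₂, hT₂, m, _, hm⟩ := hT₁.exists_sub j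
    refine ⟨T₂, h₂.trans h₁, hT₂, fun i hi => ?_⟩
    rcases Finset.mem_insert.1 hi with rfl | hi
    · exact ⟨m, hm⟩
    · obtain ⟨m', hm'⟩ := hm₁ i hi
      exact ⟨m', fun h hh => hm' h (h₂ hh)⟩

lemma posHarm_single_le_one {h : (Fin d → ℤ) → ℝ} (hh : h ∈ posHarm d) (j : Fin d) :
    h (Pi.single j 1) ≤ 1 := by
  obtain ⟨T₁, _, hT₁, m, hle, hm⟩ := (isStable_posHarm (d := d)).exists_sub j
  obtain ⟨T₂, h₂, hT₂, hM⟩ := hT₁.exists_multiplicative Finset.univ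
  obtain ⟨f, hf⟩ := hT₂.nonempty
  have hfp := hT₂.sub hf
  have key : ∀ i, f (Pi.single i 1) * f (-Pi.single i 1) = 1 := by
    intro i
    obtain ⟨M, hMi⟩ := hM i (Finset.mem_univ i)
    have h1 := hMi f hf 0
    have h2 := hMi f hf (-Pi.single i 1)
    rw [zero_add, hfp.2.2, mul_one] at h1
    rw [neg_add_cancel, hfp.2.2] at h2
    rw [h1, ← h2]
  have hnn : ∀ i, 0 ≤ f (0 + Pi.single i 1) + f (0 - Pi.single i 1) - 2 * f 0 := by
    intro i
    rw [zero_add, zero_sub, hfp.2.2]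
    nlinarith [key i, hfp.1 (Pi.single i 1), hfp.1 (-Pi.single i 1),
      sq_nonneg (f (Pi.single i 1) - f (-Pi.single i 1))]
  have hz := (Finset.sum_eq_zero_iff_of_nonneg (fun i _ => hnn i)).1 (hfp.2.1 0) j
    (Finset.mem_univ j)
  rw [zero_add, zero_sub, hfp.2.2] at hz
  have hf1 : f (Pi.single j 1) = 1 := by nlinarith [key j]
  have hm1 : m = 1 := by
    have := hm f (h₂ hf) 0
    rw [zero_add, hfp.2.2, hf1] at this
    linarith
  exact hm1 ▸ hle h hh

/-- **Liouville theorem** for nonnegative harmonic functions on `ℤ^d`. -/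
lemma posHarm_eq_one {h : (Fin d → ℤ) → ℝ} (hh : h ∈ posHarm d) (x : Fin d → ℤ) : h x = 1 := by
  have hle : ∀ g ∈ posHarm d, ∀ x i, g (x + Pi.single i 1) ≤ g x := by
    intro g hg x i
    have := posHarm_single_le_one (isStable_posHarm.shift g hg x) i
    rwa [div_le_one (posHarm_pos hg x)] at this
  have hge : ∀ x i, h x ≤ h (x + Pi.single i 1) := by
    intro x i
    have hneg : (fun x => h (-x)) ∈ posHarm d :=
      ⟨fun x => hh.1 _, fun x => by rw [lap_neg, hh.2.1], by simp [hh.2.2]⟩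
    have := hle _ hneg (-(x + Pi.single i 1)) i
    simpa using this
  have heq : ∀ x i, h (x + Pi.single i 1) = h x := fun x i =>
    le_antisymm (hle h hh x i) (hge x i)
  refine lattice_induction (p := fun x => h x = 1) hh.2.2 (fun x hx y hy => ?_) x
  obtain ⟨i, rfl | rfl⟩ := mem_latNbrs.1 hy
  · rw [heq, hx]
  · rw [← heq, sub_add_cancel, hx]

/-- Nonnegative functions harmonic on a large ball are almost constant near the origin. -/
lemma almost_constant (R : ℝ) {δ : ℝ} (hδ : 0 < δ) :
    ∃ ρ : ℝ, 0 < ρ ∧ ∀ g : (Fin d → ℤ) → ℝ, (∀ x, 0 ≤ g x) →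
      (∀ x, eunorm x < ρ → lap g x = 0) → ∀ x, eunorm x ≤ R → |g x - g 0| ≤ δ * g 0 := by
  by_contra! hcon
  choose g hg0 hgl x hxR hgx using fun k : ℕ => hcon (k + 1) (by positivity)
  have hbd : ∀ y, ∀ᶠ k in (hyperfilter ℕ : Filter ℕ), g k y ≤ (2 * d) ^ l1 y * g k 0 := by
    intro y
    have h1 : ∀ᶠ k : ℕ in atTop, l1 y ≤ k := eventually_ge_atTop _
    refine (h1.filter_mono Nat.hyperfilter_le_atTop).mono fun k (hk : l1 y ≤ k) => ?_
    refine le_pow_mul_of_harmonic (hg0 k) (hgl k) y ?_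
    have : (l1 y : ℝ) ≤ k := by exact_mod_cast hk
    linarith
  have hfin : ∀ (p : (Fin d → ℤ) → ℕ → Prop), (∀ y, ∀ᶠ k in (hyperfilter ℕ : Filter ℕ), p y k) →
      ∀ᶠ k in (hyperfilter ℕ : Filter ℕ), p (x k) k := by
    intro p hp
    have : ∀ᶠ k in (hyperfilter ℕ : Filter ℕ), ∀ y ∈ ballF d R, p y k :=
      (Filter.eventually_all_finset _).2 fun y _ => hp y
    exact this.mono fun k hk => hk _ (mem_ballF.2 (hxR k))
  have hpos : ∀ᶠ k in (hyperfilter ℕ : Filter ℕ), 0 < g k 0 := by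
    refine (hfin _ hbd).mono fun k hk => ?_
    refine lt_of_le_of_ne (hg0 k 0) fun h0 => ?_
    have := hgx k
    rw [← h0] at hk this
    have hx0 : g k (x k) = 0 := le_antisymm (by simpa using hk) (hg0 k _)
    simp [hx0] at this
  have hlim : ∀ y, ∃ a, Tendsto (fun k => g k y / g k 0) (hyperfilter ℕ) (𝓝 a) := by
    intro y
    have hmem : ∀ᶠ k in (hyperfilter ℕ : Filter ℕ),
        g k y / g k 0 ∈ Set.Icc (0:ℝ) ((2 * d) ^ l1 y) := by
      filter_upwards [hbd y, hpos] with k hk hk0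
      exact ⟨div_nonneg (hg0 k y) hk0.le, (div_le_iff₀ hk0).2 hk⟩
    obtain ⟨a, _, ha⟩ := isCompact_Icc.ultrafilter_le_nhds
      ((hyperfilter ℕ).map fun k => g k y / g k 0) (by
        rw [le_principal_iff]; exact hmem)
    exact ⟨a, ha⟩
  choose h hh using hlim
  have hharm : h ∈ posHarm d := by
    refine ⟨fun y => ?_, fun y => ?_, ?_⟩
    · refine ge_of_tendsto (hh y) (hpos.mono fun k hk => div_nonneg (hg0 k y) hk.le)
    · have h1 : Tendsto (fun k => lap (fun z => g k z / g k 0) y) (hyperfilter ℕ) (𝓝 (lap h y)) := by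
        unfold lap
        exact tendsto_finsetSum _ fun i _ => ((hh _).add (hh _)).sub ((hh _).const_mul _)
      refine tendsto_nhds_unique h1 (tendsto_const_nhds.congr' ?_)
      have h2 : ∀ᶠ k : ℕ in atTop, ⌈eunorm y⌉₊ ≤ k := eventually_ge_atTop _
      refine (h2.filter_mono Nat.hyperfilter_le_atTop).mono fun k (hk : ⌈eunorm y⌉₊ ≤ k) => ?_
      have : (fun x => g k x / g k 0) = fun x => (g k 0)⁻¹ * g k x := by
        ext x; rw [div_eq_inv_mul]
      simp only [this]
      rw [lap_const_mul, hgl k y, mul_zero]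
      have : eunorm y ≤ k := (Nat.le_ceil _).trans (by exact_mod_cast hk)
      linarith
    · refine tendsto_nhds_unique (hh 0) (tendsto_const_nhds.congr' ?_)
      exact hpos.mono fun k hk => (div_self hk.ne').symm
  have hsmall : ∀ y, ∀ᶠ k in (hyperfilter ℕ : Filter ℕ), |g k y / g k 0 - 1| < δ := by
    intro y
    have := hh y
    rw [posHarm_eq_one hharm y] at this
    have h3 := (this.sub_const 1).abs
    rw [sub_self, abs_zero] at h3
    exact h3.eventually (gt_mem_nhds hδ)
  obtain ⟨k, hk, hk0⟩ := ((hfin _ hsmall).and hpos).exists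
  have h4 : g k (x k) / g k 0 - 1 = (g k (x k) - g k 0) / g k 0 := by field_simp
  rw [h4, abs_div, abs_of_pos hk0, div_lt_iff₀ hk0] at hk
  linarith [hgx k]

end Liouville

/-! ### Counting lattice points in balls -/

section Counting

variable {d : ℕ}

lemma eunorm_le_iff {r : ℝ} (hr : 0 ≤ r) {x : Fin d → ℤ} : eunorm x ≤ r ↔ sqn x ≤ r ^ 2 := by
  rw [← eunorm_sq]
  exact (pow_le_pow_iff_left₀ (eunorm_nonneg x) hr two_ne_zero).symm

/-- The Euclidean unit ball as a subset of the function space. -/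
lemma volume_unitBall_fun :
    volume.real {x : Fin d → ℝ | ∑ i, x i ^ 2 ≤ 1} = unitBallVol d := by
  have h1 : {x : Fin d → ℝ | ∑ i, x i ^ 2 ≤ 1}
      = WithLp.toLp 2 ⁻¹' (Metric.closedBall (0 : EuclideanSpace ℝ (Fin d)) 1) := by
    rw [EuclideanSpace.closedBall_zero_eq _ zero_le_one]
    ext x; simp
  rw [h1, measureReal_def, (PiLp.volume_preserving_toLp (Fin d)).measure_preimage
    measurableSet_closedBall.nullMeasurableSet]
  rcases Nat.eq_zero_or_pos d with rfl | hd
  · rw [unitBallVol]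
    congr 2
    ext x
    simp [Subsingleton.elim x 0]
  · have : Nonempty (Fin d) := ⟨⟨0, hd⟩⟩
    rw [unitBallVol, Measure.addHaar_closedBall_eq_addHaar_ball]

lemma unitBallVol_pos : 0 < unitBallVol d := by
  rw [unitBallVol]
  refine ENNReal.toReal_pos (Metric.measure_ball_pos volume _ one_pos).ne' ?_
  exact measure_ball_lt_top.ne

open scoped Pointwise in
lemma tendsto_card_ballF (d : ℕ) :
    Tendsto (fun r : ℝ => ((ballF d r).card : ℝ) / r ^ d) atTop (𝓝 (unitBallVol d)) := by
  set s : Set (Fin d → ℝ) := {x | ∑ i, x i ^ 2 ≤ 1} with hs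
  have hconv : Convex ℝ s := by
    have : s = (WithLp.linearEquiv 2 ℝ (Fin d → ℝ)).symm ⁻¹'
        (Metric.closedBall (0 : EuclideanSpace ℝ (Fin d)) 1) := by
      rw [EuclideanSpace.closedBall_zero_eq _ zero_le_one]
      ext x; simp [hs]
    rw [this]
    exact (convex_closedBall _ _).linear_preimage
      (WithLp.linearEquiv 2 ℝ (Fin d → ℝ)).symm.toLinearMap
  have hclosed : IsClosed s := isClosed_le (by fun_prop) continuous_const
  have hbdd : Bornology.IsBounded s := by
    refine (Metric.isBounded_closedBall (x := (0 : Fin d → ℝ)) (r := 1)).subset fun x hx => ?_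
    rw [mem_closedBall_zero_iff, pi_norm_le_iff_of_nonneg zero_le_one]
    intro i
    rw [Real.norm_eq_abs, ← sq_le_one_iff_abs_le_one]
    exact (Finset.single_le_sum (f := fun i => x i ^ 2) (fun j _ => sq_nonneg _)
      (Finset.mem_univ i)).trans hx
  have hmain := tendsto_card_div_pow_atTop_volume' s hbdd hclosed.measurableSet
    (hconv.addHaar_frontier volume) (by
      intro x y hx hxy
      rw [Set.smul_set_subset_iff₀ hx.ne', smul_smul]
      intro v hv
      have hy := hx.trans_le hxy
      rw [Set.mem_smul_set_iff_inv_smul_mem₀ (by positivity)]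
      have hle : (x⁻¹ * y)⁻¹ ≤ 1 := inv_le_one_of_one_le₀ (by rw [inv_mul_eq_div, one_le_div hx]; exact hxy)
      have h0 : 0 ≤ (x⁻¹ * y)⁻¹ := by positivity
      have hv' : ∑ i, v i ^ 2 ≤ 1 := hv
      simp only [hs, Set.mem_ofPred_eq, Pi.smul_apply, smul_eq_mul, mul_pow, ← Finset.mul_sum]
      have : ((x⁻¹ * y)⁻¹) ^ 2 ≤ 1 := pow_le_one₀ h0 hle
      exact mul_le_one₀ this (Finset.sum_nonneg fun i _ => sq_nonneg _) hv')
  rw [hs, volume_unitBall_fun, Fintype.card_fin] at hmain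
  refine hmain.congr' ?_
  filter_upwards [eventually_gt_atTop 0] with r hr
  congr 2
  rw [Nat.card_coe_set_eq]
  have : {x : Fin d → ℝ | ∑ i, x i ^ 2 ≤ 1} ∩
      r⁻¹ • ↑(Submodule.span ℤ (Set.range ⇑(Pi.basisFun ℝ (Fin d))))
      = (fun (x : Fin d → ℤ) i => r⁻¹ * (x i : ℝ)) '' (ballF d r : Set (Fin d → ℤ)) := by
    ext w
    simp only [Set.mem_inter_iff, Set.mem_image, mem_ballF,
      eunorm_le_iff hr.le, Set.mem_smul_set, SetLike.mem_coe,
      Module.Basis.mem_span_iff_repr_mem, Pi.basisFun_repr]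
    constructor
    · rintro ⟨hw, y, hy, rfl⟩
      choose x hx using hy
      simp only [algebraMap_int_eq, eq_intCast] at hx
      refine ⟨x, ?_, ?_⟩
      · simp only [Set.mem_ofPred_eq, Pi.smul_apply, smul_eq_mul, mul_pow, ← Finset.mul_sum] at hw
        rw [sqn]
        simp only [hx]
        rwa [inv_pow, inv_mul_le_iff₀ (by positivity), mul_one] at hw
      · ext i; simp [hx]
    · rintro ⟨x, hx, rfl⟩
      refine ⟨?_, fun i => x i, fun i => ⟨x i, by simp⟩, rfl⟩
      simp only [Set.mem_ofPred_eq, mul_pow, ← Finset.mul_sum]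
      rw [inv_pow, inv_mul_le_iff₀ (by positivity), mul_one]
      exact hx
  rw [this, Set.ncard_image_of_injective, Set.ncard_coe_finset]
  intro x y hxy
  ext i
  have := congrFun hxy i
  simp only [mul_eq_mul_left_iff, Int.cast_inj, inv_eq_zero] at this
  exact this.resolve_right hr.ne'

end Counting

/-! ### Green functions -/

section Green

variable {d : ℕ}

lemma lap_nonneg_of_eq_zero {g : (Fin d → ℤ) → ℝ} (hg : ∀ x, 0 ≤ g x) {x : Fin d → ℤ}
    (hx : g x = 0) : 0 ≤ lap g x := by
  rw [lap_eq_sum_latNbrs, hx, mul_zero, sub_zero]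
  exact Finset.sum_nonneg fun y _ => hg y

open Classical in
/-- The Dirichlet problem for the Poisson equation on a finite set is solvable. -/
lemma exists_dirichlet (hd : 0 < d) (D : Finset (Fin d → ℤ)) (b : (Fin d → ℤ) → ℝ) :
    ∃ g : (Fin d → ℤ) → ℝ, (∀ x, x ∉ D → g x = 0) ∧ ∀ x ∈ D, lap g x = b x := by
  let ext : (D → ℝ) → (Fin d → ℤ) → ℝ := fun f x => if h : x ∈ D then f ⟨x, h⟩ else 0
  have ext_add : ∀ f g, ext (f + g) = fun x => ext f x + ext g x := by
    intro f g; funext x; by_cases h : x ∈ D <;> simp [ext, h]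
  have ext_smul : ∀ (c : ℝ) f, ext (c • f) = fun x => c * ext f x := by
    intro c f; funext x; by_cases h : x ∈ D <;> simp [ext, h]
  let T : (D → ℝ) →ₗ[ℝ] (D → ℝ) :=
    { toFun := fun f x => lap (ext f) x
      map_add' := fun f g => by funext x; simp only [ext_add, lap_add, Pi.add_apply]
      map_smul' := fun c f => by
        funext x; simp only [ext_smul, lap_const_mul, RingHom.id_apply, Pi.smul_apply, smul_eq_mul] }
  have hinj : Function.Injective T := by
    rw [← LinearMap.ker_eq_bot, LinearMap.ker_eq_bot']
    intro f hf
    have hlap : ∀ x ∈ D, lap (ext f) x = 0 := fun x hx => congrFun hf ⟨x, hx⟩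
    have hb : ∀ y ∈ bdryF latNbrs D, ext f y = 0 := fun y hy => by
      simp [ext, notMem_of_mem_bdryF hy]
    funext x
    have h1 := comparison hd D (ext f) (fun _ => 0) (fun x hx => (hlap x hx).ge)
      (fun x _ => (lap_const 0 x).le) (fun y hy => (hb y hy).le) x x.2
    have h2 := comparison hd D (fun _ => 0) (ext f) (fun x _ => (lap_const 0 x).ge)
      (fun x hx => (hlap x hx).le) (fun y hy => (hb y hy).ge) x x.2
    have h3 : ext f x = f x := by simp [ext]
    rw [← h3]; exact le_antisymm h1 h2
  obtain ⟨f, hf⟩ := (LinearMap.injective_iff_surjective.1 hinj) fun x => b x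
  exact ⟨ext f, fun x hx => by simp [ext, hx], fun x hx => congrFun hf ⟨x, hx⟩⟩

/-- The properties of the Green function of a finite set with pole `z`. -/
structure IsGreen (D : Finset (Fin d → ℤ)) (z : Fin d → ℤ) (g : (Fin d → ℤ) → ℝ) : Prop where
  nonneg : ∀ x, 0 ≤ g x
  off : ∀ x, x ∉ D → g x = 0
  pole : lap g z = -1
  harmonic : ∀ x ∈ D, x ≠ z → lap g x = 0

lemma exists_green (hd : 0 < d) {D : Finset (Fin d → ℤ)} {z : Fin d → ℤ} (hz : z ∈ D) :
    ∃ g, IsGreen D z g := by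
  classical
  obtain ⟨g, hg0, hg⟩ := exists_dirichlet hd D (fun x => if x = z then -1 else 0)
  refine ⟨g, fun x => ?_, hg0, by rw [hg z hz, if_pos rfl], fun x hx hxz => by
    rw [hg x hx, if_neg hxz]⟩
  by_cases hx : x ∈ D
  · refine comparison hd D (fun _ => 0) g (fun x _ => (lap_const 0 x).ge) (fun x hx => ?_)
      (fun y hy => (hg0 y (notMem_of_mem_bdryF hy)).ge) x hx
    rw [hg x hx]; split_ifs <;> norm_num
  · rw [hg0 x hx]

lemma IsGreen.subharmonic {D : Finset (Fin d → ℤ)} {z : Fin d → ℤ} {g : (Fin d → ℤ) → ℝ}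
    (hg : IsGreen D z g) {x : Fin d → ℤ} (hx : x ≠ z) : 0 ≤ lap g x := by
  by_cases hxD : x ∈ D
  · exact (hg.harmonic x hxD hx).ge
  · exact lap_nonneg_of_eq_zero hg.nonneg (hg.off x hxD)

lemma lap_abs_coord (i : Fin d) (c : ℤ) (x : Fin d → ℤ) :
    lap (fun x => |(x i : ℝ) - c|) x = if x i = c then 2 else 0 := by
  rw [lap, Finset.sum_eq_single i]
  · simp only [Pi.add_apply, Pi.sub_apply, Pi.single_eq_same]
    push_cast
    split_ifs with h
    · rw [h]; norm_num
    · rcases lt_or_gt_of_ne h with h | h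
      · have h' : (x i : ℝ) + 1 ≤ c := by exact_mod_cast h
        rw [abs_of_nonpos, abs_of_nonpos, abs_of_nonpos] <;> linarith
      · have h' : (c : ℝ) + 1 ≤ x i := by exact_mod_cast h
        rw [abs_of_nonneg, abs_of_nonneg, abs_of_nonneg] <;> linarith
  · intro j _ hj
    simp only [Pi.add_apply, Pi.sub_apply, Pi.single_eq_of_ne hj.symm]
    push_cast; ring_nf
  · simp

lemma IsGreen.le (hd : 0 < d) {r : ℝ} (hr : 0 ≤ r) {z : Fin d → ℤ} {g : (Fin d → ℤ) → ℝ}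
    (hz : eunorm z ≤ r) (hg : IsGreen (ballF d r) z g) (x : Fin d → ℤ) : g x ≤ r + 1 := by
  set i : Fin d := ⟨0, hd⟩
  by_cases hx : x ∈ ballF d r
  swap
  · rw [hg.off x hx]; linarith
  have hab : ∀ y, eunorm y ≤ r + 1 → |(y i : ℝ) - z i| ≤ 2 * r + 2 := by
    intro y hy
    have h1 := abs_le.1 (abs_coord_le y i)
    have h2 := abs_le.1 (abs_coord_le z i)
    rw [abs_le]; constructor <;> linarith
  have key := max_principle hd (ballF d r)
    (fun x => g x + (1/2) * |(x i : ℝ) - z i|) (r + 1) (fun y hy => ?_) (fun y hy => ?_) x hx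
  · have := abs_nonneg ((x i : ℝ) - z i)
    linarith
  · rw [lap_add, lap_const_mul, lap_abs_coord]
    by_cases hyz : y = z
    · rw [hyz, hg.pole]; simp
    · rw [hg.harmonic y hy hyz]; split_ifs <;> norm_num
  · obtain ⟨⟨w, hw, hwy⟩, hy'⟩ := mem_bdryF.1 hy
    rw [hg.off y hy']
    have := hab y (by linarith [eunorm_le_of_mem_latNbrs hwy, mem_ballF.1 hw])
    linarith

/-- Summation by parts. -/
lemma tsum_mul_lap {f : (Fin d → ℤ) → ℝ} (hf : f.support.Finite) (w : (Fin d → ℤ) → ℝ) :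
    ∑' x, f x * lap w x = ∑' x, lap f x * w x := by
  have hs : ∀ (a b : (Fin d → ℤ)) (F : (Fin d → ℤ) → ℝ), 
      Summable fun x => f (x + a) * F (x + b) := by
    intro a b F
    refine summable_of_hasFiniteSupport ((hf.preimage (add_left_injective a).injOn).subset ?_)
    intro x hx
    simp only [Function.mem_support, Set.mem_preimage] at hx ⊢
    exact left_ne_zero_of_mul hx
  have e1 : ∀ x, f x * lap w x = ∑ i, ((f (x + 0) * w (x + Pi.single i 1)
      + f (x + 0) * w (x + -Pi.single i 1)) - 2 * (f (x + 0) * w (x + 0))) := by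
    intro x; rw [lap, Finset.mul_sum]
    exact Finset.sum_congr rfl fun i _ => by rw [add_zero, sub_eq_add_neg x]; ring
  have e2 : ∀ x, lap f x * w x = ∑ i, ((f (x + Pi.single i 1) * w (x + 0)
      + f (x + -Pi.single i 1) * w (x + 0)) - 2 * (f (x + 0) * w (x + 0))) := by
    intro x; rw [lap, Finset.sum_mul]
    exact Finset.sum_congr rfl fun i _ => by rw [add_zero, sub_eq_add_neg x]; ring
  simp only [e1, e2]
  rw [Summable.tsum_finsetSum fun i _ => ((hs _ _ _).add (hs _ _ _)).sub ((hs _ _ _).mul_left 2),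
    Summable.tsum_finsetSum fun i _ => ((hs _ _ _).add (hs _ _ _)).sub ((hs _ _ _).mul_left 2)]
  refine Finset.sum_congr rfl fun i _ => ?_
  rw [Summable.tsum_sub ((hs _ _ _).add (hs _ _ _)) ((hs _ _ _).mul_left 2),
    Summable.tsum_sub ((hs _ _ _).add (hs _ _ _)) ((hs _ _ _).mul_left 2),
    Summable.tsum_add (hs _ _ _) (hs _ _ _), Summable.tsum_add (hs _ _ _) (hs _ _ _)]
  have t1 : ∑' x, f (x + 0) * w (x + Pi.single i 1) = ∑' x, f (x + -Pi.single i 1) * w (x + 0) := by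
    rw [← (Equiv.addRight (-Pi.single i 1 : Fin d → ℤ)).tsum_eq]
    refine tsum_congr fun x => ?_
    simp [Equiv.coe_addRight, add_assoc]
  have t2 : ∑' x, f (x + 0) * w (x + -Pi.single i 1) = ∑' x, f (x + Pi.single i 1) * w (x + 0) := by
    rw [← (Equiv.addRight (Pi.single i 1 : Fin d → ℤ)).tsum_eq]
    refine tsum_congr fun x => ?_
    simp [Equiv.coe_addRight, add_assoc]
  rw [t1, t2]; ring

/-- Integrating the Laplacian of a function against a Green function. -/
lemma IsGreen.sum_mul_lap_le {D : Finset (Fin d → ℤ)} {z : Fin d → ℤ} {g : (Fin d → ℤ) → ℝ}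
    (hz : z ∈ D) (hg : IsGreen D z g) {w : (Fin d → ℤ) → ℝ} {W : ℝ}
    (hw : ∀ y ∈ bdryF latNbrs D, w y ≤ W) :
    ∑ x ∈ D, g x * lap w x ≤ -(w z - W) := by
  classical
  have hsupp : g.support.Finite := D.finite_toSet.subset fun x hx => by
    by_contra h; exact hx (hg.off x h)
  have h1 : ∑ x ∈ D, g x * lap w x = ∑' x, g x * lap (fun y => w y - W) x := by
    rw [tsum_eq_sum (s := D) (fun x hx => by rw [hg.off x hx, zero_mul])]
    refine Finset.sum_congr rfl fun x _ => ?_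
    rw [lap_sub, lap_const, sub_zero]
  rw [h1, tsum_mul_lap hsupp, tsum_eq_sum (s := D ∪ bdryF latNbrs D)]
  · have hzU : z ∈ D ∪ bdryF latNbrs D := Finset.mem_union_left _ hz
    rw [← Finset.add_sum_erase _ _ hzU, hg.pole]
    have : ∑ x ∈ (D ∪ bdryF latNbrs D).erase z, lap g x * (w x - W) ≤ 0 := by
      refine Finset.sum_nonpos fun x hx => ?_
      have hxz := Finset.ne_of_mem_erase hx
      rcases Finset.mem_union.1 (Finset.mem_of_mem_erase hx) with h | h
      · rw [hg.harmonic x h hxz, zero_mul]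
      · exact mul_nonpos_of_nonneg_of_nonpos (hg.subharmonic hxz) (by linarith [hw x h])
    linarith
  · intro x hx
    rw [Finset.mem_union, not_or] at hx
    have : lap g x = 0 := by
      rw [lap_eq_sum_latNbrs, hg.off x hx.1, mul_zero, sub_zero]
      refine Finset.sum_eq_zero fun y hy => hg.off y fun hyD => ?_
      rcases mem_or_mem_bdryF hyD (mem_latNbrs_comm.1 hy) with h | h
      exacts [hx.1 h, hx.2 h]
    rw [this, zero_mul]

end Green

/-! ### A radial potential -/

section Potential

/-- A continuous modification of `σ ↦ σ ^ (-p)`. -/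
noncomputable def prof (a p σ : ℝ) : ℝ := (max (σ - a) 1) ^ (-p)

/-- A primitive of `-prof`. -/
noncomputable def pot (a p s : ℝ) : ℝ := -∫ t in (0 : ℝ)..s, prof a p t

variable {a p : ℝ}

lemma continuous_prof : Continuous (prof a p) := by
  unfold prof
  refine Continuous.rpow_const (by fun_prop) fun x => Or.inl ?_
  have : (1 : ℝ) ≤ max (x - a) 1 := le_max_right _ _
  linarith

lemma prof_of_le {σ : ℝ} (h : a + 1 ≤ σ) : prof a p σ = (σ - a) ^ (-p) := by
  rw [prof, max_eq_left (by linarith)]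

lemma prof_antitone (hp : 0 ≤ p) : Antitone (prof a p) := by
  intro x y hxy
  refine Real.rpow_le_rpow_of_nonpos ?_ (max_le_max_right 1 (by linarith)) (by linarith)
  exact lt_of_lt_of_le one_pos (le_max_right _ _)

lemma rpow_le_prof (ha : 0 ≤ a) (hp : 0 ≤ p) {σ : ℝ} (hσ : 1 ≤ σ) : σ ^ (-p) ≤ prof a p σ := by
  refine Real.rpow_le_rpow_of_nonpos ?_ (max_le (by linarith) hσ) (by linarith)
  exact lt_of_lt_of_le one_pos (le_max_right _ _)

lemma hasDerivAt_pot (s : ℝ) : HasDerivAt (pot a p) (-prof a p s) s :=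
  (intervalIntegral.integral_hasDerivAt_right (continuous_prof.intervalIntegrable _ _)
    (continuous_prof.stronglyMeasurableAtFilter _ _) continuous_prof.continuousAt).neg

lemma pot_sub_le (hp : 0 ≤ p) {s t : ℝ} (hst : s ≤ t) :
    pot a p s - pot a p t ≤ prof a p s * (t - s) := by
  have h : MonotoneOn (fun x => pot a p x + prof a p s * x) (Set.Ici s) := by
    have hd : ∀ x, HasDerivAt (fun x => pot a p x + prof a p s * x)
        (-prof a p x + prof a p s * 1) x :=
      fun x => (hasDerivAt_pot x).add ((hasDerivAt_id x).const_mul _)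
    refine monotoneOn_of_deriv_nonneg (convex_Ici s)
      (fun x _ => (hd x).continuousAt.continuousWithinAt)
      (fun x _ => (hd x).differentiableAt.differentiableWithinAt) fun x hx => ?_
    rw [interior_Ici] at hx
    rw [(hd x).deriv]
    linarith [prof_antitone (a := a) hp (le_of_lt hx)]
  have := h (Set.mem_Ici.2 le_rfl) (Set.mem_Ici.2 hst) hst
  simp only at this
  linarith

lemma pot_second_diff (hp : 0 < p) {Q h : ℝ} (hh : 0 ≤ h) (hQ : a + 1 + h < Q) :
    2 * pot a p Q + p * h ^ 2 * (Q - a) ^ (-p - 1) ≤ pot a p (Q + h) + pot a p (Q - h) := by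
  set τ := Q - a with hτ
  have hτ0 : 0 < τ := by linarith
  set K : ℝ → ℝ := fun t => pot a p (Q + t) + pot a p (Q - t) - p * t ^ 2 * τ ^ (-p - 1) with hK
  set K' : ℝ → ℝ := fun t => -(τ + t) ^ (-p) + (τ - t) ^ (-p) - 2 * p * t * τ ^ (-p - 1) with hK'
  have dK : ∀ t, 0 ≤ t → t ≤ h → HasDerivAt K (K' t) t := by
    intro t ht0 hth
    have e1 := (hasDerivAt_pot (a := a) (p := p) (Q + t)).comp_const_add Q t
    have e2 := (hasDerivAt_pot (a := a) (p := p) (Q - t)).comp_const_sub Q t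
    have e3 := ((hasDerivAt_pow 2 t).const_mul p).mul_const (τ ^ (-p - 1))
    refine ((e1.add e2).sub e3).congr_deriv ?_
    rw [prof_of_le (by linarith), prof_of_le (by linarith), hK']
    have r1 : Q + t - a = τ + t := by rw [hτ]; ring
    have r2 : Q - t - a = τ - t := by rw [hτ]; ring
    rw [r1, r2]; push_cast; ring
  have dK' : ∀ t, 0 ≤ t → t ≤ h → HasDerivAt K'
      (p * (τ + t) ^ (-p - 1) + p * (τ - t) ^ (-p - 1) - 2 * p * τ ^ (-p - 1)) t := by
    intro t ht0 hth
    have e1 := ((hasDerivAt_id t).const_add τ).rpow_const (p := -p) (Or.inl (by simp; linarith))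
    have e2 := ((hasDerivAt_id t).const_sub τ).rpow_const (p := -p) (Or.inl (by simp; linarith))
    have e3 := ((hasDerivAt_id t).const_mul (2 * p)).mul_const (τ ^ (-p - 1))
    refine ((e1.neg.add e2).sub e3).congr_deriv ?_
    simp only [id]; ring
  have hpos_t : ∀ t, 0 ≤ t → t ≤ h →
      0 ≤ p * (τ + t) ^ (-p - 1) + p * (τ - t) ^ (-p - 1) - 2 * p * τ ^ (-p - 1) := by
    intro t ht0 hth
    have h1 : 0 < τ + t := by linarith
    have h2 : 0 < τ - t := by linarith
    have A := Real.rpow_pos_of_pos h1 (-p - 1)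
    have B := Real.rpow_pos_of_pos h2 (-p - 1)
    have C := Real.rpow_pos_of_pos hτ0 (-p - 1)
    have hAB : (τ ^ (-p - 1)) * (τ ^ (-p - 1)) ≤ (τ + t) ^ (-p - 1) * (τ - t) ^ (-p - 1) := by
      rw [← Real.mul_rpow h1.le h2.le, ← Real.mul_rpow hτ0.le hτ0.le]
      exact Real.rpow_le_rpow_of_nonpos (by positivity) (by nlinarith) (by linarith)
    have : 2 * τ ^ (-p - 1) ≤ (τ + t) ^ (-p - 1) + (τ - t) ^ (-p - 1) := by
      refine abs_le_of_sq_le_sq' ?_ (by positivity) |>.2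
      nlinarith [sq_nonneg ((τ + t) ^ (-p - 1) - (τ - t) ^ (-p - 1))]
    nlinarith
  have m' : MonotoneOn K' (Set.Icc 0 h) := by
    refine monotoneOn_of_deriv_nonneg (convex_Icc 0 h)
      (fun x hx => (dK' x hx.1 hx.2).continuousAt.continuousWithinAt) (fun x hx => ?_)
      fun x hx => ?_
    all_goals
      rw [interior_Icc] at hx
    · exact (dK' x hx.1.le hx.2.le).differentiableAt.differentiableWithinAt
    · rw [(dK' x hx.1.le hx.2.le).deriv]; exact hpos_t x hx.1.le hx.2.le
  have K'0 : K' 0 = 0 := by simp [hK']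
  have m : MonotoneOn K (Set.Icc 0 h) := by
    refine monotoneOn_of_deriv_nonneg (convex_Icc 0 h)
      (fun x hx => (dK x hx.1 hx.2).continuousAt.continuousWithinAt) (fun x hx => ?_)
      fun x hx => ?_
    all_goals
      rw [interior_Icc] at hx
    · exact (dK x hx.1.le hx.2.le).differentiableAt.differentiableWithinAt
    · rw [(dK x hx.1.le hx.2.le).deriv, ← K'0]
      exact m' ⟨le_rfl, hh⟩ ⟨hx.1.le, hx.2.le⟩ hx.1.le
  have := m ⟨le_rfl, hh⟩ ⟨hh, le_rfl⟩ hh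
  simp only [hK] at this
  simp only [add_zero, sub_zero] at this
  nlinarith

/-- `(T + 1) ^ (p + 1) ≤ (T + a) T ^ p`. -/
lemma prof_le_mul (hp : 0 < p) (ha : 2 * p + 3 ≤ a) {T : ℝ} (hT : 2 * p ≤ T) (hT1 : 1 ≤ T) :
    T ^ (-p) ≤ (T + a) * (T + 1) ^ (-p - 1) := by
  have hT0 : 0 < T := by linarith
  have h1 : (1 + 1 / T) ^ p ≤ 1 + 2 * p / T := by
    have e1 : (1 + 1 / T) ^ p ≤ Real.exp (p / T) := by
      have : 1 + 1 / T ≤ Real.exp (1 / T) := by linarith [Real.add_one_le_exp (1 / T)]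
      calc (1 + 1 / T) ^ p ≤ (Real.exp (1 / T)) ^ p :=
            Real.rpow_le_rpow (by positivity) this hp.le
        _ = Real.exp (p / T) := by rw [← Real.exp_mul]; congr 1; ring
    have hu : p / T ≤ 1 / 2 := by rw [div_le_div_iff₀ hT0 two_pos]; linarith
    have hu0 : 0 ≤ p / T := by positivity
    have e2 := (abs_le.1 (Real.abs_exp_sub_one_sub_id_le (x := p / T)
      (by rw [abs_of_nonneg hu0]; linarith))).2
    have e3 : 2 * p / T = 2 * (p / T) := by ring
    rw [e3]; nlinarith
  have h2 : (T + 1) ^ p = T ^ p * (1 + 1 / T) ^ p := by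
    rw [← Real.mul_rpow hT0.le (by positivity)]; congr 1; field_simp
  have hTp := Real.rpow_pos_of_pos hT0 p
  have hT1p : 0 < (T + 1) ^ p := Real.rpow_pos_of_pos (by linarith) p
  rw [Real.rpow_neg hT0.le, Real.rpow_sub (by linarith), Real.rpow_neg (by linarith), Real.rpow_one]
  have h3 : (T + 1) * (1 + 2 * p / T) ≤ T + a := by
    have : 2 * p / T ≤ 1 := by rw [div_le_one hT0]; linarith
    have e : T * (2 * p / T) = 2 * p := by field_simp
    nlinarith
  have h4 : (T + 1) ^ p * (T + 1) ≤ (T + a) * T ^ p := by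
    rw [h2]
    calc T ^ p * (1 + 1 / T) ^ p * (T + 1) ≤ T ^ p * (1 + 2 * p / T) * (T + 1) := by gcongr
      _ = T ^ p * ((T + 1) * (1 + 2 * p / T)) := by ring
      _ ≤ T ^ p * (T + a) := by gcongr
      _ = _ := by ring
  rw [← mul_div_assoc, ← div_eq_mul_inv, div_div, inv_eq_one_div, div_le_div_iff₀ hTp (by positivity)]
  linarith

lemma sqn_add_single {d : ℕ} (x : Fin d → ℤ) (i : Fin d) :
    sqn (x + Pi.single i 1) = sqn x + 1 + 2 * x i := by
  classical
  have : sqn (x + Pi.single i 1) - sqn x = 1 + 2 * x i := by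
    rw [sqn, sqn, ← Finset.sum_sub_distrib, Finset.sum_eq_single i]
    · simp; ring
    · intro j _ hj; simp [hj]
    · simp
  linarith

lemma sqn_sub_single {d : ℕ} (x : Fin d → ℤ) (i : Fin d) :
    sqn (x - Pi.single i 1) = sqn x + 1 - 2 * x i := by
  have := sqn_add_single (x - Pi.single i 1) i
  simp only [sub_add_cancel, Pi.sub_apply, Pi.single_eq_same] at this
  push_cast at this; linarith

lemma lap_sqn {d : ℕ} (x : Fin d → ℤ) : lap sqn x = 2 * d := by
  rw [lap, Finset.sum_congr rfl (g := fun _ => (2 : ℝ)) fun i _ => by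
    rw [sqn_add_single, sqn_sub_single]; ring]
  simp [mul_comm]

lemma lap_pot_nonneg {d : ℕ} (hd : 0 < d) {a : ℝ} (ha : d + 3 ≤ a) {x : Fin d → ℤ}
    (hx : 4 * a ≤ eunorm x) : 0 ≤ lap (fun x => pot a (d / 2) (sqn x)) x := by
  have hd1 : (1 : ℝ) ≤ d := by exact_mod_cast hd
  set p : ℝ := (d : ℝ) / 2 with hpdef
  have hp : 0 < p := by positivity
  set s := sqn x with hs
  have hs2 : eunorm x ^ 2 = s := eunorm_sq x
  have hsa : a + 1 + 2 * eunorm x < s + 1 := by nlinarith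
  have hsa' : a + d + 1 ≤ s := by nlinarith
  have h1 : ∀ i, 2 * pot a p (s + 1) + p * (2 * (x i : ℝ)) ^ 2 * (s + 1 - a) ^ (-p - 1)
      ≤ pot a p (sqn (x + Pi.single i 1)) + pot a p (sqn (x - Pi.single i 1)) := by
    intro i
    have hxi := abs_coord_le x i
    have := pot_second_diff (a := a) hp (Q := s + 1) (h := |2 * (x i : ℝ)|) (abs_nonneg _)
      (by rw [abs_mul, abs_two]; linarith)
    rw [sq_abs] at this
    refine this.trans (le_of_eq ?_)
    rw [sqn_add_single, sqn_sub_single]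
    rcases abs_cases (2 * (x i : ℝ)) with h | h
    · rw [h.1]
    · rw [h.1]; rw [add_comm (pot a p _)]; congr 2; ring
  have h2 := pot_sub_le (a := a) hp.le (s := s) (t := s + 1) (by linarith)
  rw [prof_of_le (by linarith)] at h2
  have h3 := prof_le_mul (a := a) hp (by rw [hpdef]; linarith) (T := s - a)
    (by rw [hpdef]; linarith) (by linarith)
  have h4 : s - a + 1 = s + 1 - a := by ring
  rw [h4, sub_add_cancel] at h3
  rw [lap]
  have h5 : ∑ i : Fin d, (2 * pot a p (s + 1) + p * (2 * (x i : ℝ)) ^ 2 * (s + 1 - a) ^ (-p - 1)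
      - 2 * pot a p s) = 2 * d * (pot a p (s + 1) - pot a p s
        + s * (s + 1 - a) ^ (-p - 1)) := by
    have e : ∀ i : Fin d, (2 * pot a p (s + 1) + p * (2 * (x i : ℝ)) ^ 2 * (s + 1 - a) ^ (-p - 1)
      - 2 * pot a p s) = (2 * pot a p (s + 1) - 2 * pot a p s)
        + (4 * p * (s + 1 - a) ^ (-p - 1)) * (x i : ℝ) ^ 2 := fun i => by ring
    rw [Finset.sum_congr rfl fun i _ => e i, Finset.sum_add_distrib, ← Finset.mul_sum]
    have : ∑ i, (x i : ℝ) ^ 2 = s := rfl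
    rw [this]
    simp only [Finset.sum_const, Finset.card_univ, Fintype.card_fin, nsmul_eq_mul]
    rw [hpdef]; ring
  calc (0 : ℝ) ≤ 2 * d * (pot a p (s + 1) - pot a p s + s * (s + 1 - a) ^ (-p - 1)) := by
        refine mul_nonneg (by positivity) (by linarith)
    _ ≤ _ := by rw [← h5]; exact Finset.sum_le_sum fun i _ => by linarith [h1 i]

/-- Comparison of the potential with a linear function of the radius. -/
lemma pot_radial {d : ℕ} (hd : 0 < d) {a : ℝ} (ha : 0 ≤ a) {n b c : ℝ} (hc : 1 ≤ c) (hcb : c ≤ b)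
    (hb : b ≤ n) :
    2 * n * (b - c) ≤ n ^ d * (pot a (d / 2) (c ^ 2) - pot a (d / 2) (b ^ 2)) := by
  set p : ℝ := (d : ℝ) / 2 with hpdef
  have hp : 0 ≤ p := by positivity
  have hD : ∀ r, HasDerivAt (fun r => n ^ d * pot a p (r ^ 2) + 2 * n * r)
      (n ^ d * (-prof a p (r ^ 2) * (2 * r)) + 2 * n * 1) r := by
    intro r
    have e := (hasDerivAt_pot (a := a) (p := p) (r ^ 2)).comp r (hasDerivAt_pow 2 r)
    refine ((e.const_mul (n ^ d)).add ((hasDerivAt_id r).const_mul (2 * n))).congr_deriv ?_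
    simp
  have h : AntitoneOn (fun r => n ^ d * pot a p (r ^ 2) + 2 * n * r) (Set.Icc c b) := by
    refine antitoneOn_of_deriv_nonpos (convex_Icc _ _)
      (fun x _ => (hD x).continuousAt.continuousWithinAt)
      (fun x _ => (hD x).differentiableAt.differentiableWithinAt) fun r hr => ?_
    rw [interior_Icc] at hr
    rw [(hD r).deriv]
    have hr1 : 1 ≤ r := hc.trans hr.1.le
    have hrn : r ≤ n := hr.2.le.trans hb
    have h1 : (r ^ d)⁻¹ ≤ prof a p (r ^ 2) := by
      refine le_of_eq_of_le ?_ (rpow_le_prof (p := p) ha hp (by nlinarith))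
      rw [← Real.rpow_natCast, ← Real.rpow_natCast, ← Real.rpow_neg (by linarith),
        ← Real.rpow_mul (by linarith)]
      congr 1; rw [hpdef]; push_cast; ring
    have h2 : n ≤ n ^ d * ((r ^ d)⁻¹ * r) := by
      obtain ⟨k, rfl⟩ : ∃ k, d = k + 1 := ⟨d - 1, by omega⟩
      have : r ^ k ≤ n ^ k := pow_le_pow_left₀ (by linarith) hrn k
      have hrk : 0 < r ^ k := by positivity
      have e : n ^ (k + 1) * ((r ^ (k + 1))⁻¹ * r) = n * (n ^ k / r ^ k) := by
        field_simp; ring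
      rw [e]
      have : 1 ≤ n ^ k / r ^ k := by rwa [one_le_div hrk]
      nlinarith
    have h3 : (r ^ d)⁻¹ * r ≤ prof a p (r ^ 2) * r := mul_le_mul_of_nonneg_right h1 (by linarith)
    have h4 : n ^ d * ((r ^ d)⁻¹ * r) ≤ n ^ d * (prof a p (r ^ 2) * r) :=
      mul_le_mul_of_nonneg_left h3 (by have : 0 ≤ n := by linarith
                                       positivity)
    nlinarith
  have := h ⟨le_rfl, hcb⟩ ⟨hcb, le_rfl⟩ hcb
  simp only at this
  linarith

end Potential

/-! ### The mass of the potential -/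

section Mass

variable {d : ℕ}

lemma lap_eq_sum_sub (w : (Fin d → ℤ) → ℝ) (x : Fin d → ℤ) :
    lap w x = ∑ y ∈ latNbrs x, (w y - w x) := by
  rw [lap_eq_sum_latNbrs, Finset.sum_sub_distrib, Finset.sum_const, card_latNbrs, nsmul_eq_mul]
  push_cast; ring

open Classical in
/-- The discrete divergence theorem. -/
lemma sum_lap_eq (B : Finset (Fin d → ℤ)) (w : (Fin d → ℤ) → ℝ) :
    ∑ x ∈ B, lap w x = ∑ x ∈ B, ∑ y ∈ latNbrs x with y ∉ B, (w y - w x) := by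
  set S := ∑ x ∈ B, ∑ y ∈ latNbrs x with y ∈ B, (w y - w x) with hS
  have hS1 : S = ∑ x ∈ B, ∑ y ∈ B, if y ∈ latNbrs x then w y - w x else 0 := by
    refine Finset.sum_congr rfl fun x _ => ?_
    rw [← Finset.sum_filter]
    refine Finset.sum_congr ?_ fun _ _ => rfl
    ext y; simp [and_comm]
  have hS0 : S = -S := by
    conv_lhs => rw [hS1, Finset.sum_comm]
    rw [hS1, ← Finset.sum_neg_distrib]
    refine Finset.sum_congr rfl fun x _ => ?_
    rw [← Finset.sum_neg_distrib]
    refine Finset.sum_congr rfl fun y _ => ?_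
    simp only [mem_latNbrs_comm (x := y) (y := x)]
    split_ifs <;> ring
  have h : ∑ x ∈ B, lap w x = S + ∑ x ∈ B, ∑ y ∈ latNbrs x with y ∉ B, (w y - w x) := by
    rw [hS, ← Finset.sum_add_distrib]
    refine Finset.sum_congr rfl fun x _ => ?_
    rw [lap_eq_sum_sub, Finset.sum_filter_add_sum_filter_not]
  rw [h]; linarith

open Classical in
lemma le_sum_lap {B L : Finset (Fin d → ℤ)} {w : (Fin d → ℤ) → ℝ} {C : ℝ} (hC : 0 ≤ C)
    (hLB : L ⊆ B) (hL : ∀ x ∈ B, ∀ y ∈ latNbrs x, y ∉ B → x ∈ L)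
    (hw : ∀ x ∈ B, ∀ y ∈ latNbrs x, y ∉ B → -C ≤ w y - w x) :
    -(2 * d * C * L.card) ≤ ∑ x ∈ B, lap w x := by
  have h1 : ∀ x ∈ B, (if x ∈ L then -(2 * d * C) else 0)
      ≤ ∑ y ∈ latNbrs x with y ∉ B, (w y - w x) := by
    intro x hx
    split_ifs with hxL
    · calc -(2 * d * C) ≤ ∑ y ∈ latNbrs x with y ∉ B, (-C) := by
            rw [Finset.sum_const, nsmul_eq_mul]
            have h2 : (((latNbrs x).filter (· ∉ B)).card : ℝ) ≤ 2 * d := by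
              have := Finset.card_filter_le (latNbrs x) (· ∉ B)
              rw [card_latNbrs] at this
              exact_mod_cast this
            nlinarith
        _ ≤ _ := Finset.sum_le_sum fun y hy => by
            rw [Finset.mem_filter] at hy; exact hw x hx y hy.1 hy.2
    · refine Finset.sum_nonneg fun y hy => ?_
      rw [Finset.mem_filter] at hy
      exact absurd (hL x hx y hy.1 hy.2) hxL
  rw [sum_lap_eq]
  refine le_trans ?_ (Finset.sum_le_sum h1)
  rw [← Finset.sum_filter, Finset.sum_const, nsmul_eq_mul,
    Finset.filter_mem_eq_inter, Finset.inter_eq_right.2 hLB]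
  linarith

lemma pow_mul_prof_le (hd : 0 < d) {a : ℝ} (ha : 0 ≤ a) {n : ℝ} (hn : 2 * (a + 2) * d ≤ n)
    {σ : ℝ} (hσ : (n - 1) ^ 2 ≤ σ) :
    n ^ d * prof a (d / 2) σ ≤ 1 + 2 * (a + 2) * d / n := by
  have hd1 : (1 : ℝ) ≤ d := by exact_mod_cast hd
  set A := a + 2 with hA
  have hAn : 2 * A ≤ n := by nlinarith
  have hn0 : 0 < n := by linarith
  have hq : n * (n - A) ≤ (n - 1) ^ 2 - a := by nlinarith
  have hq0 : 1 ≤ n * (n - A) := by nlinarith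
  have h1 : prof a (d / 2) σ ≤ (n * (n - A)) ^ (-((d : ℝ) / 2)) := by
    rw [prof_of_le (by linarith)]
    exact Real.rpow_le_rpow_of_nonpos (by linarith) (by linarith) (by linarith)
  have h2 : n ^ d = (n ^ 2) ^ ((d : ℝ) / 2) := by
    rw [← Real.rpow_natCast n 2, ← Real.rpow_mul hn0.le, ← Real.rpow_natCast]
    congr 1; push_cast; ring
  have h3 : n ^ 2 / (n * (n - A)) ≤ Real.exp (2 * A / n) := by
    have e1 := Real.add_one_le_exp (2 * A / n)
    refine le_trans ?_ e1
    rw [div_le_iff₀ (by linarith)]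
    have : (2 * A / n + 1) * (n * (n - A)) = (2 * A + n) * (n - A) := by field_simp
    rw [this]; nlinarith
  have hu0 : 0 ≤ A * d / n := by positivity
  have hu1 : A * d / n ≤ 1 / 2 := by rw [div_le_div_iff₀ hn0 two_pos]; linarith
  calc n ^ d * prof a (d / 2) σ ≤ n ^ d * (n * (n - A)) ^ (-((d : ℝ) / 2)) := by gcongr
    _ = (n ^ 2 / (n * (n - A))) ^ ((d : ℝ) / 2) := by
        rw [Real.div_rpow (by positivity) (by linarith), h2, Real.rpow_neg (by linarith),
          ← div_eq_mul_inv]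
    _ ≤ (Real.exp (2 * A / n)) ^ ((d : ℝ) / 2) :=
        Real.rpow_le_rpow (div_nonneg (by positivity) (by linarith)) h3 (by positivity)
    _ = Real.exp (A * d / n) := by rw [← Real.exp_mul]; congr 1; ring
    _ ≤ 1 + 2 * (A * d / n) := by
        have e2 := (abs_le.1 (Real.abs_exp_sub_one_sub_id_le (x := A * d / n)
          (by rw [abs_of_nonneg hu0]; linarith))).2
        nlinarith
    _ = _ := by ring

/-- The total mass of the Laplacian of the potential. -/
lemma mass_pot_le (hd : 0 < d) {a : ℝ} (ha : 0 ≤ a) {n : ℕ} (hn : 2 * (a + 2) * d ≤ n) :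
    -∑ x ∈ ballF d n, lap (fun x => pot a (d / 2) (sqn x)) x
      ≤ 2 * d * ((ballF d n).card / (n : ℝ) ^ d + 6 * (a + 2) * d *
        ((ballF d n).card / (n : ℝ) ^ d - (ballF d (n - 1)).card / (n : ℝ) ^ d)) := by
  classical
  have hd1 : (1 : ℝ) ≤ d := by exact_mod_cast hd
  set C := 2 * (a + 2) * d with hC
  have hC0 : 4 ≤ C := by nlinarith
  have hn0 : (0 : ℝ) < n := by linarith
  have hnd : (0 : ℝ) < (n : ℝ) ^ d := by positivity
  set Γ : (Fin d → ℤ) → ℝ := fun x => pot a (d / 2) (sqn x) with hΓ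
  have hsub : ballF d ((n : ℝ) - 1) ⊆ ballF d n := fun x hx => by
    rw [mem_ballF] at hx ⊢; linarith
  have hlayer : ∀ x ∈ ballF d n, ∀ y ∈ latNbrs x, y ∉ ballF d n →
      (n : ℝ) - 1 < eunorm x ∧ eunorm x ≤ n ∧ (n : ℝ) < eunorm y ∧ eunorm y ≤ eunorm x + 1 := by
    intro x hx y hy hyB
    rw [mem_ballF] at hx hyB
    have := eunorm_le_of_mem_latNbrs hy
    push Not at hyB
    exact ⟨by linarith, hx, hyB, this⟩
  have key := le_sum_lap (B := ballF d n) (L := ballF d n \ ballF d ((n : ℝ) - 1))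
    (w := fun x => (n : ℝ) ^ d * Γ x + sqn x) (C := 3 * C) (by linarith) Finset.sdiff_subset
    (fun x hx y hy hyB => by
      rw [Finset.mem_sdiff]
      refine ⟨hx, fun h => ?_⟩
      rw [mem_ballF] at h
      linarith [(hlayer x hx y hy hyB).1]) (fun x hx y hy hyB => by
      obtain ⟨h1, h2, h3, h4⟩ := hlayer x hx y hy hyB
      have hx0 := eunorm_nonneg x
      have hσ : (n - 1 : ℝ) ^ 2 ≤ sqn x := by rw [← eunorm_sq]; nlinarith
      have hσ' : sqn x ≤ sqn y := by rw [← eunorm_sq, ← eunorm_sq]; nlinarith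
      have hσ3 : sqn y - sqn x ≤ 3 * n := by rw [← eunorm_sq, ← eunorm_sq]; nlinarith
      have e1 := pot_sub_le (a := a) (p := (d : ℝ) / 2) (by positivity) hσ'
      have e2 := pow_mul_prof_le hd ha hn hσ
      have e3 : (n : ℝ) ^ d * (Γ x - Γ y) ≤ (n : ℝ) ^ d * prof a (d / 2) (sqn x) * (sqn y - sqn x) := by
        rw [mul_assoc]; exact mul_le_mul_of_nonneg_left e1 hnd.le
      have e4 : (n : ℝ) ^ d * prof a (d / 2) (sqn x) * (sqn y - sqn x)
          ≤ (1 + C / n) * (sqn y - sqn x) := mul_le_mul_of_nonneg_right e2 (by linarith)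
      have e5 : C / n * (sqn y - sqn x) ≤ C / n * (3 * n) :=
        mul_le_mul_of_nonneg_left hσ3 (by positivity)
      have e6 : C / n * (3 * n) = 3 * C := by field_simp
      linarith)
  have hlap : ∑ x ∈ ballF d n, lap (fun x => (n : ℝ) ^ d * Γ x + sqn x) x
      = (n : ℝ) ^ d * ∑ x ∈ ballF d n, lap Γ x + 2 * d * (ballF d n).card := by
    rw [Finset.sum_congr rfl fun x _ => by rw [lap_add, lap_const_mul, lap_sqn],
      Finset.sum_add_distrib, ← Finset.mul_sum, Finset.sum_const, nsmul_eq_mul]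
    ring
  have hcard : ((ballF d n \ ballF d ((n : ℝ) - 1)).card : ℝ)
      = (ballF d n).card - (ballF d ((n : ℝ) - 1)).card := by
    rw [Finset.card_sdiff_of_subset hsub, Nat.cast_sub (Finset.card_le_card hsub)]
  rw [hlap, hcard] at key
  rw [← sub_div, ← mul_div_assoc, ← add_div, ← mul_div_assoc, le_div_iff₀ hnd]
  linarith

lemma exists_mass_pot_le (hd : 0 < d) {a : ℝ} (ha : 0 ≤ a) {δ : ℝ} (hδ : 0 < δ) (R₀ : ℝ) :
    ∃ R, R₀ ≤ R ∧ -∑ x ∈ ballF d R, lap (fun x => pot a (d / 2) (sqn x)) x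
      ≤ 2 * d * unitBallVol d + δ := by
  have hd1 : (1 : ℝ) ≤ d := by exact_mod_cast hd
  have t1 : Tendsto (fun n : ℕ => ((ballF d n).card : ℝ) / (n : ℝ) ^ d) atTop
      (𝓝 (unitBallVol d)) := (tendsto_card_ballF d).comp tendsto_natCast_atTop_atTop
  have t0 : Tendsto (fun n : ℕ => (n : ℝ) - 1) atTop atTop :=
    tendsto_atTop_add_const_right _ _ tendsto_natCast_atTop_atTop
  have t2 : Tendsto (fun n : ℕ => ((ballF d ((n : ℝ) - 1)).card : ℝ) / (n : ℝ) ^ d) atTop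
      (𝓝 (unitBallVol d)) := by
    have e1 : Tendsto (fun n : ℕ => ((n : ℝ) - 1) / n) atTop (𝓝 1) := by
      have : Tendsto (fun n : ℕ => 1 - 1 / (n : ℝ)) atTop (𝓝 (1 - 0)) :=
        tendsto_const_nhds.sub tendsto_one_div_atTop_nhds_zero_nat
      rw [sub_zero] at this
      refine this.congr' ?_
      filter_upwards [eventually_gt_atTop 0] with n hn
      have : (n : ℝ) ≠ 0 := by positivity
      field_simp
    have e2 := ((tendsto_card_ballF d).comp t0).mul (e1.pow d)
    rw [one_pow, mul_one] at e2
    refine e2.congr' ?_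
    filter_upwards [eventually_gt_atTop 1] with n hn
    have h1 : (1 : ℝ) < n := by exact_mod_cast hn
    have h2 : ((n : ℝ) - 1) ^ d ≠ 0 := pow_ne_zero _ (by linarith)
    have h3 : (n : ℝ) ^ d ≠ 0 := pow_ne_zero _ (by linarith)
    simp only [Function.comp]
    rw [div_pow]; field_simp
  have t3 := (t1.add ((t1.sub t2).const_mul (6 * (a + 2) * d))).const_mul (2 * (d : ℝ))
  rw [sub_self, mul_zero, add_zero] at t3
  have hev := (t3.eventually_le_const (u := 2 * d * unitBallVol d + δ) (by linarith)).and
    ((tendsto_natCast_atTop_atTop (R := ℝ)).eventually_ge_atTop (max R₀ (2 * (a + 2) * d)))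
  obtain ⟨n, hn1, hn2⟩ := hev.exists
  exact ⟨n, (le_max_left _ _).trans hn2, (mass_pot_le hd ha ((le_max_right _ _).trans hn2)).trans hn1⟩

end Mass

/-! ### Exponentially small sequences -/

section ExpSmall

/-- A sequence which eventually decays exponentially. -/
def ExpSmall (a : ℕ → ENNReal) : Prop :=
  ∃ c : ℝ, 0 < c ∧ ∀ᶠ n : ℕ in atTop, a n ≤ ENNReal.ofReal (Real.exp (-(c * n)))

lemma ExpSmall.of_poly {a : ℕ → ENNReal} {C c : ℝ} (k : ℕ) (hc : 0 < c)
    (h : ∀ᶠ n : ℕ in atTop, a n ≤ ENNReal.ofReal (C * (n : ℝ) ^ k * Real.exp (-(c * n)))) :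
    ExpSmall a := by
  refine ⟨c / 2, by positivity, ?_⟩
  have t := (Real.tendsto_pow_mul_exp_neg_atTop_nhds_zero k).comp
    ((tendsto_natCast_atTop_atTop (R := ℝ)).const_mul_atTop (show 0 < c / 2 by positivity))
  have t2 := t.const_mul (C / (c / 2) ^ k)
  rw [mul_zero] at t2
  filter_upwards [h, t2.eventually_le_const one_pos] with n h1 h2
  refine h1.trans (ENNReal.ofReal_le_ofReal ?_)
  simp only [Function.comp] at h2
  have e1 : Real.exp (-(c * n)) = Real.exp (-(c / 2 * n)) * Real.exp (-(c / 2 * n)) := by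
    rw [← Real.exp_add]; congr 1; ring
  have e2 : C / (c / 2) ^ k * ((c / 2 * n) ^ k * Real.exp (-(c / 2 * n)))
      = C * n ^ k * Real.exp (-(c / 2 * n)) := by
    rw [mul_pow]
    have : (c / 2) ^ k ≠ 0 := by positivity
    field_simp
  rw [e2] at h2
  rw [e1, ← mul_assoc]
  exact mul_le_of_le_one_left (Real.exp_nonneg _) h2

lemma ExpSmall.mono {a b : ℕ → ENNReal} (hb : ExpSmall b) (h : ∀ᶠ n in atTop, a n ≤ b n) :
    ExpSmall a := by
  obtain ⟨c, hc, hb⟩ := hb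
  exact ⟨c, hc, by filter_upwards [h, hb] with n h1 h2 using h1.trans h2⟩

lemma ExpSmall.zero : ExpSmall fun _ => 0 := ⟨1, one_pos, by simp⟩

lemma ExpSmall.add {a b : ℕ → ENNReal} (ha : ExpSmall a) (hb : ExpSmall b) :
    ExpSmall fun n => a n + b n := by
  obtain ⟨c₁, hc₁, ha⟩ := ha
  obtain ⟨c₂, hc₂, hb⟩ := hb
  refine ExpSmall.of_poly (C := 2) (c := min c₁ c₂) 0 (lt_min hc₁ hc₂) ?_
  filter_upwards [ha, hb] with n h1 h2
  have e1 : Real.exp (-(c₁ * n)) ≤ Real.exp (-(min c₁ c₂ * n)) :=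
    Real.exp_le_exp.2 (neg_le_neg (mul_le_mul_of_nonneg_right (min_le_left _ _) n.cast_nonneg))
  have e2 : Real.exp (-(c₂ * n)) ≤ Real.exp (-(min c₁ c₂ * n)) :=
    Real.exp_le_exp.2 (neg_le_neg (mul_le_mul_of_nonneg_right (min_le_right _ _) n.cast_nonneg))
  calc a n + b n ≤ ENNReal.ofReal (Real.exp (-(c₁ * n))) + ENNReal.ofReal (Real.exp (-(c₂ * n))) :=
        add_le_add h1 h2
    _ = ENNReal.ofReal (Real.exp (-(c₁ * n)) + Real.exp (-(c₂ * n))) :=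
        (ENNReal.ofReal_add (Real.exp_nonneg _) (Real.exp_nonneg _)).symm
    _ ≤ _ := ENNReal.ofReal_le_ofReal (by rw [pow_zero]; linarith)

lemma ExpSmall.sum {ι : Type*} (s : Finset ι) {a : ι → ℕ → ENNReal}
    (h : ∀ i ∈ s, ExpSmall (a i)) : ExpSmall fun n => ∑ i ∈ s, a i n := by
  classical
  induction s using Finset.induction_on with
  | empty => simpa using ExpSmall.zero
  | insert i s hi ih =>
    simp only [Finset.sum_insert hi]
    exact (h i (Finset.mem_insert_self _ _)).add (ih fun j hj => h j (Finset.mem_insert_of_mem hj))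

/-- A union bound over lattice balls. -/
lemma ExpSmall.of_ball {d : ℕ} {a : ℕ → ENNReal} {C c : ℝ} (K : ℝ) (hK : 0 < K) (hC : 0 ≤ C)
    (hc : 0 < c)
    (h : ∀ᶠ n : ℕ in atTop, a n ≤ ∑ _z ∈ ballF d (K * n), ENNReal.ofReal (C * Real.exp (-(c * n)))) :
    ExpSmall a := by
  refine ExpSmall.of_poly (C := (unitBallVol d + 1) * K ^ d * C) (c := c) d hc ?_
  have t := (tendsto_card_ballF d).comp
    ((tendsto_natCast_atTop_atTop (R := ℝ)).const_mul_atTop hK)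
  filter_upwards [h, t.eventually_le_const (lt_add_one (unitBallVol d)), eventually_gt_atTop 0]
    with n h1 h2 hn
  have hn' : (0 : ℝ) < n := by exact_mod_cast hn
  simp only [Function.comp] at h2
  rw [div_le_iff₀ (by positivity), mul_pow] at h2
  refine h1.trans ?_
  rw [Finset.sum_const, nsmul_eq_mul, ← ENNReal.ofReal_natCast,
    ← ENNReal.ofReal_mul (Nat.cast_nonneg _)]
  refine ENNReal.ofReal_le_ofReal ?_
  have := mul_le_mul_of_nonneg_right h2 (mul_nonneg hC (Real.exp_nonneg (-(c * n))))
  linarith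

lemma ExpSmall.ae_eventually {Ω : Type*} [MeasurableSpace Ω] {P : Measure Ω} {s : ℕ → Set Ω}
    (h : ExpSmall fun n => P (s n)) : ∀ᵐ ω ∂P, ∀ᶠ n in atTop, ω ∉ s n := by
  obtain ⟨c, hc, h⟩ := h
  obtain ⟨n₀, hn₀⟩ := eventually_atTop.1 h
  set t : ℕ → Set Ω := fun n => if n₀ ≤ n then s n else ∅ with ht
  have h1 : ∀ n, P (t n) ≤ ENNReal.ofReal (Real.exp (-(c * n))) := by
    intro n
    simp only [ht]
    split_ifs with hn
    · exact hn₀ n hn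
    · simp
  have hs : Summable fun n : ℕ => Real.exp (-(c * n)) := by
    have := Real.summable_pow_mul_exp_neg_nat_mul 0 hc
    simpa using this
  have h2 : ∑' n, P (t n) ≠ ⊤ :=
    ne_top_of_le_ne_top (hs.tsum_ofReal_ne_top) (ENNReal.tsum_le_tsum h1)
  filter_upwards [ae_eventually_notMem h2] with ω hω
  filter_upwards [hω, eventually_ge_atTop n₀] with n hn1 hn2
  simpa only [ht, if_pos hn2] using hn1

end ExpSmall

/-! ### The inner bound -/

section Inner

variable {d : ℕ} {Ω : Type*} [MeasurableSpace Ω] {P : Measure Ω}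
  {I : ℕ → Ω → Finset (Fin d → ℤ)} {Y : ℕ → Ω → (Fin d → ℤ)}

/-- The number of particles. -/
noncomputable def numP (d n : ℕ) : ℕ := ⌊unitBallVol d * (n : ℝ) ^ d⌋₊

lemma numP_le (d n : ℕ) : (numP d n : ℝ) ≤ unitBallVol d * (n : ℝ) ^ d :=
  Nat.floor_le (mul_nonneg unitBallVol_pos.le (by positivity))

lemma lt_numP (d n : ℕ) : unitBallVol d * (n : ℝ) ^ d - 1 < numP d n := by
  rw [numP]
  linarith [Nat.lt_floor_add_one (unitBallVol d * (n : ℝ) ^ d)]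

lemma l1_neg (x : Fin d → ℤ) : l1 (-x) = l1 x := by simp [l1]

/-- A fixed site is occupied after time `N` up to an exponentially small probability. -/
lemma IsGrowth.measure_notMem_fixed [IsProbabilityMeasure P] (h : IsGrowth P I Y) (hd : 0 < d)
    (z : Fin d → ℤ) : ExpSmall fun n => P {ω | z ∉ I (numP d n) ω} := by
  classical
  have hd1 : (1 : ℝ) ≤ d := by exact_mod_cast hd
  set g : (Fin d → ℤ) → ℝ := fun x => if l1 (x - z) ≤ l1 z then ((2 * (d : ℝ)) ^ l1 (x - z))⁻¹ else 0
    with hg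
  have g0 : ∀ x, 0 ≤ g x := fun x => by simp only [hg]; split_ifs <;> positivity
  have g1 : ∀ x, g x ≤ 1 := fun x => by
    simp only [hg]; split_ifs
    · exact inv_le_one_of_one_le₀ (one_le_pow₀ (by linarith))
    · norm_num
  have gz : 0 < g 0 := by
    simp only [hg, zero_sub, l1_neg, le_refl, if_true]; positivity
  have gl : ∀ x, x ≠ z → 0 ≤ lap g x := by
    intro x hx
    by_cases hgx : l1 (x - z) ≤ l1 z
    swap
    · exact lap_nonneg_of_eq_zero g0 (by simp only [hg, if_neg hgx])
    obtain ⟨y, hy, hl⟩ := exists_closer (sub_ne_zero.2 hx)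
    have hy' : y + z ∈ latNbrs x := by
      rw [mem_latNbrs] at hy ⊢
      obtain ⟨i, hi⟩ := hy
      refine ⟨i, ?_⟩
      rcases hi with hi | hi
      · right
        rw [sub_eq_iff_eq_add] at hi; rw [hi]; abel
      · left
        rw [sub_eq_iff_eq_add] at hi; rw [hi]; abel
    have e1 : g (y + z) = 2 * d * g x := by
      simp only [hg, add_sub_cancel_right, if_pos hgx, if_pos (show l1 y ≤ l1 z by omega)]
      rw [hl, pow_succ]
      have : (2 * (d : ℝ)) ≠ 0 := by positivity
      field_simp
    rw [lap_eq_sum_latNbrs, ← e1]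
    exact sub_nonneg.2 (Finset.single_le_sum (fun y _ => g0 y) hy')
  have gS : ∀ A : Finset (Fin d → ℤ), z ∉ A → ∑ x ∈ A, g x ≤ (ballF d (2 * l1 z)).card := by
    intro A _
    calc ∑ x ∈ A, g x ≤ ∑ x ∈ A, if x ∈ ballF d (2 * l1 z) then (1 : ℝ) else 0 := by
          refine Finset.sum_le_sum fun x _ => ?_
          split_ifs with hx
          · exact g1 x
          · simp only [hg]
            rw [if_neg]
            intro hl
            refine hx (mem_ballF.2 ?_)
            have e1 := eunorm_add_le (x - z) z
            rw [sub_add_cancel] at e1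
            have e2 := eunorm_le_l1 (x - z)
            have e3 := eunorm_le_l1 z
            have e4 : ((l1 (x - z) : ℕ) : ℝ) ≤ l1 z := by exact_mod_cast hl
            linarith
      _ ≤ _ := by
          rw [← Finset.sum_filter, Finset.sum_const, nsmul_eq_mul, mul_one]
          exact_mod_cast Finset.card_le_card fun x hx => (Finset.mem_filter.1 hx).2
  set S : ℝ := ((ballF d (2 * l1 z)).card : ℝ)
  set ω := unitBallVol d
  have hω : 0 < ω := unitBallVol_pos
  have hb := fun N => h.measure_notMem_le hd N (c := 1 / 2) (M := 1) (by norm_num) (by norm_num)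
    g0 g1 gl gS
  refine ExpSmall.of_poly (C := Real.exp (1 / 2 * S + 1 / 4 * g 0)) (c := 1 / 4 * g 0 * ω) 0
    (by positivity) ?_
  filter_upwards [eventually_ge_atTop 1] with n hn
  refine (hb _).trans (ENNReal.ofReal_le_ofReal ?_)
  rw [pow_zero, mul_one (Real.exp _), ← Real.exp_add, Real.exp_le_exp]
  have e1 := lt_numP d n
  have hn1 : (1 : ℝ) ≤ n := by exact_mod_cast hn
  have e2 : (n : ℝ) ≤ (n : ℝ) ^ d := le_self_pow₀ hn1 hd.ne'
  have e3 : ω * n - 1 ≤ numP d n := by nlinarith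
  nlinarith [mul_le_mul_of_nonneg_left e3 gz.le]

end Inner

section InnerMain

variable {d : ℕ} {Ω : Type*} [MeasurableSpace Ω] {P : Measure Ω}
  {I : ℕ → Ω → Finset (Fin d → ℤ)} {Y : ℕ → Ω → (Fin d → ℤ)}

set_option maxHeartbeats 800000 in
/-- A nonnegative function which is subharmonic off `z` and whose total sum is smaller than
its mean-value bound. -/
lemma exists_test_function (hd : 0 < d) {ε : ℝ} (hε : 0 < ε) (hε2 : ε ≤ 1 / 2) :
    ∃ ρ c : ℝ, 0 < c ∧ ∀ᶠ n : ℕ in atTop, ∀ z : Fin d → ℤ, ρ ≤ eunorm z →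
      eunorm z ≤ n * (1 - ε) → ∃ (g : (Fin d → ℤ) → ℝ) (T : ℝ), (∀ x, 0 ≤ g x) ∧ (∀ x, g x ≤ n) ∧
        (∀ x, x ≠ z → 0 ≤ lap g x) ∧ (∀ A : Finset (Fin d → ℤ), ∑ x ∈ A, g x ≤ T) ∧
        T ≤ (1 - ε / 16) * (unitBallVol d * (n : ℝ) ^ d * g 0) ∧
        c * n ^ 2 ≤ (n : ℝ) ^ d * g 0 := by
  have hd1 : (1 : ℝ) ≤ d := by exact_mod_cast hd
  set ω := unitBallVol d with hωdef
  have hω : 0 < ω := unitBallVol_pos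
  set a : ℝ := d + 3 with ha
  set β : ℝ := ε / 4 with hβ
  have hβ0 : 0 < β := by positivity
  set Γ : (Fin d → ℤ) → ℝ := fun x => pot a (d / 2) (sqn x) with hΓ
  set δ' : ℝ := d * ω * β / 2 with hδ'
  have hδ'0 : 0 < δ' := by positivity
  obtain ⟨R, hR0, hR⟩ := exists_mass_pot_le hd (a := a) (by positivity) hδ'0 (4 * a)
  set V : ℝ := ∑ x ∈ ballF d R, |lap Γ x| with hV
  have hV0 : 0 ≤ V := Finset.sum_nonneg fun _ _ => abs_nonneg _
  obtain ⟨ρ₀, hρ₀, hρ⟩ := almost_constant (d := d) R (δ := δ' / (V + 1)) (by positivity)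
  refine ⟨max ρ₀ 1, ε ^ 2 / (4 * (2 * d * ω + 2 * δ')), by positivity, ?_⟩
  filter_upwards [(tendsto_natCast_atTop_atTop (R := ℝ)).eventually_ge_atTop
    (max (R + 1) (max (ρ₀ + 1) (2 / ε)))] with n hn z hz1 hz2
  have hnR : R + 1 ≤ n := (le_max_left _ _).trans hn
  have hnρ : ρ₀ + 1 ≤ n := (le_max_left _ _).trans ((le_max_right _ _).trans hn)
  have hnε : 2 / ε ≤ n := (le_max_right _ _).trans ((le_max_right _ _).trans hn)
  rw [div_le_iff₀ hε] at hnε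
  have hzρ : ρ₀ ≤ eunorm z := (le_max_left _ _).trans hz1
  have hz1' : 1 ≤ eunorm z := (le_max_right _ _).trans hz1
  set D := ballF d ((n : ℝ) - 1) with hD
  have hzn : eunorm z ≤ (n : ℝ) - 1 := by linarith
  have hzD : z ∈ D := mem_ballF.2 hzn
  obtain ⟨g, hg⟩ := exists_green hd hzD
  have hn0 : (0 : ℝ) < n := by linarith
  have hnd : (0 : ℝ) < (n : ℝ) ^ d := by positivity
  have hgle : ∀ x, g x ≤ n := fun x => by
    have := hg.le hd (by linarith) hzn x
    linarith
  -- testing against the potential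
  set w : (Fin d → ℤ) → ℝ := fun x => (n : ℝ) ^ d * Γ x + (1 + β) * sqn x with hw
  have hwb : ∀ y ∈ bdryF latNbrs D, w y ≤ w z - ε ^ 2 / 4 * n ^ 2 := by
    intro y hy
    obtain ⟨⟨x, hx, hxy⟩, hyD⟩ := mem_bdryF.1 hy
    rw [hD, mem_ballF] at hx hyD
    push Not at hyD
    have hyn : eunorm y ≤ n := by linarith [eunorm_le_of_mem_latNbrs hxy]
    have e1 := pot_radial hd (a := a) (by positivity) hz1' (by linarith : eunorm z ≤ eunorm y) hyn
    rw [eunorm_sq, eunorm_sq] at e1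
    have e2 : (eunorm y - eunorm z) * (eunorm y + eunorm z) = sqn y - sqn z := by
      rw [← eunorm_sq, ← eunorm_sq]; ring
    have e3 : ε * n / 2 ≤ eunorm y - eunorm z := by linarith
    have e4 : ε * n / 2 ≤ 2 * n - (1 + β) * (eunorm y + eunorm z) := by
      have : (1 + β) * (eunorm y + eunorm z) ≤ (1 + β) * ((2 - ε) * n) :=
        mul_le_mul_of_nonneg_left (by linarith) (by linarith)
      have h5 : (1 + β) * (2 - ε) ≤ 2 - ε / 2 := by rw [hβ]; nlinarith
      have h6 := mul_le_mul_of_nonneg_right h5 hn0.le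
      linarith
    have e5 := mul_le_mul e3 e4 (by positivity) (by linarith [mul_pos hε hn0])
    simp only [hw, hΓ]
    nlinarith
  have key := hg.sum_mul_lap_le hzD hwb
  have hlap : ∑ x ∈ D, g x * lap w x
      = (n : ℝ) ^ d * ∑ x ∈ D, g x * lap Γ x + 2 * d * (1 + β) * ∑ x ∈ D, g x := by
    have : ∀ x ∈ D, g x * lap w x = (n : ℝ) ^ d * (g x * lap Γ x) + 2 * d * (1 + β) * g x := by
      intro x _
      rw [hw, lap_add, lap_const_mul, lap_const_mul, lap_sqn]; ring
    rw [Finset.sum_congr rfl this, Finset.sum_add_distrib, ← Finset.mul_sum, ← Finset.mul_sum]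
  rw [hlap] at key
  have hsub : ballF d R ⊆ D := fun x hx => by
    rw [hD, mem_ballF]; rw [mem_ballF] at hx; linarith
  have h1 : ∑ x ∈ ballF d R, g x * lap Γ x ≤ ∑ x ∈ D, g x * lap Γ x := by
    refine Finset.sum_le_sum_of_subset_of_nonneg hsub fun x _ hx => ?_
    rw [mem_ballF] at hx
    push Not at hx
    exact mul_nonneg (hg.nonneg x) (lap_pot_nonneg hd le_rfl (by linarith))
  have h2 : ∀ x ∈ ballF d R, g 0 * lap Γ x - δ' / (V + 1) * g 0 * |lap Γ x| ≤ g x * lap Γ x := by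
    intro x hx
    have := hρ g hg.nonneg (fun y hy => hg.harmonic y (by rw [hD, mem_ballF]; linarith)
      (fun h => by rw [h] at hy; linarith)) x (mem_ballF.1 hx)
    have e : |(g x - g 0) * lap Γ x| ≤ δ' / (V + 1) * g 0 * |lap Γ x| := by
      rw [abs_mul]; exact mul_le_mul_of_nonneg_right this (abs_nonneg _)
    have := (abs_le.1 e).1
    linarith
  have h3 : g 0 * ∑ x ∈ ballF d R, lap Γ x - δ' / (V + 1) * g 0 * V
      ≤ ∑ x ∈ ballF d R, g x * lap Γ x := by
    rw [hV, Finset.mul_sum, Finset.mul_sum, ← Finset.sum_sub_distrib]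
    exact Finset.sum_le_sum h2
  have hg0 := hg.nonneg 0
  have h4 : δ' / (V + 1) * g 0 * V ≤ δ' * g 0 := by
    have : V / (V + 1) ≤ 1 := by rw [div_le_one (by linarith)]; linarith
    calc δ' / (V + 1) * g 0 * V = δ' * g 0 * (V / (V + 1)) := by ring
      _ ≤ δ' * g 0 * 1 := mul_le_mul_of_nonneg_left this (by positivity)
      _ = _ := mul_one _
  have h5 : -(g 0 * (2 * d * ω + 2 * δ')) ≤ ∑ x ∈ D, g x * lap Γ x := by
    have := mul_le_mul_of_nonneg_left hR hg0
    linarith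
  have h6 := mul_le_mul_of_nonneg_left h5 hnd.le
  set T := ∑ x ∈ D, g x with hT
  have hT0 : 0 ≤ T := Finset.sum_nonneg fun x _ => hg.nonneg x
  refine ⟨g, T, hg.nonneg, hgle, fun x hx => hg.subharmonic hx, fun A => ?_, ?_, ?_⟩
  · calc ∑ x ∈ A, g x ≤ ∑ x ∈ A ∪ D, g x :=
          Finset.sum_le_sum_of_subset_of_nonneg Finset.subset_union_left fun x _ _ => hg.nonneg x
      _ = T := (Finset.sum_subset Finset.subset_union_right fun x _ hx => hg.off x hx).symm
  · have h7 : 2 * d * (1 + β) * T ≤ (n : ℝ) ^ d * (g 0 * (2 * d * ω + 2 * δ')) := by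
      have : 0 ≤ ε ^ 2 / 4 * (n : ℝ) ^ 2 := by positivity
      linarith
    have h8 : (n : ℝ) ^ d * (g 0 * (2 * d * ω + 2 * δ'))
        = 2 * d * ((1 + β / 2) * (ω * (n : ℝ) ^ d * g 0)) := by rw [hδ']; ring
    rw [h8, mul_assoc] at h7
    have h9 := le_of_mul_le_mul_left h7 (by positivity)
    have hX : 0 ≤ ω * (n : ℝ) ^ d * g 0 := by positivity
    have h10 : 1 + β / 2 ≤ (1 + β) * (1 - ε / 16) := by
      have e1 : (1 + β) * (1 - ε / 16) = 1 + β / 2 + β * (1 / 4 - β / 4) := by rw [hβ]; ring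
      have e2 : 0 ≤ β * (1 / 4 - β / 4) := mul_nonneg hβ0.le (by rw [hβ]; linarith)
      rw [e1]; linarith only [e2]
    have h11 := mul_le_mul_of_nonneg_right h10 hX
    refine le_of_mul_le_mul_left (a := 1 + β) ?_ (by linarith)
    linarith only [h9, h11]
  · rw [div_mul_eq_mul_div, div_le_iff₀ (by positivity)]
    have : 0 ≤ 2 * d * (1 + β) * T := by positivity
    linarith only [this, key, h6]

lemma IsGrowth.measure_notMem_far [IsProbabilityMeasure P] (h : IsGrowth P I Y) (hd : 0 < d)
    {ε : ℝ} (hε : 0 < ε) (hε2 : ε ≤ 1 / 2) :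
    ∃ ρ c : ℝ, 0 < c ∧ ∀ᶠ n : ℕ in atTop, ∀ z : Fin d → ℤ, ρ ≤ eunorm z →
      eunorm z ≤ n * (1 - ε) →
        P {ω | z ∉ I (numP d n) ω} ≤ ENNReal.ofReal (Real.exp (-(c * n))) := by
  obtain ⟨ρ, c, hc, H⟩ := exists_test_function hd hε hε2
  have hω : 0 < unitBallVol d := unitBallVol_pos
  refine ⟨ρ, ε ^ 2 / 2048 * unitBallVol d * c, by positivity, ?_⟩
  filter_upwards [H, (tendsto_natCast_atTop_atTop (R := ℝ)).eventually_ge_atTop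
    (max 1 (64 / (ε * unitBallVol d)))] with n hH hn z hz1 hz2
  obtain ⟨g, T, g0, gn, gl, gS, gT, gc⟩ := hH z hz1 hz2
  have hn1 : (1 : ℝ) ≤ n := (le_max_left _ _).trans hn
  have hn2 : 64 ≤ n * (ε * unitBallVol d) := by
    rw [← div_le_iff₀ (by positivity)]; exact (le_max_right _ _).trans hn
  have hn0 : (0 : ℝ) < n := by linarith
  set η := ε / 64 with hη
  have hη0 : 0 < η := by positivity
  have hη1 : η ≤ 1 := by rw [hη]; linarith
  refine (h.measure_notMem_le hd (numP d n) (c := η / n) (M := n) (by positivity)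
    (by rw [div_mul_cancel₀ _ hn0.ne']; linarith) g0 gn gl (fun A _ => gS A)).trans
    (ENNReal.ofReal_le_ofReal (Real.exp_le_exp.2 ?_))
  rw [div_mul_cancel₀ _ hn0.ne']
  set X := unitBallVol d * (n : ℝ) ^ d with hX
  have hnd : (n : ℝ) ≤ (n : ℝ) ^ d := le_self_pow₀ hn1 hd.ne'
  have hN : (1 - η) * X ≤ numP d n := by
    have e1 := lt_numP d n
    have e2 : 1 ≤ η * X := by
      have : n * unitBallVol d ≤ X := by rw [hX]; nlinarith
      rw [hη]; nlinarith
    rw [← hX] at e1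
    nlinarith
  have hg0 := g0 0
  have hX0 : 0 ≤ X := by positivity
  have e3 : (1 - 2 * η) * (X * g 0) ≤ (1 - η) * g 0 * numP d n := by
    have h1 := mul_le_mul_of_nonneg_left hN (mul_nonneg (by linarith : 0 ≤ 1 - η) hg0)
    have h2 : (1 - 2 * η) * (X * g 0) ≤ (1 - η) * g 0 * ((1 - η) * X) := by
      have : 0 ≤ η ^ 2 * (X * g 0) := by positivity
      nlinarith
    linarith
  have e4 : T - (1 - η) * g 0 * numP d n ≤ -(2 * η * (X * g 0)) := by
    have : (1 - ε / 16) = 1 - 4 * η := by rw [hη]; ring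
    rw [this] at gT
    nlinarith
  have e5 : unitBallVol d * (c * n ^ 2) ≤ X * g 0 := by
    rw [hX, mul_assoc]; exact mul_le_mul_of_nonneg_left gc hω.le
  calc η / n * T - η / n * (1 - η) * g 0 * numP d n
      = η / n * (T - (1 - η) * g 0 * numP d n) := by ring
    _ ≤ η / n * (-(2 * η * (unitBallVol d * (c * n ^ 2)))) := by
        refine mul_le_mul_of_nonneg_left (e4.trans ?_) (by positivity)
        have := mul_le_mul_of_nonneg_left e5 (by positivity : 0 ≤ 2 * η)
        linarith
    _ = _ := by rw [hη]; field_simp; ring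

/-- The inner bound, with an exponentially small error probability. -/
lemma IsGrowth.inner_bound [IsProbabilityMeasure P] (h : IsGrowth P I Y) (hd : 0 < d)
    {ε : ℝ} (hε : 0 < ε) (hε2 : ε ≤ 1 / 2) :
    ExpSmall fun n => P {ω | ¬ ballF d (n * (1 - ε)) ⊆ I (numP d n) ω} := by
  obtain ⟨ρ, c, hc, H⟩ := h.measure_notMem_far hd hε hε2
  have h1 : ExpSmall fun n => ∑ z ∈ ballF d ρ, P {ω | z ∉ I (numP d n) ω} :=
    ExpSmall.sum _ fun z _ => h.measure_notMem_fixed hd z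
  have h2 : ExpSmall fun n : ℕ => ∑ _z ∈ ballF d (1 * n),
      ENNReal.ofReal (1 * Real.exp (-(c * n))) :=
    ExpSmall.of_ball 1 one_pos zero_le_one hc (Eventually.of_forall fun _ => le_rfl)
  refine (h1.add h2).mono ?_
  filter_upwards [H] with n hn
  have hsub : {ω | ¬ ballF d (n * (1 - ε)) ⊆ I (numP d n) ω}
      ⊆ (⋃ z ∈ ballF d ρ, {ω | z ∉ I (numP d n) ω}) ∪
        ⋃ z ∈ (ballF d (1 * n)).filter (fun z => ρ ≤ eunorm z ∧ eunorm z ≤ n * (1 - ε)),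
          {ω | z ∉ I (numP d n) ω} := by
    intro ω hω
    obtain ⟨z, hz, hzI⟩ := Finset.not_subset.1 hω
    rw [mem_ballF] at hz
    rcases le_total (eunorm z) ρ with hzρ | hzρ
    · exact Or.inl (Set.mem_biUnion (mem_ballF.2 hzρ) hzI)
    · refine Or.inr (Set.mem_biUnion (x := z) ?_ hzI)
      rw [Finset.mem_coe, Finset.mem_filter, mem_ballF]
      have : 0 ≤ (n : ℝ) * ε := by positivity
      exact ⟨by linarith, hzρ, hz⟩
  refine (measure_mono hsub).trans ((measure_union_le _ _).trans (add_le_add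
    (measure_biUnion_finset_le _ _) ((measure_biUnion_finset_le _ _).trans ?_)))
  refine (Finset.sum_le_sum fun z hz => ?_).trans
    (Finset.sum_le_sum_of_subset (Finset.filter_subset _ _))
  rw [Finset.mem_filter] at hz
  rw [one_mul]
  exact hn z hz.2.1 hz.2.2

end InnerMain

/-! ### A half-space barrier -/

section Barrier

lemma abs_le_of_deriv_le {F F' : ℝ → ℝ} {C r : ℝ} {k : ℕ} (hC : 0 ≤ C) (h0 : F 0 = 0)
    (hF : ∀ x, |x| ≤ r → HasDerivAt F (F' x) x) (hF' : ∀ x, |x| ≤ r → |F' x| ≤ C * |x| ^ k)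
    {x : ℝ} (hx : |x| ≤ r) : |F x| ≤ C * |x| ^ (k + 1) := by
  have hin : ∀ y ∈ Set.Icc (-|x|) |x|, |y| ≤ |x| := fun y hy => abs_le.2 hy
  have := (convex_Icc (-|x|) |x|).norm_image_sub_le_of_norm_hasDerivWithin_le (f := F) (f' := F')
    (C := C * |x| ^ k) (x := 0) (y := x)
    (fun y hy => (hF y ((hin y hy).trans hx)).hasDerivWithinAt)
    (fun y hy => (hF' y ((hin y hy).trans hx)).trans
      (mul_le_mul_of_nonneg_left (pow_le_pow_left₀ (abs_nonneg y) (hin y hy) k) hC))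
    ⟨by simp, abs_nonneg x⟩ (abs_le.1 le_rfl)
  rw [h0, sub_zero, sub_zero, Real.norm_eq_abs, Real.norm_eq_abs] at this
  rw [pow_succ, ← mul_assoc]; exact this

/-- A second order Taylor bound for `(1 + e) ^ (-p)`. -/
lemma rpow_taylor {p : ℝ} (hp : 0 < p) : ∃ C, 0 ≤ C ∧ ∀ e : ℝ, |e| ≤ 1 / 2 →
    |(1 + e) ^ (-p) - (1 - p * e + p * (p + 1) / 2 * e ^ 2)| ≤ C * |e| ^ 3 := by
  set C : ℝ := p * (p + 1) * (p + 2) * (1 / 2) ^ (-p - 3) with hC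
  have hC0 : 0 ≤ C := by positivity
  refine ⟨C, hC0, fun e he => ?_⟩
  have pos : ∀ x : ℝ, |x| ≤ 1 / 2 → 1 / 2 ≤ 1 + x := fun x hx => by linarith [(abs_le.1 hx).1]
  have base : ∀ (m x : ℝ), |x| ≤ 1 / 2 → HasDerivAt (fun x : ℝ => (1 + x) ^ m)
      (m * (1 + x) ^ (m - 1)) x := by
    intro m x hx
    have := ((hasDerivAt_id x).const_add 1).rpow_const (p := m)
      (Or.inl (by have := pos x hx; simp only [id]; linarith))
    refine this.congr_deriv ?_
    simp only [id]; ring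
  have d3 : ∀ x : ℝ, |x| ≤ 1 / 2 → |-(p * (p + 1) * (p + 2)) * (1 + x) ^ (-p - 3)|
      ≤ C * |x| ^ 0 := by
    intro x hx
    have h1 := pos x hx
    rw [abs_mul, abs_neg, abs_of_nonneg (by positivity : 0 ≤ p * (p + 1) * (p + 2)),
      abs_of_nonneg (Real.rpow_nonneg (by linarith) _), pow_zero, mul_one, hC]
    refine mul_le_mul_of_nonneg_left ?_ (by positivity)
    exact Real.rpow_le_rpow_of_nonpos (by norm_num) h1 (by linarith)
  have d2 : ∀ x : ℝ, |x| ≤ 1 / 2 → |p * (p + 1) * (1 + x) ^ (-p - 2) - p * (p + 1)|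
      ≤ C * |x| ^ 1 := by
    intro x hx
    refine abs_le_of_deriv_le (r := 1 / 2)
      (F := fun x => p * (p + 1) * (1 + x) ^ (-p - 2) - p * (p + 1)) hC0 (by simp)
      (fun y hy => ?_) d3 hx
    refine (((base (-p - 2) y hy).const_mul (p * (p + 1))).sub_const _).congr_deriv ?_
    rw [show -p - 2 - 1 = -p - 3 by ring]; ring
  have d1 : ∀ x : ℝ, |x| ≤ 1 / 2 → |-p * (1 + x) ^ (-p - 1) + p - p * (p + 1) * x|
      ≤ C * |x| ^ 2 := by
    intro x hx
    refine abs_le_of_deriv_le (r := 1 / 2)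
      (F := fun x => -p * (1 + x) ^ (-p - 1) + p - p * (p + 1) * x) hC0 (by simp)
      (fun y hy => ?_) (fun y hy => ?_) hx (F' := fun x => p * (p + 1) * (1 + x) ^ (-p - 2) - p * (p + 1))
    · refine ((((base (-p - 1) y hy).const_mul (-p)).add_const p).sub
        ((hasDerivAt_id y).const_mul (p * (p + 1)))).congr_deriv ?_
      rw [show -p - 1 - 1 = -p - 2 by ring]; ring
    · exact d2 y hy
  refine abs_le_of_deriv_le (r := 1 / 2)
    (F := fun e => (1 + e) ^ (-p) - (1 - p * e + p * (p + 1) / 2 * e ^ 2)) hC0 (by simp)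
    (fun y hy => ?_) (F' := fun x => -p * (1 + x) ^ (-p - 1) + p - p * (p + 1) * x) d1 he
  refine ((base (-p) y hy).sub ((((hasDerivAt_id y).const_mul p).const_sub 1).add
    ((hasDerivAt_pow 2 y).const_mul (p * (p + 1) / 2)))).congr_deriv ?_
  push_cast; ring

/-- The contribution of a coordinate direction to the Laplacian of `t q ^ (-p)`. -/
lemma abs_coord_diff_le {p C : ℝ}
    (hT : ∀ e : ℝ, |e| ≤ 1 / 2 →
      |(1 + e) ^ (-p) - (1 - p * e + p * (p + 1) / 2 * e ^ 2)| ≤ C * |e| ^ 3) (hC : 0 ≤ C)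
    {s h t w : ℝ} (hs : 6 ≤ s) (hh : |h| ≤ 2 * s) (ht : 0 ≤ t) (hw : |w| ≤ 1) :
    |(t - w) * (s ^ 2 + 1 - h) ^ (-p) + (t + w) * (s ^ 2 + 1 + h) ^ (-p) - 2 * (t * (s ^ 2) ^ (-p))
      - (s ^ 2) ^ (-p) * (t * (-2 * p / s ^ 2 + p * (p + 1) * (1 + h ^ 2) / s ^ 4)
        + (-2 * p / s ^ 2 + 2 * p * (p + 1) / s ^ 4) * (w * h))|
      ≤ 54 * C * (t + 1) * (s ^ 2) ^ (-p) / s ^ 3 := by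
  have hs0 : 0 < s := by linarith
  have hs2 : (0 : ℝ) < s ^ 2 := by positivity
  have E : ∀ k : ℝ, |k| ≤ 2 * s → ∃ r : ℝ, |r| ≤ 27 * C / s ^ 3 ∧
      (s ^ 2 + 1 + k) ^ (-p) = (s ^ 2) ^ (-p) *
        (1 - p * ((1 + k) / s ^ 2) + p * (p + 1) / 2 * ((1 + k) / s ^ 2) ^ 2 + r) := by
    intro k hk
    set e := (1 + k) / s ^ 2 with he
    have he3 : |e| ≤ 3 / s := by
      rw [he, abs_div, abs_of_pos hs2, div_le_div_iff₀ hs2 hs0]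
      have : |1 + k| ≤ 1 + 2 * s := (abs_add_le _ _).trans (by rw [abs_one]; linarith)
      nlinarith
    have he2 : |e| ≤ 1 / 2 := he3.trans (by rw [div_le_div_iff₀ hs0 two_pos]; linarith)
    refine ⟨(1 + e) ^ (-p) - (1 - p * e + p * (p + 1) / 2 * e ^ 2), (hT e he2).trans ?_, ?_⟩
    · calc C * |e| ^ 3 ≤ C * (3 / s) ^ 3 := by gcongr
        _ = _ := by rw [div_pow]; ring
    · rw [add_sub_cancel, ← Real.mul_rpow hs2.le (by linarith [(abs_le.1 he2).1])]
      congr 1; rw [he]; field_simp; ring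
  obtain ⟨r₁, hr₁, e₁⟩ := E h hh
  obtain ⟨r₂, hr₂, e₂⟩ := E (-h) (by rwa [abs_neg])
  rw [sub_eq_add_neg (s ^ 2 + 1) h, e₁, e₂]
  have hw' := abs_le.1 hw
  have hQ : 0 ≤ (s ^ 2) ^ (-p) := Real.rpow_nonneg hs2.le _
  have key : |(t - w) * r₂ + (t + w) * r₁| ≤ 54 * C * (t + 1) / s ^ 3 := by
    have a1 : |t - w| ≤ t + 1 := by rw [abs_le]; constructor <;> linarith
    have a2 : |t + w| ≤ t + 1 := by rw [abs_le]; constructor <;> linarith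
    calc |(t - w) * r₂ + (t + w) * r₁| ≤ |t - w| * |r₂| + |t + w| * |r₁| := by
          rw [← abs_mul, ← abs_mul]; exact abs_add_le _ _
      _ ≤ (t + 1) * (27 * C / s ^ 3) + (t + 1) * (27 * C / s ^ 3) := by gcongr
      _ = _ := by ring
  generalize (s ^ 2) ^ (-p) = Q at *
  calc _ = |Q * ((t - w) * r₂ + (t + w) * r₁)| := by
        congr 1; field_simp; ring
    _ ≤ Q * (54 * C * (t + 1) / s ^ 3) := by
        rw [abs_mul, abs_of_nonneg hQ]; exact mul_le_mul_of_nonneg_left key hQ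
    _ = _ := by ring

variable {d : ℕ}

/-- The height of `x` below the point `c` in the direction `v`. -/
noncomputable def ht (v c : Fin d → ℝ) (x : Fin d → ℤ) : ℝ := ∑ i, v i * (c i - x i)

/-- The squared distance from `x` to the point `c`. -/
noncomputable def sqd (c : Fin d → ℝ) (x : Fin d → ℤ) : ℝ := ∑ i, (c i - x i) ^ 2

lemma sqd_nonneg (c : Fin d → ℝ) (x : Fin d → ℤ) : 0 ≤ sqd c x :=
  Finset.sum_nonneg fun _ _ => sq_nonneg _

lemma ht_sq_le {v : Fin d → ℝ} (hv : ∑ i, v i ^ 2 = 1) (c : Fin d → ℝ) (x : Fin d → ℤ) :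
    ht v c x ^ 2 ≤ sqd c x := by
  have := Finset.sum_mul_sq_le_sq_mul_sq Finset.univ v (fun i => c i - x i)
  rw [hv, one_mul] at this
  exact this

lemma ht_add_single (v c : Fin d → ℝ) (x : Fin d → ℤ) (i : Fin d) :
    ht v c (x + Pi.single i 1) = ht v c x - v i := by
  have : ht v c (x + Pi.single i 1) - ht v c x = - v i := by
    rw [ht, ht, ← Finset.sum_sub_distrib, Finset.sum_eq_single i]
    · simp; ring
    · intro j _ hj; simp [hj]
    · simp
  linarith

lemma sqd_add_single (c : Fin d → ℝ) (x : Fin d → ℤ) (i : Fin d) :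
    sqd c (x + Pi.single i 1) = sqd c x + 1 - 2 * (c i - x i) := by
  have : sqd c (x + Pi.single i 1) - sqd c x = 1 - 2 * (c i - x i) := by
    rw [sqd, sqd, ← Finset.sum_sub_distrib, Finset.sum_eq_single i]
    · simp; ring
    · intro j _ hj; simp [hj]
    · simp
  linarith

lemma ht_sub_single (v c : Fin d → ℝ) (x : Fin d → ℤ) (i : Fin d) :
    ht v c (x - Pi.single i 1) = ht v c x + v i := by
  have := ht_add_single v c (x - Pi.single i 1) i
  rw [sub_add_cancel] at this; linarith

lemma sqd_sub_single (c : Fin d → ℝ) (x : Fin d → ℤ) (i : Fin d) :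
    sqd c (x - Pi.single i 1) = sqd c x + 1 + 2 * (c i - x i) := by
  have := sqd_add_single c (x - Pi.single i 1) i
  simp only [sub_add_cancel, Pi.sub_apply, Pi.single_eq_same] at this
  push_cast at this; linarith

/-- The Laplacian of `t q ^ (-p)` to leading order. -/
lemma abs_lap_barrier_le (d : ℕ) {p : ℝ} (hp : 0 < p) : ∃ K, 0 ≤ K ∧
    ∀ v c : Fin d → ℝ, ∑ i, v i ^ 2 = 1 → ∀ x : Fin d → ℤ, 6 ≤ ht v c x →
      |lap (fun x => ht v c x * sqd c x ^ (-p)) x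
        - 4 * p * (p - d / 2) * ht v c x * sqd c x ^ (-p) / sqd c x|
        ≤ K * ht v c x * sqd c x ^ (-p) / (Real.sqrt (sqd c x)) ^ 3 := by
  obtain ⟨C, hC, hT⟩ := rpow_taylor hp
  refine ⟨108 * C * d + p * (p + 1) * (d + 4), by positivity, fun v c hv x hx => ?_⟩
  set t := ht v c x with ht'
  set s := Real.sqrt (sqd c x) with hs
  have hs2 : sqd c x = s ^ 2 := (Real.sq_sqrt (sqd_nonneg c x)).symm
  have hts : t ≤ s := by
    refine Real.le_sqrt_of_sq_le (ht_sq_le hv c x)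
  have hs6 : 6 ≤ s := hx.trans hts
  have hs0 : 0 < s := by linarith
  set Q := (s ^ 2) ^ (-p) with hQ
  have hQ0 : 0 ≤ Q := by positivity
  set h : Fin d → ℝ := fun i => 2 * (c i - x i) with hh
  have hsum : ∑ i, h i ^ 2 = 4 * s ^ 2 := by
    rw [← hs2, sqd, Finset.mul_sum]
    exact Finset.sum_congr rfl fun i _ => by rw [hh]; ring
  have hsum2 : ∑ i, v i * h i = 2 * t := by
    rw [ht', ht, Finset.mul_sum]
    exact Finset.sum_congr rfl fun i _ => by rw [hh]; ring
  have hhi : ∀ i, |h i| ≤ 2 * s := by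
    intro i
    refine abs_le_of_sq_le_sq ?_ (by positivity)
    calc h i ^ 2 ≤ ∑ i, h i ^ 2 :=
          Finset.single_le_sum (f := fun i => h i ^ 2) (fun _ _ => sq_nonneg _) (Finset.mem_univ i)
      _ = (2 * s) ^ 2 := by rw [hsum]; ring
  have hb := fun i => abs_coord_diff_le hT hC hs6 (hhi i) (by linarith : 0 ≤ t)
    (abs_le_one_of_unit hv i)
  have hS := (Finset.abs_sum_le_sum_abs _ Finset.univ).trans (Finset.sum_le_sum fun i _ => hb i)
  rw [Finset.sum_sub_distrib] at hS
  have hlap : lap (fun x => ht v c x * sqd c x ^ (-p)) x = ∑ i, ((t - v i) * (s ^ 2 + 1 - h i) ^ (-p)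
      + (t + v i) * (s ^ 2 + 1 + h i) ^ (-p) - 2 * (t * (s ^ 2) ^ (-p))) := by
    rw [lap]
    refine Finset.sum_congr rfl fun i _ => ?_
    rw [ht_add_single, ht_sub_single, sqd_add_single, sqd_sub_single, hs2]
  have hmain : ∑ i, (s ^ 2) ^ (-p) * (t * (-2 * p / s ^ 2 + p * (p + 1) * (1 + h i ^ 2) / s ^ 4)
        + (-2 * p / s ^ 2 + 2 * p * (p + 1) / s ^ 4) * (v i * h i))
      = 4 * p * (p - d / 2) * t * Q / s ^ 2 + p * (p + 1) * (d + 4) * t * Q / s ^ 4 := by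
    have e : ∀ i, (s ^ 2) ^ (-p) * (t * (-2 * p / s ^ 2 + p * (p + 1) * (1 + h i ^ 2) / s ^ 4)
        + (-2 * p / s ^ 2 + 2 * p * (p + 1) / s ^ 4) * (v i * h i))
        = Q * t * (-2 * p / s ^ 2 + p * (p + 1) / s ^ 4) + Q * t * (p * (p + 1) / s ^ 4) * h i ^ 2
          + Q * (-2 * p / s ^ 2 + 2 * p * (p + 1) / s ^ 4) * (v i * h i) := fun i => by
      rw [← hQ]; ring
    rw [Finset.sum_congr rfl fun i _ => e i, Finset.sum_add_distrib, Finset.sum_add_distrib,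
      Finset.sum_const, Finset.card_univ, Fintype.card_fin, nsmul_eq_mul,
      ← Finset.mul_sum, ← Finset.mul_sum, hsum, hsum2]
    field_simp; ring
  rw [← hlap, hmain, Finset.sum_const, Finset.card_univ, Fintype.card_fin, nsmul_eq_mul, ← hQ] at hS
  rw [hs2, ← hQ]
  have e1 : p * (p + 1) * (d + 4) * t * Q / s ^ 4 ≤ p * (p + 1) * (d + 4) * t * Q / s ^ 3 := by
    refine div_le_div_of_nonneg_left ?_ (by positivity) (pow_le_pow_right₀ (by linarith) (by norm_num))
    have : 0 ≤ t := by linarith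
    positivity
  have e1' : 0 ≤ p * (p + 1) * (d + 4) * t * Q / s ^ 4 := by
    have : 0 ≤ t := by linarith
    positivity
  have e2 : (d : ℝ) * (54 * C * (t + 1) * Q / s ^ 3) ≤ 108 * C * d * t * Q / s ^ 3 := by
    rw [← mul_div_assoc]
    refine div_le_div_of_nonneg_right ?_ (by positivity)
    have : 0 ≤ 54 * C * d * Q := by positivity
    nlinarith
  have e3 : (108 * C * d + p * (p + 1) * (d + 4)) * t * Q / s ^ 3
      = 108 * C * d * t * Q / s ^ 3 + p * (p + 1) * (d + 4) * t * Q / s ^ 3 := by ring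
  rw [e3]
  rw [abs_le] at hS ⊢
  constructor <;> linarith [hS.1, hS.2]

/-- A superharmonic function with the decay of the half-space Poisson kernel. -/
lemma exists_superharmonic (hd : 0 < d) : ∃ R : ℝ, 6 ≤ R ∧
    ∀ v c : Fin d → ℝ, ∑ i, v i ^ 2 = 1 → ∀ x : Fin d → ℤ, R ≤ ht v c x →
      lap (fun x => ht v c x * sqd c x ^ (-((d : ℝ) / 2))
        - ht v c x * sqd c x ^ (-((d : ℝ) / 2 + 1 / 4))) x ≤ 0 := by
  have hd0 : (0 : ℝ) < d := by exact_mod_cast hd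
  obtain ⟨K₁, hK₁, H₁⟩ := abs_lap_barrier_le d (p := (d : ℝ) / 2) (by positivity)
  obtain ⟨K₂, hK₂, H₂⟩ := abs_lap_barrier_le d (p := (d : ℝ) / 2 + 1 / 4) (by positivity)
  set p₂ : ℝ := (d : ℝ) / 2 + 1 / 4 with hp₂
  have hp₂0 : 0 < p₂ := by positivity
  refine ⟨max 6 (((K₁ + K₂) / p₂) ^ 2), le_max_left _ _, fun v c hv x hx => ?_⟩
  have h6 := (le_max_left _ _).trans hx
  have hK := (le_max_right _ _).trans hx
  have b₁ := (abs_le.1 (H₁ v c hv x h6)).2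
  have b₂ := (abs_le.1 (H₂ v c hv x h6)).1
  rw [lap_sub]
  set t := ht v c x
  set s := Real.sqrt (sqd c x) with hs
  have hs2 : sqd c x = s ^ 2 := (Real.sq_sqrt (sqd_nonneg c x)).symm
  have hts : t ≤ s := Real.le_sqrt_of_sq_le (ht_sq_le hv c x)
  have hs0 : 0 < s := by linarith
  set m := Real.sqrt s with hm
  have hm2 : s = m ^ 2 := (Real.sq_sqrt hs0.le).symm
  have hm0 : 0 < m := Real.sqrt_pos.2 hs0
  have hmK : (K₁ + K₂) / p₂ ≤ m := Real.le_sqrt_of_sq_le (hK.trans hts)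
  rw [div_le_iff₀ hp₂0] at hmK
  set A := (s ^ 2) ^ (-((d : ℝ) / 2)) with hA
  have hA0 : 0 < A := by positivity
  have hA2 : (s ^ 2) ^ (-p₂) = A / m := by
    rw [hp₂, neg_add, Real.rpow_add (by positivity), ← hA, div_eq_mul_inv]
    congr 1
    rw [hm2, ← pow_mul, ← Real.rpow_natCast, ← Real.rpow_mul hm0.le, ← Real.rpow_neg_one m]
    congr 1; norm_num
  rw [hs2, ← hA] at b₁
  rw [hs2, hA2] at b₂
  have hm1 : 1 ≤ m := by
    rw [hm]; exact Real.one_le_sqrt.2 (by linarith)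
  have ht0 : 0 < t := by linarith
  have c₁ : 4 * ((d : ℝ) / 2) * ((d : ℝ) / 2 - d / 2) * t * A / s ^ 2 = 0 := by simp
  have c₂ : 4 * p₂ * (p₂ - d / 2) * t * (A / m) / s ^ 2 = p₂ * m * (t * A / s ^ 3) := by
    rw [show p₂ - d / 2 = 1 / 4 by rw [hp₂]; ring, hm2]; field_simp
  have c₃ : K₂ * t * (A / m) / s ^ 3 ≤ K₂ * (t * A / s ^ 3) := by
    have : A / m ≤ A := div_le_self hA0.le hm1
    calc K₂ * t * (A / m) / s ^ 3 ≤ K₂ * t * A / s ^ 3 := by gcongr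
      _ = _ := by ring
  have c₄ : K₁ * t * A / s ^ 3 = K₁ * (t * A / s ^ 3) := by ring
  have c₅ : (K₁ + K₂) * (t * A / s ^ 3) ≤ p₂ * m * (t * A / s ^ 3) :=
    mul_le_mul_of_nonneg_right (by linarith) (by positivity)
  rw [c₁, c₄] at b₁
  rw [c₂] at b₂
  linarith

/-- A family of barriers for half-spaces. -/
lemma exists_barrier (hd : 0 < d) : ∃ b : ℝ, 0 < b ∧ ∀ v : Fin d → ℝ, ∑ i, v i ^ 2 = 1 →
    ∃ u : (Fin d → ℤ) → (Fin d → ℤ) → ℝ,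
      (∀ y x, dot v x < dot v y → lap (u y) x ≤ 0) ∧ (∀ y, 1 ≤ u y y) ∧
      (∀ y x, dot v x ≤ dot v y + 1 → 0 ≤ u y x) ∧
      ∀ D : ℝ, 0 < D → ∀ y x, D ≤ dot v y - dot v x → u y x ≤ b / D ^ (d - 1) := by
  obtain ⟨R, hR6, hR⟩ := exists_superharmonic hd
  set p₁ : ℝ := (d : ℝ) / 2 with hp₁
  set p₂ : ℝ := (d : ℝ) / 2 + 1 / 4 with hp₂
  set c₀ : ℝ := R * ((R ^ 2) ^ (-p₁) - (R ^ 2) ^ (-p₂)) with hc₀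
  have hR2 : 1 < R ^ 2 := by nlinarith
  have hc₀0 : 0 < c₀ := by
    refine mul_pos (by linarith) (sub_pos.2 ?_)
    exact Real.rpow_lt_rpow_of_exponent_lt hR2 (by rw [hp₁, hp₂]; linarith)
  refine ⟨c₀⁻¹, inv_pos.2 hc₀0, fun v hv => ?_⟩
  set c : (Fin d → ℤ) → Fin d → ℝ := fun y i => y i + R * v i with hc
  have hht : ∀ y x, ht v (c y) x = R + dot v y - dot v x := by
    intro y x
    rw [ht, dot, dot, add_sub_assoc, ← Finset.sum_sub_distrib, ← mul_one R, ← hv, Finset.mul_sum,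
      ← Finset.sum_add_distrib]
    exact Finset.sum_congr rfl fun i _ => by simp only [hc]; ring
  have hsq : ∀ y, sqd (c y) y = R ^ 2 := by
    intro y
    rw [sqd, ← mul_one (R ^ 2), ← hv, Finset.mul_sum]
    exact Finset.sum_congr rfl fun i _ => by simp only [hc]; ring
  refine ⟨fun y x => c₀⁻¹ * (ht v (c y) x * sqd (c y) x ^ (-p₁) - ht v (c y) x * sqd (c y) x ^ (-p₂)),
    fun y x hxy => ?_, fun y => ?_, fun y x hxy => ?_, fun D hD y x hxy => ?_⟩
  · rw [lap_const_mul]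
    exact mul_nonpos_of_nonneg_of_nonpos (inv_pos.2 hc₀0).le
      (hR v (c y) hv x (by rw [hht]; linarith))
  · show 1 ≤ c₀⁻¹ * (ht v (c y) y * sqd (c y) y ^ (-p₁) - ht v (c y) y * sqd (c y) y ^ (-p₂))
    rw [hht, hsq, add_sub_cancel_right, ← mul_sub, ← hc₀, inv_mul_cancel₀ hc₀0.ne']
  · have h1 : 1 ≤ ht v (c y) x := by rw [hht]; linarith
    have h2 := ht_sq_le hv (c y) x
    have h3 : 1 ≤ sqd (c y) x := by nlinarith
    refine mul_nonneg (inv_pos.2 hc₀0).le ?_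
    rw [← mul_sub]
    exact mul_nonneg (by linarith) (sub_nonneg.2
      (Real.rpow_le_rpow_of_exponent_le h3 (by rw [hp₁, hp₂]; linarith)))
  · have h1 : D ≤ ht v (c y) x := by rw [hht]; linarith
    set t := ht v (c y) x with ht'
    have ht0 : 0 < t := by linarith
    have h2 := ht_sq_le hv (c y) x
    have h3 : 0 ≤ t * sqd (c y) x ^ (-p₂) :=
      mul_nonneg ht0.le (Real.rpow_nonneg (sqd_nonneg _ _) _)
    have h4 : sqd (c y) x ^ (-p₁) ≤ (t ^ d)⁻¹ := by
      refine (Real.rpow_le_rpow_of_nonpos (by positivity) h2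
        (by rw [hp₁]; linarith [d.cast_nonneg (α := ℝ)])).trans (le_of_eq ?_)
      rw [← Real.rpow_natCast, ← Real.rpow_mul ht0.le, ← Real.rpow_natCast, ← Real.rpow_neg ht0.le]
      congr 1; rw [hp₁]; push_cast; ring
    have h5 : t * (t ^ d)⁻¹ = (t ^ (d - 1))⁻¹ := by
      obtain ⟨k, rfl⟩ : ∃ k, d = k + 1 := ⟨d - 1, by omega⟩
      rw [add_tsub_cancel_right, pow_succ]; field_simp
    have h6 : (t ^ (d - 1))⁻¹ ≤ (D ^ (d - 1))⁻¹ :=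
      inv_anti₀ (by positivity) (pow_le_pow_left₀ hD.le h1 _)
    rw [div_eq_mul_inv]
    refine mul_le_mul_of_nonneg_left ?_ (inv_pos.2 hc₀0).le
    have h7 := mul_le_mul_of_nonneg_left h4 ht0.le
    linarith

end Barrier

/-! ### The outer bound -/

section Outer

variable {d : ℕ} {Ω : Type*} [MeasurableSpace Ω] {P : Measure Ω}
  {I : ℕ → Ω → Finset (Fin d → ℤ)} {Y : ℕ → Ω → (Fin d → ℤ)}

lemma IsGrowth.subset_or (h : IsGrowth P I Y) {R : ℝ} (hR : 0 ≤ R) (N : ℕ) (ω : Ω) :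
    I N ω ⊆ ballF d R ∨ ∃ z ∈ I N ω, R < eunorm z ∧ eunorm z ≤ R + 1 := by
  induction N with
  | zero =>
    left
    rw [h.init, Finset.singleton_subset_iff, mem_ballF, eunorm_zero]
    exact hR
  | succ N ih =>
    rw [h.step]
    rcases ih with ih | ⟨z, hz, hz'⟩
    · by_cases hy : eunorm (Y (N + 1) ω) ≤ R
      · exact Or.inl (Finset.insert_subset (mem_ballF.2 hy) ih)
      · obtain ⟨⟨x, hx, hxy⟩, _⟩ := mem_bdryF.1 (h.bdry N ω)
        refine Or.inr ⟨_, Finset.mem_insert_self _ _, not_le.1 hy, ?_⟩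
        have := eunorm_le_of_mem_latNbrs hxy
        have := mem_ballF.1 (ih hx)
        linarith
    · exact Or.inr ⟨z, Finset.mem_insert_of_mem hz, hz'⟩

/-- To leave a ball, the cluster has to contain a point just outside of the ball. -/
lemma IsGrowth.expSmall_not_subset (h : IsGrowth P I Y) {E : ℕ → Set Ω} {ρ C c : ℝ} {k : ℕ}
    (hρ : 0 < ρ) (hC : 0 ≤ C) (hc : 0 < c)
    (H : ∀ᶠ n : ℕ in atTop, ∀ z : Fin d → ℤ, ρ * n < eunorm z →
      P {ω | z ∈ I (numP d n) ω ∧ ω ∈ E n}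
        ≤ ENNReal.ofReal (C * (n : ℝ) ^ k * Real.exp (-(c * n)))) :
    ExpSmall fun n => P {ω | ω ∈ E n ∧ ¬ I (numP d n) ω ⊆ ballF d (ρ * n)} := by
  refine ExpSmall.of_poly (C := (unitBallVol d + 1) * (ρ + 1) ^ d * C) (c := c) (d + k) hc ?_
  have t := (tendsto_card_ballF d).comp
    ((tendsto_natCast_atTop_atTop (R := ℝ)).const_mul_atTop (show 0 < ρ + 1 by linarith))
  filter_upwards [H, t.eventually_le_const (lt_add_one (unitBallVol d)), eventually_gt_atTop 0]
    with n h1 h2 hn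
  have hn1 : (1 : ℝ) ≤ n := by exact_mod_cast hn
  simp only [Function.comp] at h2
  rw [div_le_iff₀ (by positivity), mul_pow] at h2
  have hsub : {ω | ω ∈ E n ∧ ¬ I (numP d n) ω ⊆ ballF d (ρ * n)}
      ⊆ ⋃ z ∈ (ballF d ((ρ + 1) * n)).filter (fun z => ρ * n < eunorm z),
          {ω | z ∈ I (numP d n) ω ∧ ω ∈ E n} := by
    rintro ω ⟨hωE, hω⟩
    obtain ⟨z, hz, hz1, hz2⟩ := (h.subset_or (by positivity) _ ω).resolve_left hω
    refine Set.mem_biUnion (x := z) ?_ ⟨hz, hωE⟩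
    rw [Finset.mem_coe, Finset.mem_filter, mem_ballF]
    exact ⟨by linarith, hz1⟩
  refine (measure_mono hsub).trans ((measure_biUnion_finset_le _ _).trans
    ((Finset.sum_le_sum fun z hz => h1 z (Finset.mem_filter.1 hz).2).trans
    ((Finset.sum_le_sum_of_subset (Finset.filter_subset _ _)).trans ?_)))
  rw [Finset.sum_const, nsmul_eq_mul, ← ENNReal.ofReal_natCast,
    ← ENNReal.ofReal_mul (Nat.cast_nonneg _)]
  refine ENNReal.ofReal_le_ofReal ?_
  have := mul_le_mul_of_nonneg_right h2
    (show 0 ≤ C * (n : ℝ) ^ k * Real.exp (-(c * n)) by positivity)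
  rw [pow_add]
  linarith

/-- The tentacle estimate, with the barriers inserted. -/
lemma IsGrowth.measure_far_le [IsProbabilityMeasure P] (h : IsGrowth P I Y) (hd : 0 < d) :
    ∃ b : ℝ, 0 < b ∧ ∀ (φ : (Fin d → ℤ) → ℝ) (r D S : ℝ) (G : Set (Fin d → ℤ)) (N J : ℕ)
      (z : Fin d → ℤ), (∀ x, 0 ≤ φ x) → (∀ x, 0 ≤ lap φ x) → (∀ x, r < eunorm x → 1 ≤ φ x) →
      0 ≤ r → 0 < D → (∀ x ∈ G, ∀ y ∈ latNbrs x, 4 * (b / D ^ (d - 1)) * φ y ≤ 1 / 2) →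
      r + 1 + D + J ≤ eunorm z →
      P {ω | z ∈ I N ω ∧ ↑(I N ω) ⊆ G ∧ ∑ x ∈ I N ω, φ x ≤ S}
        ≤ ENNReal.ofReal ((2 * (b / D ^ (d - 1)))⁻¹
          * Real.exp (4 * (b / D ^ (d - 1)) * S - J * Real.log 2)) := by
  obtain ⟨b, hb, H⟩ := exists_barrier hd
  refine ⟨b, hb, fun φ r D S G N J z hφ0 hφ hφ1 hr hD hφG hz => ?_⟩
  have hz0 : z ≠ 0 := by
    rintro rfl
    rw [eunorm_zero] at hz
    have : (0 : ℝ) ≤ J := J.cast_nonneg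
    linarith
  obtain ⟨v, hv, hvz⟩ := exists_unit_dot hz0
  obtain ⟨u, hu1, hu2, hu3, hu4⟩ := H v hv
  have hκ : 0 < b / D ^ (d - 1) := by positivity
  refine h.measure_tentacle_le hd (v := v) hκ (k₀ := r + 1 + D) (by linarith) hφ0
    (fun x hx => hφ1 x ?_) G hφG (fun k hk A hA => ?_) N J (by rw [hvz]; exact hz) S
  · linarith [dot_le_eunorm hv x]
  · refine exitMean_half_le hd hv (n := r) hr (by linarith) hκ.le hu1 hu2 hu3
      (fun y x hy hx => hu4 D hD y x ?_) hφ0 hφ hφ1 hA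
    linarith [dot_le_eunorm hv x]

/-- A crude outer bound. -/
lemma IsGrowth.outer_crude [IsProbabilityMeasure P] (h : IsGrowth P I Y) (hd : 2 ≤ d) :
    ∃ C : ℝ, 1 ≤ C ∧ ExpSmall fun n => P {ω | ¬ I (numP d n) ω ⊆ ballF d (C * n)} := by
  obtain ⟨b, hb, H⟩ := h.measure_far_le (by omega)
  have hω : 0 < unitBallVol d := unitBallVol_pos
  set μ : ℝ := 2 * (4 * b * (unitBallVol d + 1) + 1) with hμ
  have hμ0 : 0 < μ := by positivity
  refine ⟨μ + 4, by linarith, ?_⟩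
  have key := h.expSmall_not_subset (E := fun _ => Set.univ) (ρ := μ + 4) (C := (2 * b)⁻¹)
    (c := 1) (k := d - 1) (by linarith) (by positivity) one_pos ?_
  · simpa using key
  filter_upwards [eventually_ge_atTop 1,
    (tendsto_natCast_atTop_atTop (R := ℝ)).eventually_ge_atTop (8 * b)] with n hn hnb z hz
  have hn1 : (1 : ℝ) ≤ n := by exact_mod_cast hn
  have hn0 : (0 : ℝ) < n := by linarith
  have hpow : (n : ℝ) ^ d = n ^ (d - 1) * n := by
    rw [← pow_succ]; congr 1; omega
  have hnd : (n : ℝ) ≤ (n : ℝ) ^ (d - 1) := le_self_pow₀ hn1 (by omega)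
  have hJ := Nat.ceil_lt_add_one (show 0 ≤ μ * n by positivity)
  have hJ' := Nat.le_ceil (μ * n)
  have hN := numP_le d n
  have key := H (fun _ => 1) 0 n ((unitBallVol d + 1) * n ^ d) Set.univ (numP d n) ⌈μ * n⌉₊ z
    (fun _ => zero_le_one) (fun x => (lap_const 1 x).ge) (fun _ _ => le_rfl) le_rfl hn0
    (fun x _ y _ => ?_) ?_
  · have e1 : P {ω | z ∈ I (numP d n) ω ∧ ω ∈ Set.univ} ≤ P {ω | z ∈ I (numP d n) ω ∧
        (↑(I (numP d n) ω) : Set (Fin d → ℤ)) ⊆ Set.univ ∧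
        ∑ x ∈ I (numP d n) ω, (1 : ℝ) ≤ (unitBallVol d + 1) * n ^ d} := by
      refine measure_mono fun ω hω => ⟨hω.1, Set.subset_univ _, ?_⟩
      rw [Finset.sum_const, h.card, nsmul_eq_mul, mul_one, Nat.cast_add, Nat.cast_one]
      have : (1 : ℝ) ≤ (n : ℝ) ^ d := one_le_pow₀ hn1
      linarith
    refine e1.trans (key.trans (ENNReal.ofReal_le_ofReal ?_))
    have e2 : (2 * (b / (n : ℝ) ^ (d - 1)))⁻¹ = (2 * b)⁻¹ * n ^ (d - 1) := by field_simp
    rw [e2]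
    refine mul_le_mul_of_nonneg_left (Real.exp_le_exp.2 ?_) (by positivity)
    have e3 : 4 * (b / (n : ℝ) ^ (d - 1)) * ((unitBallVol d + 1) * n ^ d)
        = 4 * b * (unitBallVol d + 1) * n := by
      rw [hpow]; field_simp
    have e4 : μ * n * (1 / 2) ≤ ⌈μ * n⌉₊ * Real.log 2 :=
      mul_le_mul hJ' (by linarith [Real.log_two_gt_d9]) (by norm_num) (Nat.cast_nonneg _)
    have e5 : μ * n * (1 / 2) = 4 * b * (unitBallVol d + 1) * n + n := by rw [hμ]; ring
    rw [e3]; linarith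
  · rw [mul_one, ← mul_div_assoc, div_le_iff₀ (by positivity)]
    linarith
  · linarith

/-- The truncated quadratic function is subharmonic. -/
lemma lap_trunc_nonneg {a Δ : ℝ} (hΔ : 0 < Δ) (x : Fin d → ℤ) :
    0 ≤ lap (fun x => max (sqn x - a) 0 / Δ) x := by
  rcases le_total (sqn x - a) 0 with hx | hx
  · refine lap_nonneg_of_eq_zero (fun y => by positivity) ?_
    rw [max_eq_right hx, zero_div]
  · have h1 : lap (fun x => Δ⁻¹ * (sqn x - a)) x ≤ lap (fun x => max (sqn x - a) 0 / Δ) x := by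
      have e : ∀ y : Fin d → ℤ, Δ⁻¹ * (sqn y - a) ≤ max (sqn y - a) 0 / Δ := fun y => by
        rw [div_eq_inv_mul]
        exact mul_le_mul_of_nonneg_left (le_max_left _ _) (inv_pos.2 hΔ).le
      have e' : max (sqn x - a) 0 / Δ = Δ⁻¹ * (sqn x - a) := by
        rw [max_eq_left hx, div_eq_inv_mul]
      rw [lap, lap]
      refine Finset.sum_le_sum fun i _ => ?_
      rw [e']
      linarith [e (x + Pi.single i 1), e (x - Pi.single i 1)]
    refine le_trans ?_ h1
    rw [lap_const_mul, lap_sub, lap_const, lap_sqn, sub_zero]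
    have := inv_pos.2 hΔ
    positivity

lemma eventually_le_card_ballF (d : ℕ) {δ η : ℝ} (hδ : 0 ≤ δ) (hδ1 : δ < 1) (hη : 0 < η) :
    ∀ᶠ n : ℕ in atTop,
      (unitBallVol d * (1 - d * δ) - η) * (n : ℝ) ^ d ≤ (ballF d (n * (1 - δ))).card := by
  have hω : 0 < unitBallVol d := unitBallVol_pos
  have h1 : 0 < 1 - δ := by linarith
  have h1d : (1 - δ) ^ d ≤ 1 := pow_le_one₀ h1.le (by linarith)
  have t := (tendsto_card_ballF d).comp
    ((tendsto_natCast_atTop_atTop (R := ℝ)).atTop_mul_const h1)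
  filter_upwards [t.eventually_const_le (sub_lt_self (unitBallVol d) hη), eventually_gt_atTop 0]
    with n h2 hn
  have hn' : (0 : ℝ) < n := by exact_mod_cast hn
  simp only [Function.comp] at h2
  rw [le_div_iff₀ (by positivity), mul_pow] at h2
  refine le_trans ?_ h2
  have hb : 1 - d * δ ≤ (1 - δ) ^ d := by
    have := one_add_mul_le_pow (a := -δ) (by linarith) d
    rw [← sub_eq_add_neg] at this
    linarith
  have h3 : unitBallVol d * (1 - d * δ) - η ≤ (unitBallVol d - η) * (1 - δ) ^ d := by
    nlinarith
  calc _ ≤ (unitBallVol d - η) * (1 - δ) ^ d * (n : ℝ) ^ d :=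
        mul_le_mul_of_nonneg_right h3 (by positivity)
    _ = _ := by ring

lemma eventually_card_ballF_le (d : ℕ) {η : ℝ} (hη : 0 < η) :
    ∀ᶠ n : ℕ in atTop, ((ballF d n).card : ℝ) ≤ (unitBallVol d + η) * (n : ℝ) ^ d := by
  have t := (tendsto_card_ballF d).comp (tendsto_natCast_atTop_atTop (R := ℝ))
  filter_upwards [t.eventually_le_const (lt_add_of_pos_right (unitBallVol d) hη),
    eventually_gt_atTop 0] with n h2 hn
  have hn' : (0 : ℝ) < n := by exact_mod_cast hn
  simp only [Function.comp] at h2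
  rwa [div_le_iff₀ (by positivity)] at h2

/-- The number of occupied sites outside a slightly smaller ball. -/
lemma IsGrowth.eventually_card_sdiff_le (h : IsGrowth P I Y) (hd : 0 < d) {δ η : ℝ}
    (hδ : 0 ≤ δ) (hδ1 : δ < 1) (hη : 0 < η) :
    ∀ᶠ n : ℕ in atTop, ∀ ω, ballF d (n * (1 - δ)) ⊆ I (numP d n) ω →
      (((I (numP d n) ω) \ ballF d (n * (1 - δ))).card : ℝ)
        ≤ (unitBallVol d * d * δ + η) * (n : ℝ) ^ d := by
  filter_upwards [eventually_le_card_ballF d hδ hδ1 (half_pos hη),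
    ((tendsto_pow_atTop (α := ℝ) hd.ne').comp
      (tendsto_natCast_atTop_atTop (R := ℝ))).eventually_ge_atTop (2 / η)] with n h1 h2 ω hω
  rw [Finset.card_sdiff_of_subset hω, h.card, Nat.cast_sub, Nat.cast_add, Nat.cast_one]
  · simp only [Function.comp] at h2
    rw [div_le_iff₀ hη] at h2
    have := numP_le d n
    linarith
  · rw [← h.card (numP d n) ω]; exact Finset.card_le_card hω

lemma sum_trunc_le {A : Finset (Fin d → ℤ)} {n δ ε C : ℝ} (hn : 0 < n) (hε : 0 < ε) (hε1 : ε ≤ 1)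
    (hδ : 0 ≤ δ) (hC : 0 ≤ C) (hA : A ⊆ ballF d (C * n)) :
    ∑ x ∈ A, max (sqn x - (n * (1 - ε)) ^ 2) 0 / (n ^ 2 - (n * (1 - ε)) ^ 2)
      ≤ (ballF d n \ ballF d (n * (1 - ε))).card
        + C ^ 2 / ε * (A \ ballF d (n * (1 - δ))).card := by
  have hr : 0 ≤ n * (1 - ε) := mul_nonneg hn.le (by linarith)
  have hΔ : ε * n ^ 2 ≤ n ^ 2 - (n * (1 - ε)) ^ 2 := by
    have : 0 ≤ n ^ 2 * (ε * (1 - ε)) := by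
      have : 0 ≤ 1 - ε := by linarith
      positivity
    linarith
  have hΔ0 : 0 < n ^ 2 - (n * (1 - ε)) ^ 2 := lt_of_lt_of_le (by positivity) hΔ
  have hC2 : 0 ≤ C ^ 2 / ε := by positivity
  calc _ ≤ ∑ x ∈ A, ((if x ∈ ballF d n \ ballF d (n * (1 - ε)) then (1 : ℝ) else 0)
        + C ^ 2 / ε * (if x ∉ ballF d (n * (1 - δ)) then (1 : ℝ) else 0)) := by
        refine Finset.sum_le_sum fun x hx => ?_
        by_cases h1 : x ∈ ballF d (n * (1 - ε))
        · rw [max_eq_right, zero_div]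
          · split_ifs <;> simp <;> positivity
          · rw [mem_ballF, eunorm_le_iff hr] at h1
            linarith
        by_cases h2 : x ∈ ballF d n
        · rw [if_pos (Finset.mem_sdiff.2 ⟨h2, h1⟩)]
          have : max (sqn x - (n * (1 - ε)) ^ 2) 0 / (n ^ 2 - (n * (1 - ε)) ^ 2) ≤ 1 := by
            rw [div_le_one hΔ0]
            rw [mem_ballF, eunorm_le_iff hn.le] at h2
            exact max_le (by linarith) hΔ0.le
          have : 0 ≤ C ^ 2 / ε * (if x ∉ ballF d (n * (1 - δ)) then (1 : ℝ) else 0) := by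
            split_ifs <;> simp [hC2]
          linarith
        · have h3 : x ∉ ballF d (n * (1 - δ)) := by
            rw [mem_ballF] at h2 ⊢
            have : 0 ≤ n * δ := by positivity
            intro h; exact h2 (by linarith)
          rw [if_pos h3, if_neg fun h => h2 (Finset.mem_sdiff.1 h).1, zero_add, mul_one]
          have h4 := hA hx
          rw [mem_ballF, eunorm_le_iff (by positivity)] at h4
          rw [div_le_div_iff₀ hΔ0 hε]
          have h5 : max (sqn x - (n * (1 - ε)) ^ 2) 0 ≤ (C * n) ^ 2 :=
            max_le (by linarith [sq_nonneg (n * (1 - ε))]) (by positivity)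
          calc _ ≤ (C * n) ^ 2 * ε := mul_le_mul_of_nonneg_right h5 hε.le
            _ = C ^ 2 * (ε * n ^ 2) := by ring
            _ ≤ _ := mul_le_mul_of_nonneg_left hΔ (sq_nonneg C)
    _ = ((A.filter fun x => x ∈ ballF d n \ ballF d (n * (1 - ε))).card : ℝ)
        + C ^ 2 / ε * (A \ ballF d (n * (1 - δ))).card := by
        rw [Finset.sum_add_distrib, ← Finset.mul_sum, Finset.sum_boole, Finset.sum_boole,
          Finset.filter_notMem_eq_sdiff]
    _ ≤ _ := by
        gcongr
        exact fun x hx => (Finset.mem_filter.1 hx).2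

end Outer

section OuterMain

variable {d : ℕ} {Ω : Type*} [MeasurableSpace Ω] {P : Measure Ω}
  {I : ℕ → Ω → Finset (Fin d → ℤ)} {Y : ℕ → Ω → (Fin d → ℤ)}

/-- Few particles, weighted by the truncated quadratic function, are outside the inner ball. -/
lemma IsGrowth.eventually_sum_trunc_le (h : IsGrowth P I Y) (hd : 0 < d) {C ε : ℝ} (hC : 0 ≤ C)
    (hε : 0 < ε) (hε2 : ε ≤ 1 / 2) :
    ∀ᶠ n : ℕ in atTop, ∀ ω, ballF d (n * (1 - ε ^ 2)) ⊆ I (numP d n) ω →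
      I (numP d n) ω ⊆ ballF d (C * n) →
      ∑ x ∈ I (numP d n) ω,
        max (sqn x - (n * (1 - ε)) ^ 2) 0 / ((n : ℝ) ^ 2 - (n * (1 - ε)) ^ 2)
        ≤ (unitBallVol d * d + 2) * (1 + C ^ 2) * ε * n ^ d := by
  have hω : 0 < unitBallVol d := unitBallVol_pos
  set δ : ℝ := ε ^ 2 with hδ
  have hδ0 : 0 < δ := by positivity
  have hδε : δ ≤ ε := by nlinarith
  filter_upwards [eventually_ge_atTop 1, eventually_card_ballF_le d hδ0,
    eventually_le_card_ballF d hε.le (by linarith) hδ0,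
    h.eventually_card_sdiff_le hd hδ0.le (by linarith) hδ0] with n hn hc1 hc2 hc3 ω hωi hωc
  have hn0 : (0 : ℝ) < n := by exact_mod_cast hn
  refine (sum_trunc_le (δ := δ) hn0 hε (by linarith) hδ0.le hC hωc).trans ?_
  have g1 := hc3 ω hωi
  have hle : (n : ℝ) * (1 - ε) ≤ n := mul_le_of_le_one_right hn0.le (by linarith)
  have hsub : ballF d (n * (1 - ε)) ⊆ ballF d n := fun x hx => by
    rw [mem_ballF] at hx ⊢
    exact hx.trans hle
  have g2 : ((ballF d n \ ballF d (n * (1 - ε))).card : ℝ)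
      ≤ (unitBallVol d * d * ε + 2 * δ) * n ^ d := by
    rw [Finset.card_sdiff_of_subset hsub, Nat.cast_sub (Finset.card_le_card hsub)]
    linarith
  have g3 := mul_le_mul_of_nonneg_left g1 (by positivity : 0 ≤ C ^ 2 / ε)
  have g4 : C ^ 2 / ε * ((unitBallVol d * d * δ + δ) * (n : ℝ) ^ d)
      = C ^ 2 * ε * (unitBallVol d * d + 1) * n ^ d := by
    rw [hδ]; field_simp
  have g5 : (unitBallVol d * d * ε + 2 * δ) + C ^ 2 * ε * (unitBallVol d * d + 1)
      ≤ (unitBallVol d * d + 2) * (1 + C ^ 2) * ε := by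
    have : 0 ≤ C ^ 2 * ε := by positivity
    linarith
  have g6 := mul_le_mul_of_nonneg_right g5 (by positivity : 0 ≤ (n : ℝ) ^ d)
  linarith

/-- The outer bound, with an exponentially small error probability. -/
lemma IsGrowth.outer_bound_of_two_le [IsProbabilityMeasure P] (h : IsGrowth P I Y) (hd : 2 ≤ d)
    {ε : ℝ} (hε : 0 < ε) :
    ExpSmall fun n => P {ω | ¬ I (numP d n) ω ⊆ ballF d ((1 + ε) * n)} := by
  have hd0 : 0 < d := by omega
  obtain ⟨C, hC1, hcrude⟩ := h.outer_crude hd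
  obtain ⟨b, hb, H⟩ := h.measure_far_le hd0
  have hω : 0 < unitBallVol d := unitBallVol_pos
  set K : ℝ := (unitBallVol d * d + 2) * (1 + C ^ 2) with hK
  have hK0 : 0 < K := by positivity
  set M : ℝ := 4 * b * (4 / ε) ^ (d - 1) * K with hM
  have hM0 : 0 < M := by positivity
  obtain ⟨ε₁, hε₁, hε₁2, hMε⟩ : ∃ ε₁ : ℝ, 0 < ε₁ ∧ ε₁ ≤ 1 / 2 ∧ M * ε₁ ≤ ε / 16 := by
    refine ⟨min (1 / 2) (ε / (16 * M)), by positivity, min_le_left _ _, ?_⟩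
    calc M * min (1 / 2) (ε / (16 * M)) ≤ M * (ε / (16 * M)) :=
          mul_le_mul_of_nonneg_left (min_le_right _ _) hM0.le
      _ = ε / 16 := by field_simp
  set δ : ℝ := ε₁ ^ 2 with hδ
  have hδ0 : 0 < δ := by positivity
  have hδ2 : δ ≤ 1 / 2 := by nlinarith
  set E : ℕ → Set Ω := fun n =>
    {ω | ballF d (n * (1 - δ)) ⊆ I (numP d n) ω ∧ I (numP d n) ω ⊆ ballF d (C * n)} with hE
  suffices hmain : ExpSmall fun n =>
      P {ω | ω ∈ E n ∧ ¬ I (numP d n) ω ⊆ ballF d ((1 + ε) * n)} by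
    refine (((h.inner_bound hd0 hδ0 hδ2).add hcrude).add hmain).mono
      (Eventually.of_forall fun n => ?_)
    refine (measure_mono fun ω hω => ?_).trans ((measure_union_le _ _).trans
      (add_le_add_left (measure_union_le _ _) _))
    by_cases h1 : ballF d (n * (1 - δ)) ⊆ I (numP d n) ω
    · by_cases h2 : I (numP d n) ω ⊆ ballF d (C * n)
      · exact Or.inr ⟨⟨h1, h2⟩, hω⟩
      · exact Or.inl (Or.inr h2)
    · exact Or.inl (Or.inl h1)
  refine h.expSmall_not_subset (C := (ε / 4) ^ (d - 1) / (2 * b) * Real.exp 1) (c := ε / 16)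
    (k := d - 1) (by linarith) (by positivity) (by positivity) ?_
  set X : ℝ := 8 * b * (4 / ε) ^ (d - 1) * ((C + 1) ^ 2 / ε₁) with hX
  filter_upwards [eventually_ge_atTop 1,
    (tendsto_natCast_atTop_atTop (R := ℝ)).eventually_ge_atTop X,
    (tendsto_natCast_atTop_atTop (R := ℝ)).eventually_ge_atTop (2 / ε),
    h.eventually_sum_trunc_le hd0 (zero_le_one.trans hC1) hε₁ hε₁2]
    with n hn hnX hnε hsum z hz
  have hn1 : (1 : ℝ) ≤ n := by exact_mod_cast hn
  have hn0 : (0 : ℝ) < n := by linarith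
  have hpow : (n : ℝ) ^ d = n ^ (d - 1) * n := by
    rw [← pow_succ]; congr 1; omega
  have hnd : (n : ℝ) ≤ (n : ℝ) ^ (d - 1) := le_self_pow₀ hn1 (by omega)
  rw [div_le_iff₀ hε] at hnε
  set D : ℝ := ε * n / 4 with hD
  have hD0 : 0 < D := by positivity
  have hκ : b / D ^ (d - 1) = b * (4 / ε) ^ (d - 1) / n ^ (d - 1) := by
    rw [hD, mul_div_right_comm, mul_pow, div_pow, div_pow]
    field_simp
  have hκ' : (2 * (b / D ^ (d - 1)))⁻¹ = (ε / 4) ^ (d - 1) / (2 * b) * n ^ (d - 1) := by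
    rw [hD, mul_div_right_comm, mul_pow]
    field_simp
  set Δ : ℝ := (n : ℝ) ^ 2 - (n * (1 - ε₁)) ^ 2 with hΔ
  have hΔ1 : ε₁ * n ^ 2 ≤ Δ := by
    have : 0 ≤ (n : ℝ) ^ 2 * (ε₁ * (1 - ε₁)) := by
      have : 0 ≤ 1 - ε₁ := by linarith
      positivity
    linarith
  have hΔ0 : 0 < Δ := lt_of_lt_of_le (by positivity) hΔ1
  set φ : (Fin d → ℤ) → ℝ := fun x => max (sqn x - (n * (1 - ε₁)) ^ 2) 0 / Δ with hφ
  have hJ := Nat.sub_one_lt_floor D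
  have hJ' := Nat.floor_le hD0.le
  have key := H φ n D (K * ε₁ * n ^ d) (ballF d (C * n)) (numP d n) ⌊D⌋₊ z
    (fun x => by simp only [hφ]; positivity) (lap_trunc_nonneg hΔ0) (fun x hx => ?_) hn0.le hD0
    (fun x hx y hxy => ?_) ?_
  · have e1 : P {ω | z ∈ I (numP d n) ω ∧ ω ∈ E n} ≤ P {ω | z ∈ I (numP d n) ω ∧
        (↑(I (numP d n) ω) : Set (Fin d → ℤ)) ⊆ ballF d (C * n) ∧
        ∑ x ∈ I (numP d n) ω, φ x ≤ K * ε₁ * n ^ d} := by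
      refine measure_mono fun ω hω => ⟨hω.1, Finset.coe_subset.2 hω.2.2, ?_⟩
      exact hsum ω hω.2.1 hω.2.2
    refine e1.trans (key.trans (ENNReal.ofReal_le_ofReal ?_))
    have e2 : 4 * (b / D ^ (d - 1)) * (K * ε₁ * n ^ d) = M * ε₁ * n := by
      rw [hκ, hpow, hM]; field_simp
    have e3 : (D - 1) * (1 / 2) ≤ ⌊D⌋₊ * Real.log 2 := by
      have hlog : 1 / 2 ≤ Real.log 2 := by linarith [Real.log_two_gt_d9]
      have : (0 : ℝ) ≤ ⌊D⌋₊ := Nat.cast_nonneg _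
      nlinarith
    have e4 : M * ε₁ * n ≤ ε / 16 * n := mul_le_mul_of_nonneg_right hMε hn0.le
    rw [hκ', e2]
    have e5 : Real.exp (M * ε₁ * n - ⌊D⌋₊ * Real.log 2) ≤ Real.exp (-(ε / 16 * n) + 1) := by
      refine Real.exp_le_exp.2 ?_
      have : (D - 1) * (1 / 2) = ε / 16 * n * 2 - 1 / 2 := by rw [hD]; ring
      linarith
    rw [Real.exp_add] at e5
    have e6 := mul_le_mul_of_nonneg_left e5
      (by positivity : 0 ≤ (ε / 4) ^ (d - 1) / (2 * b) * (n : ℝ) ^ (d - 1))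
    linarith
  · simp only [hφ]
    rw [le_div_iff₀ hΔ0, one_mul]
    refine le_max_of_le_left ?_
    have : (n : ℝ) ^ 2 < eunorm x ^ 2 := pow_lt_pow_left₀ hx hn0.le two_ne_zero
    rw [eunorm_sq] at this
    linarith
  · have h1 : eunorm y ≤ (C + 1) * n := by
      have h2 := eunorm_le_of_mem_latNbrs hxy
      have h3 := mem_ballF.1 (Finset.mem_coe.1 hx)
      linarith
    rw [eunorm_le_iff (by positivity)] at h1
    have h2 : φ y ≤ (C + 1) ^ 2 / ε₁ := by
      simp only [hφ]
      rw [div_le_div_iff₀ hΔ0 hε₁]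
      calc _ ≤ ((C + 1) * n) ^ 2 * ε₁ := mul_le_mul_of_nonneg_right
            (max_le (by linarith [sq_nonneg ((n : ℝ) * (1 - ε₁))]) (by positivity)) hε₁.le
        _ = (C + 1) ^ 2 * (ε₁ * n ^ 2) := by ring
        _ ≤ _ := mul_le_mul_of_nonneg_left hΔ1 (sq_nonneg _)
    calc 4 * (b / D ^ (d - 1)) * φ y ≤ 4 * (b / D ^ (d - 1)) * ((C + 1) ^ 2 / ε₁) :=
          mul_le_mul_of_nonneg_left h2 (by positivity)
      _ = X / 2 / n ^ (d - 1) := by rw [hκ, hX]; ring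
      _ ≤ 1 / 2 := by
          rw [div_le_iff₀ (by positivity)]
          linarith
  · have : (1 : ℝ) ≤ ε * n / 2 := by linarith
    rw [hD] at hJ' ⊢
    linarith

end OuterMain

section Line

variable {Ω : Type*} [MeasurableSpace Ω] {P : Measure Ω}
  {I : ℕ → Ω → Finset (Fin 1 → ℤ)} {Y : ℕ → Ω → (Fin 1 → ℤ)}

/-- In dimension one the cluster is an interval. -/
lemma IsGrowth.interval (h : IsGrowth P I Y) (N : ℕ) (ω : Ω) : ∀ z ∈ I N ω, ∀ w : Fin 1 → ℤ,
    (0 ≤ w 0 ∧ w 0 ≤ z 0) ∨ (z 0 ≤ w 0 ∧ w 0 ≤ 0) → w ∈ I N ω := by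
  have ext1 : ∀ w z : Fin 1 → ℤ, w 0 = z 0 → w = z := fun w z e => by
    funext i; rw [Subsingleton.elim i 0]; exact e
  induction N with
  | zero =>
    intro z hz w hw
    rw [h.init, Finset.mem_singleton] at hz ⊢
    subst hz
    refine ext1 _ _ ?_
    simp only [Pi.zero_apply] at hw ⊢
    omega
  | succ N ih =>
    intro z hz w hw
    rw [h.step, Finset.mem_insert] at hz ⊢
    rcases hz with rfl | hz
    swap
    · exact Or.inr (ih z hz w hw)
    set y := Y (N + 1) ω
    obtain ⟨⟨x, hx, hxy⟩, hyI⟩ := mem_bdryF.1 (h.bdry N ω)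
    by_cases hwy : w 0 = y 0
    · exact Or.inl (ext1 _ _ hwy)
    right
    have hxy' : y 0 = x 0 + 1 ∨ y 0 = x 0 - 1 := by
      obtain ⟨i, hi⟩ := mem_latNbrs.1 hxy
      rw [Subsingleton.elim i 0] at hi
      rcases hi with hi | hi
      · left; rw [show y = _ from hi]; simp
      · right; rw [show y = _ from hi]; simp
    have hy' : ¬ ((0 ≤ y 0 ∧ y 0 ≤ x 0) ∨ (x 0 ≤ y 0 ∧ y 0 ≤ 0)) := fun hc => hyI (ih x hx y hc)
    exact ih x hx w (by omega)

lemma eunorm_fin_one (x : Fin 1 → ℤ) : eunorm x = |(x 0 : ℝ)| := by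
  rw [eunorm, Fin.sum_univ_one, Real.sqrt_sq_eq_abs]

/-- The outer bound in dimension one. -/
lemma IsGrowth.outer_bound_one [IsProbabilityMeasure P] (h : IsGrowth P I Y)
    {ε : ℝ} (hε : 0 < ε) :
    ExpSmall fun n => P {ω | ¬ I (numP 1 n) ω ⊆ ballF 1 ((1 + ε) * n)} := by
  have hω : 0 < unitBallVol 1 := unitBallVol_pos
  obtain ⟨δ, hδ, hδ2, hδε⟩ : ∃ δ : ℝ, 0 < δ ∧ δ ≤ 1 / 2 ∧ unitBallVol 1 * δ ≤ ε / 4 := by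
    refine ⟨min (1 / 2) (ε / (4 * unitBallVol 1)), by positivity, min_le_left _ _, ?_⟩
    calc _ ≤ unitBallVol 1 * (ε / (4 * unitBallVol 1)) :=
          mul_le_mul_of_nonneg_left (min_le_right _ _) hω.le
      _ = _ := by field_simp
  refine (h.inner_bound one_pos hδ hδ2).mono ?_
  filter_upwards [h.eventually_card_sdiff_le one_pos hδ.le (by linarith) (show 0 < ε / 4 by linarith),
    (tendsto_natCast_atTop_atTop (R := ℝ)).eventually_ge_atTop (4 / ε)] with n hc hn
  have hn0 : (0 : ℝ) < n := lt_of_lt_of_le (by positivity) hn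
  rw [div_le_iff₀ hε] at hn
  refine measure_mono fun ω hω' hsub => hω' fun z hz => ?_
  have hc' := hc ω hsub
  rw [mem_ballF, eunorm_fin_one]
  by_contra hlt
  rw [not_le] at hlt
  set s : ℤ := if 0 ≤ z 0 then 1 else -1 with hs
  set f : ℕ → Fin 1 → ℤ := fun j _ => z 0 - s * j with hf
  have hinj : Function.Injective f := by
    intro i j hij
    have := congrFun hij 0
    simp only [hf, hs] at this
    split_ifs at this <;> omega
  have hsubs : (Finset.range ⌊ε * n⌋₊).image f
      ⊆ I (numP 1 n) ω \ ballF 1 (n * (1 - δ)) := by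
    intro w hw
    obtain ⟨j, hj, rfl⟩ := Finset.mem_image.1 hw
    have hj1 : (j : ℝ) ≤ ε * n :=
      (Nat.cast_le.2 (Finset.mem_range.1 hj).le).trans (Nat.floor_le (by positivity))
    have hsj : (f j 0 : ℝ) = z 0 - s * j := by simp [hf]
    have hjz : (j : ℝ) ≤ |(z 0 : ℝ)| := by linarith
    have hjz' : (j : ℤ) ≤ |z 0| := by exact_mod_cast hjz
    have habs : |(f j 0 : ℝ)| = |(z 0 : ℝ)| - j := by
      rw [hsj]
      by_cases h0 : 0 ≤ z 0
      · have h0' : (0 : ℝ) ≤ z 0 := by exact_mod_cast h0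
        rw [abs_of_nonneg h0'] at hjz ⊢
        simp only [hs, if_pos h0, Int.cast_one, one_mul]
        exact abs_of_nonneg (by linarith)
      · have h0' : (z 0 : ℝ) < 0 := by exact_mod_cast not_le.1 h0
        rw [abs_of_neg h0'] at hjz ⊢
        simp only [hs, if_neg h0, Int.cast_neg, Int.cast_one]
        rw [abs_of_nonpos (by linarith)]; ring
    rw [Finset.mem_sdiff, mem_ballF, eunorm_fin_one, habs]
    refine ⟨h.interval _ ω z hz _ ?_, ?_⟩
    · simp only [hf, hs]
      split_ifs with h0
      · rw [abs_of_nonneg h0] at hjz'; omega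
      · rw [abs_of_neg (not_le.1 h0)] at hjz'; omega
    · have : 0 < n * δ := by positivity
      rw [not_le]
      linarith
  have hcard := Finset.card_le_card hsubs
  rw [Finset.card_image_of_injective _ hinj, Finset.card_range] at hcard
  have hcard' : (⌊ε * n⌋₊ : ℝ) ≤ (I (numP 1 n) ω \ ballF 1 (n * (1 - δ))).card := by
    exact_mod_cast hcard
  have hfl := Nat.sub_one_lt_floor (ε * (n : ℝ))
  rw [pow_one, Nat.cast_one, mul_one] at hc'
  have := mul_le_mul_of_nonneg_right hδε hn0.le
  linarith

end Line

lemma IsGrowth.outer_bound {d : ℕ} {Ω : Type*} [MeasurableSpace Ω] {P : Measure Ω}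
    [IsProbabilityMeasure P] {I : ℕ → Ω → Finset (Fin d → ℤ)} {Y : ℕ → Ω → (Fin d → ℤ)}
    (h : IsGrowth P I Y) (hd : 0 < d) {ε : ℝ} (hε : 0 < ε) :
    ExpSmall fun n => P {ω | ¬ I (numP d n) ω ⊆ ballF d ((1 + ε) * n)} := by
  obtain rfl | hd2 : d = 1 ∨ 2 ≤ d := by omega
  · exact h.outer_bound_one hε
  · exact h.outer_bound_of_two_le hd2 hε

lemma IsGrowth.pos {d : ℕ} {Ω : Type*} [MeasurableSpace Ω] {P : Measure Ω}
    [IsProbabilityMeasure P] {I : ℕ → Ω → Finset (Fin d → ℤ)} {Y : ℕ → Ω → (Fin d → ℤ)}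
    (h : IsGrowth P I Y) : 0 < d := by
  rw [Nat.pos_iff_ne_zero]
  rintro rfl
  obtain ⟨ω⟩ := nonempty_of_isProbabilityMeasure P
  obtain ⟨⟨x, _, hxy⟩, _⟩ := mem_bdryF.1 (h.bdry 0 ω)
  obtain ⟨i, _⟩ := mem_latNbrs.1 hxy
  exact i.elim0

end InternalDLA

/-- **Internal DLA on ℤ^d: the limit shape is a ball (Lawler–Bramson–Griffeath).**
At time `⌊ω_d n^d⌋` the internal DLA cluster occupies a set of sites close to a
`d`-dimensional ball of radius `n`: for any `ε > 0`, with probability one,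
`B_{n(1-ε)} ⊆ I_{⌊ω_d n^d⌋} ⊆ B_{n(1+ε)}` for all large `n`. -/
theorem internal_dla_limit_shape_Zd
    (d : ℕ)
    {Ω : Type*} [MeasurableSpace Ω] (P : Measure Ω) [IsProbabilityMeasure P]
    (I : ℕ → Ω → Finset (Fin d → ℤ)) (Y : ℕ → Ω → (Fin d → ℤ))
    -- dynamics of the internal DLA chain: `Y (n+1)` is the first exit location from
    -- `I n` of a simple random walk started at the origin, independent of the past
    (h0 : ∀ ω, I 0 ω = {0})
    (hstep : ∀ n ω, I (n+1) ω = insert (Y (n+1) ω) (I n ω))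
    (hbd : ∀ n ω, Y (n+1) ω ∈ bdryF latNbrs (I n ω))
    (hlaw : ∀ (n : ℕ) (A : Finset (Fin d → ℤ)), ∀ y ∈ bdryF latNbrs A,
      P {ω | I n ω = A ∧ Y (n+1) ω = y}
        = ENNReal.ofReal (hitMeas latNbrs (↑(bdryF latNbrs A)) 0 y) *
          P {ω | I n ω = A}) :
    ∀ ε : ℝ, 0 < ε → ∀ᵐ ω ∂P, ∀ᶠ n : ℕ in atTop,
      (latBall ((n : ℝ) * (1 - ε)) : Set (Fin d → ℤ)) ⊆
        (I (⌊unitBallVol d * (n : ℝ) ^ d⌋₊) ω : Set (Fin d → ℤ)) ∧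
      (I (⌊unitBallVol d * (n : ℝ) ^ d⌋₊) ω : Set (Fin d → ℤ)) ⊆
        (latBall ((n : ℝ) * (1 + ε)) : Set (Fin d → ℤ)) := by
  intro ε hε
  have h : InternalDLA.IsGrowth P I Y := ⟨h0, hstep, hbd, hlaw⟩
  have hin := (h.inner_bound h.pos (ε := min ε (1 / 2)) (by positivity)
    (min_le_right _ _)).ae_eventually
  have hout := (h.outer_bound h.pos hε).ae_eventually
  filter_upwards [hin, hout] with ω h1 h2
  filter_upwards [h1, h2] with n h3 h4
  rw [not_not] at h3 h4
  refine ⟨fun x hx => h3 (InternalDLA.mem_ballF.2 ?_), fun x hx => ?_⟩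
  · refine le_trans (show eunorm x ≤ n * (1 - ε) from hx) ?_
    gcongr
    exact min_le_left _ _
  · have := InternalDLA.mem_ballF.1 (h4 hx)
    rw [mul_comm] at this
    exact this
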